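/- Let d ≥ 2. There exist positive constants c₁, c₂, C₁, C₂ depending only on the dimension d such that, almost surely, for all sufficiently large n, B[n(1 − C₁ n^{−c₁})] ⊆ A_{b_n} ⊆ B[n(1 + C₂ n^{−c₂})], where A_{b_n} is the uIDLA aggregate with b_n particles. -/

import Mathlib

open MeasureTheory Filter
open scoped ENNReal

noncomputable section

/-- The `k`-th binary digit of `x ∈ [0,1)` (after the binary point). -/
def bit (x : ℝ) (k : ℕ) : Bool := ⌊x * 2 ^ (k + 1)⌋ % 2 == 1

/-- From one uniform sample on `[0,1]`, extract countably many independent uniform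
samples on `[0,1]`, using disjoint subsequences of binary digits. -/
def uSlice (x : ℝ) (i : ℕ) : ℝ :=
  ∑' j : ℕ, if bit x (Nat.pair i j) then ((2 : ℝ) ^ (-(j : ℤ) - 1)) else 0

/-- The base probability space: Lebesgue measure restricted to `[0,1]`. -/
def μ0 : Measure ℝ := volume.restrict (Set.Icc 0 1)

/-- The vertex set of the lattice `ℤ^d`. -/
abbrev V (d : ℕ) := Fin d → ℤ

instance (d : ℕ) : MeasurableSpace (Finset (V d)) := ⊤

open Classical in
/-- `B[r]`: the Euclidean ball of radius `r` in `ℤ^d`, as a `Finset`. -/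
def ball (d : ℕ) (r : ℝ) : Finset (V d) :=
  (Finset.Icc (fun _ => -⌈r⌉) (fun _ => ⌈r⌉)).filter
    (fun y => Real.sqrt (∑ i, ((y i : ℝ)) ^ 2) ≤ r)

/-- `b_n`: the number of lattice points in the Euclidean ball of radius `n`. -/
def bn (d n : ℕ) : ℕ := (ball d n).card

/-- The `2d` unit vectors of `ℤ^d` (the possible steps of the simple random walk). -/
def unitVecs (d : ℕ) : Finset (V d) :=
  Finset.image
    (fun p : Fin d × Bool => fun j => if j = p.1 then (if p.2 then 1 else -1) else 0)
    Finset.univ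

/-- Given `u` uniform on `[0,1]`, `pick S u` is a uniformly chosen element of `S`. -/
def pick {d : ℕ} (S : Finset (V d)) (u : ℝ) : V d :=
  if h : S.Nonempty then
    (S.equivFin.symm ⟨(⌊u * S.card⌋).toNat % S.card,
      Nat.mod_lt _ (Finset.card_pos.mpr h)⟩).val
  else 0

/-- Position at time `t` of the simple random walk started at `x`, driven by the
random seed `ω`: the steps `pick (unitVecs d) (uSlice ω i)` are i.i.d. uniform on
the `2d` unit vectors when `ω` is uniform on `[0,1]`. -/
def walk {d : ℕ} (x : V d) (ω : ℝ) (t : ℕ) : V d :=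
  x + ∑ i ∈ Finset.range t, pick (unitVecs d) (uSlice ω i)

/-- `t_S`: the first time the walk started at `x` is outside `S`. -/
def exitT {d : ℕ} (S : Finset (V d)) (x : V d) (ω : ℝ) : ℕ :=
  sInf {t | walk x ω t ∉ S}

/-- The position `ξ(t_S)` at which the walk started at `x` first exits `S`. -/
def hitPt {d : ℕ} (S : Finset (V d)) (x : V d) (ω : ℝ) : V d :=
  walk x ω (exitT S x ω)

/-- `Add[ξ,S]`: add to `S` the exit point of a random walk started at `x`. -/
def addPt {d : ℕ} (S : Finset (V d)) (x : V d) (ω : ℝ) : Finset (V d) :=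
  insert (hitPt S x ω) S

/-- `P_x(ξ(τ_A) = y)`: the probability that the walk started at `x` exits `A` at `y`. -/
def hitProb {d : ℕ} (A : Finset (V d)) (x y : V d) : ℝ≥0∞ :=
  μ0 {ω | hitPt A x ω = y}

/-- The outer boundary `∂A`: vertices outside `A` with a neighbour in `A`. -/
def outb {d : ℕ} (A : Finset (V d)) : Finset (V d) :=
  (A.biUnion fun x => (unitVecs d).image (fun e => x + e)) \ A

/-- `DA_X(S)`: the IDLA aggregate obtained from `S` by launching one particle from each
point of the list `xs` in turn (driven by independent slices of the seed `ω`). -/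
def daFrom {d : ℕ} : Finset (V d) → List (V d) → ℝ → Finset (V d)
  | S, [], _ => S
  | S, x :: xs, ω => daFrom (addPt S x (uSlice ω 0)) xs (uSlice ω 1)

/-- The law of the IDLA aggregate `DA_X(S)`. -/
def daLaw {d : ℕ} (S : Finset (V d)) (xs : List (V d)) : Measure (Finset (V d)) :=
  μ0.map (fun ω => daFrom S xs ω)

/-- One uIDLA step: launch a particle from a uniformly chosen point of `S`. -/
def uStep {d : ℕ} (S : Finset (V d)) (ω : ℝ) : Finset (V d) :=
  addPt S (pick S (uSlice ω 0)) (uSlice ω 1)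

/-- `A_k(S)`: the uIDLA aggregate obtained by adding `k` particles to `S`,
each started at a uniform point of the current aggregate. -/
def uAggFrom {d : ℕ} (S : Finset (V d)) (ω : ℝ) : ℕ → Finset (V d)
  | 0 => S
  | k + 1 => uStep (uAggFrom S ω k) (uSlice ω k)

/-- The law of the uIDLA aggregate `A_k(S)`. -/
def uLaw {d : ℕ} (S : Finset (V d)) (k : ℕ) : Measure (Finset (V d)) :=
  μ0.map (fun ω => uAggFrom S ω k)

/-- One step of the subset uIDLA `A_·(E;m)`: at step `k`, perform a uIDLA step
with probability `|E|/(m+k)` and otherwise do nothing. -/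
def subStep {d : ℕ} (m k : ℕ) (E : Finset (V d)) (ω : ℝ) : Finset (V d) :=
  if uSlice ω 0 * ((m : ℝ) + k) ≤ E.card then uStep E (uSlice ω 1) else E

/-- The subset uIDLA `A_n(E;m)`. -/
def subAggFrom {d : ℕ} (E : Finset (V d)) (m : ℕ) (ω : ℝ) : ℕ → Finset (V d)
  | 0 => E
  | k + 1 => subStep m k (subAggFrom E m ω k) (uSlice ω k)

/-- The law of the subset uIDLA `A_n(E;m)`. -/
def subLaw {d : ℕ} (E : Finset (V d)) (m k : ℕ) : Measure (Finset (V d)) :=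
  μ0.map (fun ω => subAggFrom E m ω k)

/-- Stochastic domination of random finite subsets of `ℤ^d`: `μ` dominates `ν` if
there is a coupling under which the sample of `ν` is a.s. contained in that of `μ`. -/
def StochDom {d : ℕ} (μ ν : Measure (Finset (V d))) : Prop :=
  ∃ π : Measure (Finset (V d) × Finset (V d)), IsProbabilityMeasure π ∧
    π.map Prod.fst = μ ∧ π.map Prod.snd = ν ∧ π {p | p.2 ⊆ p.1} = 1

/-- A `Geometric(1/2)` sample (taking value `j ≥ 0` with probability `2^{-(j+1)}`)
produced from a uniform sample `u` on `[0,1]` by inverting the CDF. -/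
def geom (u : ℝ) : ℕ := sInf {j : ℕ | u ≤ 1 - (2 : ℝ) ^ (-(j : ℤ) - 1)}

/-- The parent of vertex `j ≥ 1` in the uniform random recursive tree (vertex `0` is
the root): uniform on `{0, …, j-1}` when the seed is uniform on `[0,1]`. -/
def parent (ω : ℝ) (j : ℕ) : ℕ := (⌊uSlice ω (Nat.pair 0 j) * j⌋).toNat % j

/-- The reaching time of vertex `j` in a uniform random recursive tree whose edges
carry i.i.d. `Geometric(1/2)` weights: the sum of the weights on the path from the
root to `j`. (The `min` is a.s. inoperative, since a.s. `parent ω (j+1) ≤ j`.) -/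
def reach (ω : ℝ) : ℕ → ℕ
  | 0 => 0
  | j + 1 => reach ω (min (parent ω (j + 1)) j) + geom (uSlice ω (Nat.pair 1 (j + 1)))
termination_by j => j
decreasing_by exact Nat.lt_succ_of_le (min_le_right _ _)

end

section

/-! ### Bits and slices -/

instance isProb_mu0 : IsProbabilityMeasure μ0 := by
  constructor
  simp [μ0]

lemma mu0_eq_Ico : μ0 = volume.restrict (Set.Ico (0:ℝ) 1) := by
  unfold μ0
  exact (Measure.restrict_congr_set Ico_ae_eq_Icc).symm

lemma ae_mu0_Ico : ∀ᵐ ω ∂μ0, ω ∈ Set.Ico (0:ℝ) 1 := by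
  rw [mu0_eq_Ico]
  exact ae_restrict_mem measurableSet_Ico

lemma measurable_bit (k : ℕ) : Measurable (fun x => bit x k) := by
  unfold bit
  have h1 : Measurable (fun x : ℝ => ⌊x * 2 ^ (k + 1)⌋) :=
    Int.measurable_floor.comp (measurable_id.mul_const _)
  exact (measurable_of_countable (fun m : ℤ => (m % 2 == 1))).comp h1

noncomputable def coin : Measure Bool := μ0.map (fun x => bit x 0)

instance isProb_coin : IsProbabilityMeasure coin :=
  Measure.isProbabilityMeasure_map (measurable_bit 0).aemeasurable

lemma bit_zero_of_mem {x : ℝ} (hx : x ∈ Set.Ico (0:ℝ) 1) :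
    bit x 0 = decide (1/2 ≤ x) := by
  obtain ⟨h0, h1⟩ := hx
  unfold bit
  by_cases h : 1/2 ≤ x
  · have : ⌊x * 2 ^ (0+1)⌋ = 1 := by
      rw [Int.floor_eq_iff]; norm_num; constructor <;> linarith
    rw [this]; simp; norm_num at h; linarith
  · have : ⌊x * 2 ^ (0+1)⌋ = 0 := by
      rw [Int.floor_eq_iff]; norm_num; push Not at h; constructor <;> linarith
    rw [this]; simp; norm_num at h; linarith

lemma bit_succ (x : ℝ) (k : ℕ) : bit x (k+1) = bit (Int.fract (2*x)) k := by
  unfold bit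
  have : Int.fract (2*x) * 2^(k+1) = x * 2^(k+1+1) - ((⌊2*x⌋ * 2^(k+1) : ℤ) : ℝ) := by
    rw [Int.fract]; push_cast; ring
  rw [this, Int.floor_sub_intCast]
  have h2 : (⌊2*x⌋ * 2^(k+1)) % 2 = 0 := by
    exact Int.emod_eq_zero_of_dvd (dvd_mul_of_dvd_right (dvd_pow_self 2 (by omega)) _)
  generalize ⌊2*x⌋ * 2^(k+1) = a at *
  congr 1
  omega

lemma mu0_apply {E : Set ℝ} (hE : MeasurableSet E) : μ0 E = volume (E ∩ Set.Ico 0 1) := by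
  rw [mu0_eq_Ico, Measure.restrict_apply hE]

lemma half_lemma {E : Set ℝ} (hE : MeasurableSet E) (b : Bool) :
    μ0 {ω | bit ω 0 = b ∧ Int.fract (2*ω) ∈ E} = 2⁻¹ * μ0 E := by
  have hm : MeasurableSet {ω : ℝ | bit ω 0 = b ∧ Int.fract (2*ω) ∈ E} := by
    apply MeasurableSet.inter
    · exact measurable_bit 0 (measurableSet_singleton b)
    · exact (measurable_fract.comp (measurable_id.const_mul 2)) hE
  rw [mu0_apply hm, mu0_apply hE]
  have key : {ω : ℝ | bit ω 0 = b ∧ Int.fract (2*ω) ∈ E} ∩ Set.Ico 0 1 =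
      (fun x => 2 * x) ⁻¹' ((fun x => x + (if b then (-1:ℝ) else 0)) ⁻¹' (E ∩ Set.Ico 0 1)) := by
    ext x
    simp only [Set.mem_inter_iff, Set.mem_ofPred_eq, Set.mem_preimage]
    constructor
    · rintro ⟨⟨h1, h2⟩, h3⟩
      rw [bit_zero_of_mem h3] at h1
      obtain ⟨h30, h31⟩ := h3
      by_cases h : 1/2 ≤ x
      · have hf : ⌊2*x⌋ = 1 := by rw [Int.floor_eq_iff]; push_cast; constructor <;> linarith
        have hb : b = true := by rw [← h1]; simpa using h
        subst hb
        rw [Int.fract, hf] at h2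
        push_cast at h2
        refine ⟨by simpa [sub_eq_add_neg] using h2, ?_, ?_⟩ <;> simp <;> linarith
      · have hf : ⌊2*x⌋ = 0 := by
          push Not at h
          rw [Int.floor_eq_iff]; push_cast; constructor <;> linarith
        have hb : b = false := by rw [← h1]; simpa using h
        subst hb
        rw [Int.fract, hf] at h2
        push Not at h
        refine ⟨by simpa using h2, ?_, ?_⟩ <;> simp <;> linarith
    · rintro ⟨h2, h3, h4⟩
      cases b
      · simp at h2 h3 h4
        have hx : x ∈ Set.Ico (0:ℝ) 1 := ⟨by linarith, by linarith⟩
        have hf : ⌊2*x⌋ = 0 := by rw [Int.floor_eq_iff]; push_cast; constructor <;> linarith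
        refine ⟨⟨?_, ?_⟩, hx⟩
        · rw [bit_zero_of_mem hx]; simp; linarith
        · rw [Int.fract, hf]; simpa using h2
      · simp at h2 h3 h4
        have hx : x ∈ Set.Ico (0:ℝ) 1 := ⟨by linarith, by linarith⟩
        have hf : ⌊2*x⌋ = 1 := by rw [Int.floor_eq_iff]; push_cast; constructor <;> linarith
        refine ⟨⟨?_, ?_⟩, hx⟩
        · rw [bit_zero_of_mem hx]; simp; linarith
        · rw [Int.fract, hf]; simpa [sub_eq_add_neg] using h2
  rw [key, Real.volume_preimage_mul_left (by norm_num : (2:ℝ) ≠ 0), measure_preimage_add_right]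
  congr 1
  rw [abs_of_pos (by norm_num)]
  rw [ENNReal.ofReal_inv_of_pos (by norm_num)]
  simp

lemma coin_singleton (b : Bool) : coin {b} = 2⁻¹ := by
  rw [coin, Measure.map_apply (measurable_bit 0) (measurableSet_singleton b)]
  have := half_lemma MeasurableSet.univ b
  simpa [Set.preimage] using this

lemma bit_split {E : Set ℝ} (hE : MeasurableSet E) (t : Set Bool) :
    μ0 {ω | bit ω 0 ∈ t ∧ Int.fract (2*ω) ∈ E} = coin t * μ0 E := by
  have hm : ∀ b, MeasurableSet {ω : ℝ | bit ω 0 = b ∧ Int.fract (2*ω) ∈ E} := by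
    intro b
    apply MeasurableSet.inter
    · exact measurable_bit 0 (measurableSet_singleton b)
    · exact (measurable_fract.comp (measurable_id.const_mul 2)) hE
  have ht : t.Finite := Set.toFinite t
  induction t, ht using Set.Finite.induction_on with
  | empty => simp
  | @insert a s ha hs ih =>
    have : {ω : ℝ | bit ω 0 ∈ insert a s ∧ Int.fract (2*ω) ∈ E} =
      {ω | bit ω 0 = a ∧ Int.fract (2*ω) ∈ E} ∪ {ω | bit ω 0 ∈ s ∧ Int.fract (2*ω) ∈ E} := by
      ext x; simp; tauto
    rw [this, measure_union' _ (hm a), ih, half_lemma hE, ← coin_singleton a, ← add_mul]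
    · congr 1
      rw [Set.insert_eq, measure_union' (by simpa using ha) (measurableSet_singleton a)]
    · rw [Set.disjoint_left]
      rintro x ⟨h1, _⟩ ⟨h2, _⟩
      exact ha (h1 ▸ h2)

lemma bits_cyl (n : ℕ) : ∀ t : ℕ → Set Bool,
    μ0 {ω | ∀ i < n, bit ω i ∈ t i} = ∏ i ∈ Finset.range n, coin (t i) := by
  induction n with
  | zero => intro t; simp
  | succ n ih =>
    intro t
    have hs : {ω | ∀ i < n+1, bit ω i ∈ t i} =
        {ω | bit ω 0 ∈ t 0 ∧ Int.fract (2*ω) ∈ {x | ∀ i < n, bit x i ∈ t (i+1)}} := by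
      ext ω
      simp only [Set.mem_ofPred_eq]
      constructor
      · intro h
        refine ⟨h 0 (by omega), fun i hi => ?_⟩
        rw [← bit_succ]; exact h (i+1) (by omega)
      · rintro ⟨h0, h⟩ i hi
        cases i with
        | zero => exact h0
        | succ i => rw [bit_succ]; exact h i (by omega)
    have hm : MeasurableSet {x | ∀ i < n, bit x i ∈ t (i+1)} := by
      have : {x | ∀ i < n, bit x i ∈ t (i+1)} = ⋂ i, ⋂ (_ : i < n), {x | bit x i ∈ t (i+1)} := by
        ext; simp
      rw [this]
      exact MeasurableSet.iInter fun i => MeasurableSet.iInter fun _ =>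
        measurable_bit i (Set.toFinite _).measurableSet
    rw [hs, bit_split hm, ih, Finset.prod_range_succ', mul_comm]

lemma measurable_bits : Measurable (fun (ω : ℝ) (k : ℕ) => bit ω k) :=
  measurable_pi_lambda _ measurable_bit

lemma bits_law : μ0.map (fun ω k => bit ω k) = Measure.infinitePi (fun _ : ℕ => coin) := by
  classical
  apply Measure.eq_infinitePi
  intro s t ht
  rw [Measure.map_apply measurable_bits (MeasurableSet.pi s.countable_toSet fun i _ => ht i)]
  obtain ⟨n, hn⟩ : ∃ n, s ⊆ Finset.range n := by
    refine ⟨s.sup id + 1, fun i hi => ?_⟩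
    rw [Finset.mem_range, Nat.lt_succ_iff]
    exact Finset.le_sup (f := id) hi
  have := bits_cyl n (fun i => if i ∈ s then t i else Set.univ)
  have h2 : {ω | ∀ i < n, bit ω i ∈ (if i ∈ s then t i else Set.univ)} =
      (fun (ω : ℝ) (k : ℕ) => bit ω k) ⁻¹' ((s : Set ℕ).pi t) := by
    ext ω
    simp only [Set.mem_ofPred_eq, Set.mem_preimage, Set.mem_pi, Finset.mem_coe]
    constructor
    · intro h i hi
      have := h i (Finset.mem_range.1 (hn hi))
      simpa [hi] using this
    · intro h i _
      by_cases hi : i ∈ s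
      · simpa [hi] using h i hi
      · simp [hi]
  rw [h2] at this
  rw [this, ← Finset.prod_subset hn]
  · apply Finset.prod_congr rfl
    intro i hi; simp [hi]
  · intro i _ hi; rw [if_neg hi]; exact measure_univ

noncomputable def dsum (b : ℕ → Bool) : ℝ := ∑' j : ℕ, if b j then ((2 : ℝ) ^ (-(j : ℤ) - 1)) else 0

lemma summable_two_pow : Summable (fun j : ℕ => (2:ℝ) ^ (-(j : ℤ) - 1)) := by
  have : (fun j : ℕ => (2:ℝ) ^ (-(j : ℤ) - 1)) = fun j : ℕ => (1/2:ℝ) ^ j * (1/2) := by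
    ext j
    rw [zpow_sub₀ (by norm_num), zpow_neg]; simp; ring
  rw [this]
  exact (summable_geometric_of_lt_one (by norm_num) (by norm_num)).mul_right _

lemma summable_dsum (b : ℕ → Bool) :
    Summable (fun j : ℕ => if b j then ((2 : ℝ) ^ (-(j : ℤ) - 1)) else 0) := by
  refine Summable.of_nonneg_of_le (fun j => ?_) (fun j => ?_) summable_two_pow
  · split_ifs <;> positivity
  · split_ifs
    · exact le_rfl
    · positivity

lemma dsum_partial (x : ℝ) (hx : x ∈ Set.Ico (0:ℝ) 1) (n : ℕ) :
    ∑ j ∈ Finset.range n, (if bit x j then ((2 : ℝ) ^ (-(j : ℤ) - 1)) else 0) =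
      ⌊x * 2^n⌋ / 2^n := by
  induction n with
  | zero =>
    have : ⌊x⌋ = 0 := by rw [Int.floor_eq_iff]; simpa using hx
    simp [this]
  | succ n ih =>
    rw [Finset.sum_range_succ, ih]
    have hp : (2:ℝ) ^ (-(n:ℤ) - 1) = 1 / 2^(n+1) := by
      rw [zpow_sub₀ (by norm_num), zpow_neg]; simp [pow_succ]; ring
    have h1 : ⌊x * 2^n⌋ = ⌊x * 2^(n+1)⌋ / 2 := by
      have : x * 2^n = (x * 2^(n+1)) / (2:ℕ) := by push_cast; rw [pow_succ]; ring
      rw [this, Int.floor_div_natCast]; norm_num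
    have h2 := Int.mul_ediv_add_emod ⌊x * 2^(n+1)⌋ 2
    rw [← h1] at h2
    rw [hp]
    unfold bit
    rcases Int.emod_two_eq_zero_or_one ⌊x * 2^(n+1)⌋ with h | h
    · rw [h] at h2 ⊢
      rw [← h2]; push_cast; simp [pow_succ]; field_simp
    · rw [h] at h2 ⊢
      rw [← h2]; push_cast; simp [pow_succ]; field_simp

lemma dsum_bits (x : ℝ) (hx : x ∈ Set.Ico (0:ℝ) 1) : dsum (fun k => bit x k) = x := by
  have h1 := (summable_dsum (fun k => bit x k)).hasSum.tendsto_sum_nat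
  have h2 : Tendsto (fun n : ℕ => (⌊x * 2^n⌋ : ℝ) / 2^n) atTop (nhds x) := by
    have hz : Tendsto (fun n : ℕ => x - (1/2:ℝ)^n) atTop (nhds (x - 0)) :=
      tendsto_const_nhds.sub (tendsto_pow_atTop_nhds_zero_of_lt_one (by norm_num) (by norm_num))
    rw [sub_zero] at hz
    refine tendsto_of_tendsto_of_tendsto_of_le_of_le hz tendsto_const_nhds ?_ ?_
    · intro n
      have := (Int.lt_floor_add_one (x * 2^n)).le
      have hp : (0:ℝ) < 2^n := by positivity
      simp only
      rw [le_div_iff₀ hp, sub_mul, ← mul_pow]; norm_num; linarith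
    · intro n
      have := (Int.floor_le (x * 2^n))
      have hp : (0:ℝ) < 2^n := by positivity
      simp only
      rw [div_le_iff₀ hp]; exact this
  refine tendsto_nhds_unique h1 ?_
  refine h2.congr fun n => ?_
  rw [← dsum_partial x hx n]

lemma measurable_dsum : Measurable dsum := by
  unfold dsum
  have h : ∀ j : ℕ, Measurable (fun b : ℕ → Bool => if b j then ((2 : ℝ) ^ (-(j : ℤ) - 1)) else 0) := by
    intro j
    exact (measurable_of_countable (fun c : Bool => if c then ((2 : ℝ) ^ (-(j : ℤ) - 1)) else 0)).comp
      (measurable_pi_apply j)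
  refine measurable_of_tendsto_metrizable (f := fun n (b : ℕ → Bool) => ∑ j ∈ Finset.range n,
    if b j then ((2 : ℝ) ^ (-(j : ℤ) - 1)) else 0) (fun n => Finset.measurable_fun_sum _ fun j _ => h j) ?_
  rw [tendsto_pi_nhds]
  intro b
  exact (summable_dsum b).hasSum.tendsto_sum_nat

lemma dsum_law : (Measure.infinitePi (fun _ : ℕ => coin)).map dsum = μ0 := by
  rw [← bits_law, Measure.map_map measurable_dsum measurable_bits]
  conv_rhs => rw [← Measure.map_id (μ := μ0)]
  apply Measure.map_congr
  filter_upwards [ae_mu0_Ico] with x hx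
  exact dsum_bits x hx

lemma measurable_uSlices : Measurable (fun (ω : ℝ) (i : ℕ) => uSlice ω i) := by
  apply measurable_pi_lambda
  intro i
  have : (fun ω => uSlice ω i) = dsum ∘ (fun (ω : ℝ) (j : ℕ) => bit ω (Nat.pair i j)) := rfl
  rw [this]
  exact measurable_dsum.comp (measurable_pi_lambda _ fun j => measurable_bit _)

theorem uSlice_law : μ0.map (fun ω i => uSlice ω i) = Measure.infinitePi (fun _ : ℕ => μ0) := by
  have hinj : Function.Injective (fun p : ℕ × ℕ => Nat.pair p.1 p.2) := by
    intro p q h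
    have := Nat.pair_eq_pair.1 h
    exact Prod.ext this.1 this.2
  have h1 := Measure.map_infinitePi_infinitePi_of_inj (P := fun _ : ℕ => coin) hinj
  have h2 := Measure.infinitePi_map_curry (ι := ℕ) (κ := ℕ) (fun _ _ => coin)
  have h3 := Measure.infinitePi_map_pi (μ := fun _ : ℕ => Measure.infinitePi (fun _ : ℕ => coin))
    (f := fun _ => dsum) (fun _ => measurable_dsum)
  simp only [dsum_law] at h3
  rw [← h3, ← h2, ← h1, ← bits_law]
  have hm1 : Measurable (fun (ω : ℕ → Bool) (i : ℕ × ℕ) => ω (Nat.pair i.1 i.2)) :=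
    measurable_pi_lambda _ fun i => measurable_pi_apply _
  rw [Measure.map_map hm1 measurable_bits,
    Measure.map_map (MeasurableEquiv.measurable _) (hm1.comp measurable_bits), Measure.map_map]
  · rfl
  · exact measurable_pi_lambda _ fun i => measurable_dsum.comp (measurable_pi_apply i)
  · exact (MeasurableEquiv.measurable _).comp (hm1.comp measurable_bits)

end

section

/-! ### Markov chains driven by slices -/

section chain
variable {σ : Type*} [MeasurableSpace σ] [Countable σ] [DiscreteMeasurableSpace σ]

def chain {σ : Type*} (F : σ → ℝ → σ) (s0 : σ) (x : ℕ → ℝ) : ℕ → σ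
  | 0 => s0
  | k + 1 => F (chain F s0 x k) (x k)

lemma measurable_uncurry_countable {β : Type*} [MeasurableSpace β] {F : σ → ℝ → β}
    (hF : ∀ s, Measurable (F s)) : Measurable (fun p : σ × ℝ => F p.1 p.2) :=
  measurable_from_prod_countable_right hF

lemma measurable_chain {F : σ → ℝ → σ} (hF : ∀ s, Measurable (F s)) (s0 : σ) (k : ℕ) :
    Measurable (fun x : ℕ → ℝ => chain F s0 x k) := by
  induction k with
  | zero => exact measurable_const
  | succ k ih => exact (measurable_uncurry_countable hF).comp (ih.prodMk (measurable_pi_apply k))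

lemma chain_congr (F : σ → ℝ → σ) (s0 : σ) {x y : ℕ → ℝ} (k : ℕ) (h : ∀ i < k, x i = y i) :
    chain F s0 x k = chain F s0 y k := by
  induction k with
  | zero => rfl
  | succ k ih =>
    simp only [chain]
    rw [ih (fun i hi => h i (by omega)), h k (by omega)]

lemma measurable_uSlice (i : ℕ) : Measurable (fun ω => uSlice ω i) :=
  (measurable_pi_apply i).comp measurable_uSlices

lemma map_uSlice (i : ℕ) : μ0.map (fun ω => uSlice ω i) = μ0 := by
  have h := congrArg (Measure.map (fun x : ℕ → ℝ => x i)) uSlice_law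
  rw [Measure.map_map (measurable_pi_apply i) measurable_uSlices] at h
  have h2 := Measure.infinitePi_map_eval (fun _ : ℕ => μ0) i
  exact h.trans h2

lemma iIndep_uSlice : ProbabilityTheory.iIndepFun (fun i ω => uSlice ω i) μ0 := by
  rw [ProbabilityTheory.iIndepFun_iff_map_fun_eq_infinitePi_map measurable_uSlice, uSlice_law]
  congr 1
  funext i
  exact (map_uSlice i).symm

lemma chain_indep {F : σ → ℝ → σ} (hF : ∀ s, Measurable (F s)) (s0 : σ) (k : ℕ) :
    ProbabilityTheory.IndepFun (fun ω => chain F s0 (uSlice ω) k) (fun ω => uSlice ω k) μ0 := by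
  classical
  have h := iIndep_uSlice.indepFun_finset (Finset.range k) {k} (by simp) measurable_uSlice
  let G : (Finset.range k → ℝ) → σ := fun y =>
    chain F s0 (fun i => if h : i ∈ Finset.range k then y ⟨i, h⟩ else 0) k
  have hG : Measurable G := by
    apply (measurable_chain hF s0 k).comp
    apply measurable_pi_lambda
    intro i
    by_cases h : i ∈ Finset.range k
    · simp only [h, dite_true]; exact measurable_pi_apply _
    · simp only [h, dite_false]; exact measurable_const
  have hk : Measurable (fun y : (({k} : Finset ℕ) → ℝ) => y ⟨k, by simp⟩) := measurable_pi_apply _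
  have := h.comp hG hk
  have e : (fun ω => chain F s0 (uSlice ω) k) =
      G ∘ (fun a (i : Finset.range k) => uSlice a i) := ?_
  · rw [e]; exact this
  funext ω
  apply chain_congr
  intro i hi
  simp [hi]

lemma lintegral_chain_succ {F : σ → ℝ → σ} (hF : ∀ s, Measurable (F s)) (s0 : σ) (k : ℕ)
    (h : σ → ℝ≥0∞) :
    ∫⁻ ω, h (chain F s0 (uSlice ω) (k+1)) ∂μ0 =
      ∫⁻ ω, ∫⁻ u, h (F (chain F s0 (uSlice ω) k) u) ∂μ0 ∂μ0 := by
  have hc : Measurable (fun ω => chain F s0 (uSlice ω) k) :=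
    (measurable_chain hF s0 k).comp measurable_uSlices
  have hi := (ProbabilityTheory.indepFun_iff_map_prod_eq_prod_map_map hc.aemeasurable
    (measurable_uSlice k).aemeasurable).1 (chain_indep hF s0 k)
  rw [map_uSlice] at hi
  have hm : Measurable (fun p : σ × ℝ => h (F p.1 p.2)) :=
    measurable_uncurry_countable (fun s => (Measurable.of_discrete (f := h)).comp (hF s))
  have e1 : ∫⁻ ω, h (chain F s0 (uSlice ω) (k+1)) ∂μ0 =
     ∫⁻ p, h (F p.1 p.2) ∂(μ0.map (fun ω => (chain F s0 (uSlice ω) k, uSlice ω k))) := by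
    rw [lintegral_map hm (hc.prodMk (measurable_uSlice k))]; rfl
  have : IsProbabilityMeasure (μ0.map (fun ω => chain F s0 (uSlice ω) k)) :=
    Measure.isProbabilityMeasure_map hc.aemeasurable
  rw [e1, hi, lintegral_prod _ hm.aemeasurable, lintegral_map Measurable.of_discrete hc]

theorem chain_super {F : σ → ℝ → σ} (hF : ∀ s, Measurable (F s)) (s0 : σ)
    (Ψ : ℕ → σ → ℝ≥0∞) (P : ℕ → σ → Prop)
    (hP : ∀ k, ∀ᵐ ω ∂μ0, P k (chain F s0 (uSlice ω) k))
    (h : ∀ k s, P k s → ∫⁻ u, Ψ (k+1) (F s u) ∂μ0 ≤ Ψ k s) (j k : ℕ) (hjk : j ≤ k) :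
    ∫⁻ ω, Ψ k (chain F s0 (uSlice ω) k) ∂μ0 ≤ ∫⁻ ω, Ψ j (chain F s0 (uSlice ω) j) ∂μ0 := by
  induction k, hjk using Nat.le_induction with
  | base => exact le_rfl
  | succ k hk ih =>
    refine le_trans ?_ ih
    rw [lintegral_chain_succ hF]
    apply lintegral_mono_ae
    filter_upwards [hP k] with ω hω
    exact h k _ hω

end chain

/-! ### pick is uniform -/

lemma measurable_pick {d : ℕ} (S : Finset (V d)) : Measurable (pick S) := by
  unfold pick
  split_ifs with h
  · have h1 : Measurable (fun u : ℝ => ⌊u * S.card⌋) :=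
      Int.measurable_floor.comp (measurable_id.mul_const _)
    exact (measurable_of_countable (fun m : ℤ => ((S.equivFin.symm ⟨m.toNat % S.card,
      Nat.mod_lt _ (Finset.card_pos.mpr h)⟩).val : V d))).comp h1
  · exact measurable_const

lemma pick_mem {d : ℕ} {S : Finset (V d)} (hS : S.Nonempty) (u : ℝ) : pick S u ∈ S := by
  unfold pick
  rw [dif_pos hS]
  exact Subtype.property _

lemma pick_prob {d : ℕ} {S : Finset (V d)} (s : V d) (hs : s ∈ S) :
    μ0 {u | pick S u = s} = (S.card : ℝ≥0∞)⁻¹ := by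
  have hS : S.Nonempty := ⟨s, hs⟩
  have hN : 0 < S.card := Finset.card_pos.2 hS
  have hNR : (0:ℝ) < S.card := by exact_mod_cast hN
  set i := S.equivFin ⟨s, hs⟩ with hi
  rw [mu0_apply (show MeasurableSet {u | pick S u = s} from measurable_pick S (measurableSet_singleton s))]
  have : {u | pick S u = s} ∩ Set.Ico 0 1 = Set.Ico ((i:ℕ) / S.card : ℝ) (((i:ℕ)+1) / S.card) := by
    ext u
    simp only [Set.mem_inter_iff, Set.mem_ofPred_eq, Set.mem_Ico, div_le_iff₀ hNR, lt_div_iff₀ hNR]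
    have hil : ((i:ℕ):ℝ) + 1 ≤ S.card := by exact_mod_cast i.2
    have key : (0 ≤ u ∧ u < 1) → (pick S u = s ↔ ⌊u * S.card⌋ = (i : ℕ)) := by
      rintro ⟨h0, h1⟩
      have hf0 : 0 ≤ ⌊u * S.card⌋ := Int.floor_nonneg.2 (by positivity)
      have hf1 : ⌊u * S.card⌋ < S.card := by
        rw [Int.floor_lt]; push_cast; nlinarith
      have hmod : (⌊u * S.card⌋).toNat % S.card = (⌊u * S.card⌋).toNat :=
        Nat.mod_eq_of_lt (by omega)
      unfold pick
      rw [dif_pos hS]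
      constructor
      · intro h
        have h2 : S.equivFin.symm ⟨(⌊u * S.card⌋).toNat % S.card,
            Nat.mod_lt _ (Finset.card_pos.mpr hS)⟩ = ⟨s, hs⟩ := Subtype.ext h
        rw [Equiv.symm_apply_eq, ← hi] at h2
        have := congrArg Fin.val h2
        simp only [hmod] at this
        omega
      · intro h
        have h2 : S.equivFin.symm ⟨(⌊u * S.card⌋).toNat % S.card,
            Nat.mod_lt _ (Finset.card_pos.mpr hS)⟩ = ⟨s, hs⟩ := by
          rw [Equiv.symm_apply_eq, ← hi]
          apply Fin.ext
          simp only [hmod]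
          omega
        rw [h2]
    constructor
    · rintro ⟨h, h0⟩
      rw [key h0, Int.floor_eq_iff] at h
      exact_mod_cast h
    · rintro ⟨h1, h2⟩
      have h0 : 0 ≤ u ∧ u < 1 := by
        constructor
        · by_contra hc
          push Not at hc
          have : u * S.card < 0 := mul_neg_of_neg_of_pos hc hNR
          have : (0:ℝ) ≤ (i:ℕ) := by positivity
          linarith
        · by_contra hc
          push Not at hc
          nlinarith
      refine ⟨?_, h0⟩
      rw [key h0, Int.floor_eq_iff]
      exact ⟨by exact_mod_cast h1, by exact_mod_cast h2⟩
  rw [this, Real.volume_Ico, ← sub_div, add_sub_cancel_left, one_div,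
    ENNReal.ofReal_inv_of_pos hNR, ENNReal.ofReal_natCast]

lemma lintegral_finite_range {d : ℕ} {X : ℝ → V d} (hX : Measurable X) (S : Finset (V d))
    (hS : ∀ᵐ ω ∂μ0, X ω ∈ S) (h : V d → ℝ≥0∞) :
    ∫⁻ ω, h (X ω) ∂μ0 = ∑ s ∈ S, h s * μ0 {ω | X ω = s} := by
  rw [← lintegral_map (Measurable.of_discrete (f := h)) hX, lintegral_countable', tsum_eq_sum (s := S)]
  · refine Finset.sum_congr rfl fun s _ => ?_
    rw [Measure.map_apply hX (measurableSet_singleton s)]; rfl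
  · intro s hs
    rw [Measure.map_apply hX (measurableSet_singleton s)]
    have : μ0 (X ⁻¹' {s}) = 0 := by
      rw [measure_eq_zero_iff_ae_notMem]
      filter_upwards [hS] with ω h1 h2
      exact hs (by rw [← h2]; exact h1)
    rw [this, mul_zero]

lemma lintegral_pick {d : ℕ} {S : Finset (V d)} (hS : S.Nonempty) (h : V d → ℝ≥0∞) :
    ∫⁻ u, h (pick S u) ∂μ0 = (∑ s ∈ S, h s) * (S.card : ℝ≥0∞)⁻¹ := by
  rw [lintegral_finite_range (measurable_pick S) S (ae_of_all _ fun u => pick_mem hS u),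
    Finset.sum_mul]
  exact Finset.sum_congr rfl fun s hs => by rw [pick_prob s hs]

/-! ### unit vectors and averages -/

def ev {d : ℕ} (i : Fin d) : V d := Pi.single i 1

lemma unitVecs_inj (d : ℕ) : Function.Injective (fun p : Fin d × Bool => (fun j =>
    if j = p.1 then (if p.2 then (1:ℤ) else -1) else 0 : V d)) := by
  rintro ⟨i, b⟩ ⟨j, c⟩ h
  have h1 := congrFun h i
  by_cases hij : i = j
  · subst hij
    cases b <;> cases c <;> simp at h1 ⊢
  · cases b <;> simp [hij] at h1

lemma sum_unitVecs {d : ℕ} {M : Type*} [AddCommMonoid M] (g : V d → M) :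
    ∑ e ∈ unitVecs d, g e = ∑ i, (g (ev i) + g (-ev i)) := by
  unfold unitVecs
  rw [Finset.sum_image (fun a _ b _ h => unitVecs_inj d h), ← Finset.univ_product_univ,
    Finset.sum_product]
  refine Finset.sum_congr rfl fun i _ => ?_
  have e1 : (fun j => if j = i then (if true then (1:ℤ) else -1) else 0 : V d) = ev i := by
    funext j; by_cases hj : j = i <;> simp [ev, Pi.single_apply, hj]
  have e2 : (fun j => if j = i then (if false then (1:ℤ) else -1) else 0 : V d) = -ev i := by
    funext j; by_cases hj : j = i <;> simp [ev, Pi.single_apply, hj]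
  rw [Fintype.sum_bool, ← e2, ← e1]

lemma card_unitVecs (d : ℕ) : (unitVecs d).card = 2 * d := by
  have := sum_unitVecs (d := d) (fun _ => (1:ℕ))
  simp at this
  omega

lemma mem_unitVecs {d : ℕ} (e : V d) : e ∈ unitVecs d ↔ ∃ i, e = ev i ∨ e = -ev i := by
  unfold unitVecs
  simp only [Finset.mem_image, Finset.mem_univ, true_and, Prod.exists]
  constructor
  · rintro ⟨i, b, rfl⟩
    refine ⟨i, ?_⟩
    cases b
    · right; funext j; by_cases hj : j = i <;> simp [ev, Pi.single_apply, hj]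
    · left; funext j; by_cases hj : j = i <;> simp [ev, Pi.single_apply, hj]
  · rintro ⟨i, rfl | rfl⟩
    · refine ⟨i, true, ?_⟩; funext j; by_cases hj : j = i <;> simp [ev, Pi.single_apply, hj]
    · refine ⟨i, false, ?_⟩; funext j; by_cases hj : j = i <;> simp [ev, Pi.single_apply, hj]

noncomputable def avg {d : ℕ} (f : V d → ℝ) (y : V d) : ℝ :=
  (∑ i, (f (y + ev i) + f (y - ev i))) / (2 * d)

lemma avg_eq_unitVecs {d : ℕ} (f : V d → ℝ) (y : V d) :
    avg f y = (∑ e ∈ unitVecs d, f (y + e)) / (2 * d) := by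
  rw [sum_unitVecs (fun e => f (y + e))]
  simp [avg, sub_eq_add_neg]

lemma mem_outb {d : ℕ} (A : Finset (V d)) (y : V d) :
    y ∈ outb A ↔ y ∉ A ∧ ∃ x ∈ A, ∃ e ∈ unitVecs d, y = x + e := by
  unfold outb
  simp only [Finset.mem_sdiff, Finset.mem_biUnion, Finset.mem_image]
  constructor
  · rintro ⟨⟨x, hx, e, he, rfl⟩, h⟩; exact ⟨h, x, hx, e, he, rfl⟩
  · rintro ⟨h, x, hx, e, he, rfl⟩; exact ⟨⟨x, hx, e, he, rfl⟩, h⟩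

lemma nbr_mem {d : ℕ} {A : Finset (V d)} {x e : V d} (hx : x ∈ A) (he : e ∈ unitVecs d) :
    x + e ∈ A ∪ outb A := by
  rw [Finset.mem_union, mem_outb]
  by_cases h : x + e ∈ A
  · exact Or.inl h
  · exact Or.inr ⟨h, x, hx, e, he, rfl⟩

lemma avg_congr {d : ℕ} {f g : V d → ℝ} {y : V d} (h : ∀ e ∈ unitVecs d, f (y+e) = g (y+e)) :
    avg f y = avg g y := by
  rw [avg_eq_unitVecs, avg_eq_unitVecs, Finset.sum_congr rfl h]

lemma avg_mono {d : ℕ} {f g : V d → ℝ} {y : V d} (h : ∀ e ∈ unitVecs d, f (y+e) ≤ g (y+e)) :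
    avg f y ≤ avg g y := by
  rw [avg_eq_unitVecs, avg_eq_unitVecs]
  exact div_le_div_of_nonneg_right (Finset.sum_le_sum h) (by positivity)

lemma avg_add {d : ℕ} (f g : V d → ℝ) (y : V d) :
    avg (fun z => f z + g z) y = avg f y + avg g y := by
  simp only [avg_eq_unitVecs, Finset.sum_add_distrib, add_div]

lemma avg_sub {d : ℕ} (f g : V d → ℝ) (y : V d) :
    avg (fun z => f z - g z) y = avg f y - avg g y := by
  simp only [avg_eq_unitVecs, Finset.sum_sub_distrib, sub_div]

lemma avg_neg {d : ℕ} (f : V d → ℝ) (y : V d) :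
    avg (fun z => - f z) y = - avg f y := by
  simp only [avg_eq_unitVecs, Finset.sum_neg_distrib, neg_div]

lemma avg_smul {d : ℕ} (c : ℝ) (f : V d → ℝ) (y : V d) :
    avg (fun z => c * f z) y = c * avg f y := by
  simp only [avg_eq_unitVecs, ← Finset.mul_sum, mul_div_assoc]

lemma avg_const {d : ℕ} (hd : 0 < d) (c : ℝ) (y : V d) : avg (fun _ => c) y = c := by
  have : (0:ℝ) < d := by exact_mod_cast hd
  simp only [avg_eq_unitVecs, Finset.sum_const, card_unitVecs]
  simp; field_simp

lemma avg_sum {d : ℕ} {ι : Type*} (s : Finset ι) (f : ι → V d → ℝ) (y : V d) :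
    avg (fun z => ∑ i ∈ s, f i z) y = ∑ i ∈ s, avg (f i) y := by
  simp only [avg_eq_unitVecs, ← Finset.sum_div]
  rw [Finset.sum_comm]

lemma avg_translate {d : ℕ} (f : V d → ℝ) (w y : V d) :
    avg (fun z => f (z - w)) y = avg f (y - w) := by
  simp only [avg_eq_unitVecs]
  congr 1
  refine Finset.sum_congr rfl fun e _ => ?_
  congr 1; abel

noncomputable def nsq {d : ℕ} (y : V d) : ℝ := ∑ i, (y i : ℝ) ^ 2

lemma nsq_nonneg {d : ℕ} (y : V d) : 0 ≤ nsq y := Finset.sum_nonneg fun i _ => sq_nonneg _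

lemma nsq_add {d : ℕ} (y : V d) (i : Fin d) : nsq (y + ev i) = nsq y + (1 + 2 * y i) := by
  unfold nsq ev
  have h := Finset.sum_erase_eq_sub (f := fun j => ((y j : ℝ))^2) (Finset.mem_univ i)
  rw [← Finset.add_sum_erase _ _ (Finset.mem_univ i), ← Finset.add_sum_erase (a := i) _ _ (Finset.mem_univ i)]
  rw [Finset.sum_congr rfl (g := fun j => ((y j : ℝ))^2)]
  · simp; ring
  · intro j hj
    simp [(Finset.mem_erase.1 hj).1]

lemma nsq_sub {d : ℕ} (y : V d) (i : Fin d) : nsq (y - ev i) = nsq y + (1 - 2 * y i) := by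
  unfold nsq ev
  have h := Finset.sum_erase_eq_sub (f := fun j => ((y j : ℝ))^2) (Finset.mem_univ i)
  rw [← Finset.add_sum_erase _ _ (Finset.mem_univ i), ← Finset.add_sum_erase (a := i) _ _ (Finset.mem_univ i)]
  rw [Finset.sum_congr rfl (g := fun j => ((y j : ℝ))^2)]
  · simp; ring
  · intro j hj
    simp [(Finset.mem_erase.1 hj).1]

lemma avg_nsq {d : ℕ} (hd : 0 < d) (y : V d) : avg nsq y = nsq y + 1 := by
  have : (0:ℝ) < d := by exact_mod_cast hd
  unfold avg
  simp only [nsq_add, nsq_sub]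
  rw [div_eq_iff (by positivity)]
  rw [Finset.sum_congr rfl (g := fun _ => 2 * nsq y + 2) (fun i _ => by ring)]
  simp; ring

end

section

/-! ### Exit from a finite set -/

section exit
variable {d : ℕ}

lemma ae_of_lintegral_ite {σ : Type*} [MeasurableSpace σ] [DiscreteMeasurableSpace σ] {X : ℝ → σ}
    (hX : Measurable X) (Q : σ → Prop) [DecidablePred Q] (h : ∫⁻ ω, (if Q (X ω) then (0:ℝ≥0∞) else 1) ∂μ0 = 0) :
    ∀ᵐ ω ∂μ0, Q (X ω) := by
  have hm : Measurable (fun ω => if Q (X ω) then (0:ℝ≥0∞) else 1) :=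
    (Measurable.of_discrete (f := fun s => if Q s then (0:ℝ≥0∞) else 1)).comp hX
  rw [lintegral_eq_zero_iff hm] at h
  filter_upwards [h] with ω hω
  by_contra hc
  have h2 : (if Q (X ω) then (0:ℝ≥0∞) else 1) = 0 := hω
  rw [if_neg hc] at h2
  exact one_ne_zero h2

lemma walk_zero (x : V d) (ω : ℝ) : walk x ω 0 = x := by simp [walk]

lemma walk_succ (x : V d) (ω : ℝ) (t : ℕ) :
    walk x ω (t+1) = walk x ω t + pick (unitVecs d) (uSlice ω t) := by
  simp [walk, Finset.sum_range_succ, add_assoc]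

lemma measurable_walk (x : V d) (t : ℕ) : Measurable (fun ω => walk x ω t) := by
  induction t with
  | zero => simp only [walk_zero]; exact measurable_const
  | succ t ih =>
    simp only [walk_succ]
    exact ih.add ((measurable_pick _).comp (measurable_uSlice t))

lemma measurableSet_walk (S : Finset (V d)) (x : V d) (t : ℕ) :
    MeasurableSet {ω | walk x ω t ∈ S} :=
  measurable_walk x t (S.measurableSet)

open Classical in
noncomputable def stepF (S : Finset (V d)) (s : V d) (u : ℝ) : V d :=
  if s ∈ S then s + pick (unitVecs d) u else s

lemma measurable_stepF (S : Finset (V d)) (s : V d) : Measurable (stepF S s) := by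
  unfold stepF
  split_ifs
  · exact (measurable_pick _).const_add s
  · exact measurable_const

lemma measurable_exitT (S : Finset (V d)) (x : V d) : Measurable (fun ω => exitT S x ω) := by
  apply measurable_to_countable'
  intro t
  have hs : (fun ω => exitT S x ω) ⁻¹' {t} =
      ({ω | walk x ω t ∉ S} ∩ ⋂ i, ⋂ (_ : i < t), {ω | walk x ω i ∈ S}) ∪
      ({_ω | t = 0} ∩ ⋂ i, {ω | walk x ω i ∈ S}) := by
    ext ω
    simp only [Set.mem_preimage, Set.mem_singleton_iff, Set.mem_union, Set.mem_inter_iff,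
      Set.mem_iInter, Set.mem_ofPred_eq]
    constructor
    · rintro rfl
      by_cases hne : {t | walk x ω t ∉ S}.Nonempty
      · left
        refine ⟨Nat.sInf_mem hne, fun i hi => ?_⟩
        by_contra hc
        exact absurd (Nat.sInf_le (s := {t | walk x ω t ∉ S}) hc) (by unfold exitT at hi; omega)
      · right
        rw [Set.not_nonempty_iff_eq_empty] at hne
        refine ⟨by rw [exitT, hne]; simp, fun i => ?_⟩
        by_contra hc
        have : i ∈ {t | walk x ω t ∉ S} := hc
        rw [hne] at this; exact this
    · rintro (⟨h1, h2⟩ | ⟨h1, h2⟩)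
      · apply le_antisymm
        · exact Nat.sInf_le h1
        · by_contra hc
          push Not at hc
          exact Nat.sInf_mem (s := {t | walk x ω t ∉ S}) ⟨t, h1⟩ (h2 _ hc)
      · have : {t | walk x ω t ∉ S} = ∅ := by
          ext i; simp [h2 i]
        rw [exitT, this, h1]; simp
  rw [hs]
  refine MeasurableSet.union (MeasurableSet.inter ?_ ?_) (MeasurableSet.inter ?_ ?_)
  · exact (measurableSet_walk S x t).compl
  · exact MeasurableSet.iInter fun i => MeasurableSet.iInter fun _ => measurableSet_walk S x i
  · exact MeasurableSet.const _
  · exact MeasurableSet.iInter fun i => measurableSet_walk S x i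

lemma measurable_hitPt (S : Finset (V d)) (x : V d) : Measurable (fun ω => hitPt S x ω) := by
  have h : Measurable (fun p : ℕ × ℝ => walk x p.2 p.1) :=
    measurable_uncurry_countable (F := fun t ω => walk x ω t) (fun t => measurable_walk x t)
  have h2 : Measurable (fun ω : ℝ => (exitT S x ω, ω)) := (measurable_exitT S x).prodMk measurable_id
  have h3 := h.comp h2
  simp only [Function.comp_def] at h3
  simpa only [hitPt] using h3

lemma chain_eq_walk (S : Finset (V d)) (x : V d) (ω : ℝ) (k : ℕ)
    (h : ∀ i < k, walk x ω i ∈ S) : chain (stepF S) x (uSlice ω) k = walk x ω k := by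
  induction k with
  | zero => simp [chain, walk_zero]
  | succ k ih =>
    rw [chain, ih (fun i hi => h i (by omega)), stepF, if_pos (h k (by omega)), walk_succ]

lemma chain_eq_hitPt (S : Finset (V d)) (x : V d) (ω : ℝ) (hne : ∃ t, walk x ω t ∉ S) (k : ℕ)
    (hk : exitT S x ω ≤ k) : chain (stepF S) x (uSlice ω) k = hitPt S x ω := by
  have hmem : hitPt S x ω ∉ S := Nat.sInf_mem (s := {t | walk x ω t ∉ S}) hne
  induction k, hk using Nat.le_induction with
  | base =>
    rw [chain_eq_walk]; · rfl
    intro i hi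
    by_contra hc
    exact absurd (Nat.sInf_le (s := {t | walk x ω t ∉ S}) hc) (by unfold exitT at hi; omega)
  | succ k hk ih =>
    rw [chain, ih, stepF, if_neg hmem]

lemma nsq_unit (hd : 0 < d) (x e : V d) (he : e ∈ unitVecs d) :
    nsq (x + e) ≤ 2 * nsq x + 2 := by
  obtain ⟨i, rfl | rfl⟩ := (mem_unitVecs e).1 he
  · rw [nsq_add]
    have : (x i : ℝ)^2 ≤ nsq x := Finset.single_le_sum (f := fun j => ((x j:ℝ))^2)
      (fun j _ => sq_nonneg _) (Finset.mem_univ i)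
    nlinarith [sq_nonneg ((x i : ℝ) - 1)]
  · rw [← sub_eq_add_neg, nsq_sub]
    have : (x i : ℝ)^2 ≤ nsq x := Finset.single_le_sum (f := fun j => ((x j:ℝ))^2)
      (fun j _ => sq_nonneg _) (Finset.mem_univ i)
    nlinarith [sq_nonneg ((x i : ℝ) + 1)]

lemma unitVecs_nonempty (hd : 0 < d) : (unitVecs d).Nonempty := by
  rw [← Finset.card_pos, card_unitVecs]; omega

lemma ofReal_avg (hd : 0 < d) (f : V d → ℝ) (y : V d) (hf : ∀ e ∈ unitVecs d, 0 ≤ f (y + e)) :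
    (∑ e ∈ unitVecs d, ENNReal.ofReal (f (y+e))) * ((unitVecs d).card : ℝ≥0∞)⁻¹ =
      ENNReal.ofReal (avg f y) := by
  rw [avg_eq_unitVecs, ← ENNReal.ofReal_sum_of_nonneg hf, card_unitVecs, ENNReal.ofReal_div_of_pos
    (by positivity), div_eq_mul_inv]
  congr 2
  rw [← ENNReal.ofReal_natCast]; congr 1; push_cast; rfl

lemma lintegral_stepF (hd : 0 < d) (S : Finset (V d)) (s : V d) (hs : s ∈ S) (h : V d → ℝ≥0∞) :
    ∫⁻ u, h (stepF S s u) ∂μ0 =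
      (∑ e ∈ unitVecs d, h (s+e)) * ((unitVecs d).card : ℝ≥0∞)⁻¹ := by
  simp only [stepF, if_pos hs]
  exact lintegral_pick (unitVecs_nonempty hd) (fun e => h (s + e))

lemma lintegral_stepF' (S : Finset (V d)) (s : V d) (hs : s ∉ S) (h : V d → ℝ≥0∞) :
    ∫⁻ u, h (stepF S s u) ∂μ0 = h s := by
  simp [stepF, if_neg hs]

lemma measurable_chainZ (S : Finset (V d)) (x : V d) (k : ℕ) :
    Measurable (fun ω => chain (stepF S) x (uSlice ω) k) :=
  (measurable_chain (measurable_stepF S) x k).comp measurable_uSlices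

open Classical in
lemma exit_ae (hd : 0 < d) (S : Finset (V d)) (x : V d) :
    ∀ᵐ ω ∂μ0, ∃ t, walk x ω t ∉ S := by
  obtain ⟨R, hR⟩ : ∃ R : ℝ, ∀ s ∈ S, 2 * nsq s + 2 ≤ R := by
    refine ⟨∑ s ∈ S, (2 * nsq s + 2), fun s hs => ?_⟩
    exact Finset.single_le_sum (f := fun s => 2 * nsq s + 2)
      (fun j _ => by have := nsq_nonneg j; positivity) hs
  let Ψ : ℕ → V d → ℝ≥0∞ := fun k s => ENNReal.ofReal (R - nsq s) + (if s ∈ S then (k:ℝ≥0∞) else 0)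
  have hstep : ∀ k s, ∫⁻ u, Ψ (k+1) (stepF S s u) ∂μ0 ≤ Ψ k s := by
    intro k s
    by_cases hs : s ∈ S
    · calc ∫⁻ u, Ψ (k+1) (stepF S s u) ∂μ0
          ≤ ∫⁻ u, (ENNReal.ofReal (R - nsq (stepF S s u)) + ((k+1 : ℕ) : ℝ≥0∞)) ∂μ0 := by
            apply lintegral_mono
            intro u
            simp only [Ψ]
            gcongr
            split_ifs
            · exact le_rfl
            · exact zero_le
        _ = ENNReal.ofReal (avg (fun y => R - nsq y) s) + ((k+1 : ℕ) : ℝ≥0∞) := by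
            rw [lintegral_add_right _ measurable_const, lintegral_stepF hd S s hs
              (fun y => ENNReal.ofReal (R - nsq y)), ofReal_avg hd (fun y => R - nsq y)]
            · simp
            · intro e he
              have := nsq_unit hd s e he
              have := hR s hs
              linarith
        _ = ENNReal.ofReal (R - nsq s - 1) + 1 + (k:ℝ≥0∞) := by
            rw [avg_sub, avg_const hd, avg_nsq hd]
            push_cast
            rw [add_assoc, add_comm (1:ℝ≥0∞)]
            congr 2; ring
        _ = Ψ k s := by
            have h1 : (0:ℝ) ≤ R - nsq s - 1 := by
              have := hR s hs
              have := nsq_nonneg s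
              linarith
            simp only [Ψ, if_pos hs]
            rw [← ENNReal.ofReal_one, ← ENNReal.ofReal_add h1 zero_le_one]
            congr 2; ring
    · rw [lintegral_stepF' S s hs (Ψ (k+1))]
      simp [Ψ, hs]
  have hbd : ∀ k : ℕ, (k:ℝ≥0∞) * μ0 {ω | chain (stepF S) x (uSlice ω) k ∈ S} ≤ Ψ 0 x := by
    intro k
    have h1 := chain_super (measurable_stepF S) x Ψ (fun _ _ => True) (by simp)
      (fun k s _ => hstep k s) 0 k (Nat.zero_le k)
    have h2 : ∫⁻ ω, Ψ 0 (chain (stepF S) x (uSlice ω) 0) ∂μ0 = Ψ 0 x := by simp [chain]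
    rw [h2] at h1
    refine le_trans ?_ h1
    have hm : MeasurableSet {ω | chain (stepF S) x (uSlice ω) k ∈ S} :=
      measurable_chainZ S x k S.measurableSet
    rw [← lintegral_indicator_const hm]
    apply lintegral_mono
    intro ω
    simp only [Ψ]
    by_cases h : chain (stepF S) x (uSlice ω) k ∈ S
    · simp [h]
    · simp [h]
  have hzero : μ0 {ω | ∀ t, walk x ω t ∈ S} = 0 := by
    by_contra hne
    have hfin : Ψ 0 x ≠ ⊤ := by simp only [Ψ]; split_ifs <;> simp
    have h3 : ∀ k : ℕ, (k:ℝ≥0∞) * μ0 {ω | ∀ t, walk x ω t ∈ S} ≤ Ψ 0 x := by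
      intro k
      refine le_trans ?_ (hbd k)
      gcongr
      intro h
      rw [chain_eq_walk S x _ k (fun i _ => h i)]
      exact h k
    obtain ⟨k, hk⟩ := ENNReal.exists_nat_mul_gt hne hfin
    exact absurd (h3 k) (not_le.2 hk)
  rw [ae_iff]
  convert hzero using 2
  ext ω; simp

lemma lintegral_hitPt_le (hd : 0 < d) (S : Finset (V d)) (x : V d) (f : V d → ℝ≥0∞)
    (hf : ∀ s ∈ S, (∑ e ∈ unitVecs d, f (s+e)) * ((unitVecs d).card : ℝ≥0∞)⁻¹ ≤ f s) :
    ∫⁻ ω, f (hitPt S x ω) ∂μ0 ≤ f x := by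
  have h1 : ∀ k, ∫⁻ ω, f (chain (stepF S) x (uSlice ω) k) ∂μ0 ≤ f x := by
    intro k
    have := chain_super (measurable_stepF S) x (fun _ => f) (fun _ _ => True) (by simp) (by
      intro k s _
      by_cases hs : s ∈ S
      · rw [lintegral_stepF hd S s hs f]; exact hf s hs
      · rw [lintegral_stepF' S s hs f]) 0 k (Nat.zero_le k)
    refine this.trans ?_
    simp [chain]
  have h2 : ∫⁻ ω, f (hitPt S x ω) ∂μ0 =
      ∫⁻ ω, liminf (fun k => f (chain (stepF S) x (uSlice ω) k)) atTop ∂μ0 := by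
    apply lintegral_congr_ae
    filter_upwards [exit_ae hd S x] with ω hω
    symm
    apply Tendsto.liminf_eq
    apply tendsto_const_nhds.congr'
    filter_upwards [eventually_ge_atTop (exitT S x ω)] with k hk
    rw [chain_eq_hitPt S x ω hω k hk]
  rw [h2]
  refine (lintegral_liminf_le (fun k => Measurable.of_discrete.comp (measurable_chainZ S x k))).trans ?_
  refine (liminf_le_liminf (Eventually.of_forall h1)).trans ?_
  simp

lemma hitPt_notMem (hd : 0 < d) (S : Finset (V d)) (x : V d) :
    ∀ᵐ ω ∂μ0, hitPt S x ω ∉ S := by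
  filter_upwards [exit_ae hd S x] with ω hω
  exact Nat.sInf_mem (s := {t | walk x ω t ∉ S}) hω

open Classical in
lemma hitPt_outb (hd : 0 < d) (S : Finset (V d)) (x : V d) (hx : x ∈ S) :
    ∀ᵐ ω ∂μ0, hitPt S x ω ∈ outb S := by
  have h := lintegral_hitPt_le hd S x (fun y => if y ∈ S ∪ outb S then 0 else 1) (by
    intro s hs
    rw [Finset.sum_eq_zero]
    · simp
    · intro e he
      rw [if_pos (nbr_mem hs he)])
  rw [if_pos (Finset.mem_union_left _ hx), nonpos_iff_eq_zero] at h
  have h := ae_of_lintegral_ite (measurable_hitPt S x) (fun y => y ∈ S ∪ outb S) h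
  filter_upwards [h, hitPt_notMem hd S x] with ω h1 h2
  exact (Finset.mem_union.1 h1).resolve_left h2

/-- exit distribution -/
noncomputable def hp (S : Finset (V d)) (x y : V d) : ℝ := (μ0 {ω | hitPt S x ω = y}).toReal

lemma hp_nonneg (S : Finset (V d)) (x y : V d) : 0 ≤ hp S x y := ENNReal.toReal_nonneg

lemma ofReal_hp (S : Finset (V d)) (x y : V d) :
    ENNReal.ofReal (hp S x y) = μ0 {ω | hitPt S x ω = y} :=
  ENNReal.ofReal_toReal (measure_ne_top _ _)

lemma lintegral_hitPt (hd : 0 < d) (S : Finset (V d)) (x : V d) (hx : x ∈ S) (h : V d → ℝ≥0∞) :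
    ∫⁻ ω, h (hitPt S x ω) ∂μ0 = ∑ y ∈ outb S, h y * ENNReal.ofReal (hp S x y) := by
  rw [lintegral_finite_range (measurable_hitPt S x) (outb S) (hitPt_outb hd S x hx)]
  simp only [ofReal_hp]

lemma lintegral_hitPt_real (hd : 0 < d) (S : Finset (V d)) (x : V d) (hx : x ∈ S) (h : V d → ℝ)
    (h0 : ∀ y ∈ outb S, 0 ≤ h y) :
    ∫⁻ ω, ENNReal.ofReal (h (hitPt S x ω)) ∂μ0 = ENNReal.ofReal (∑ y ∈ outb S, hp S x y * h y) := by
  rw [lintegral_hitPt hd S x hx (fun y => ENNReal.ofReal (h y)), ENNReal.ofReal_sum_of_nonneg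
    (fun y hy => mul_nonneg (hp_nonneg _ _ _) (h0 y hy))]
  refine Finset.sum_congr rfl fun y hy => ?_
  rw [mul_comm, ENNReal.ofReal_mul (hp_nonneg _ _ _)]

lemma sum_hp (hd : 0 < d) (S : Finset (V d)) (x : V d) (hx : x ∈ S) :
    ∑ y ∈ outb S, hp S x y = 1 := by
  have h := lintegral_hitPt_real hd S x hx (fun _ => 1) (fun _ _ => zero_le_one)
  simp only [mul_one, lintegral_const, measure_univ, ENNReal.ofReal_one] at h
  have := congrArg ENNReal.toReal h
  rw [ENNReal.toReal_ofReal (Finset.sum_nonneg fun y _ => hp_nonneg _ _ _)] at this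
  simpa using this.symm

open Classical in
theorem hp_super (hd : 0 < d) (S : Finset (V d)) (x : V d) (hx : x ∈ S) (f : V d → ℝ)
    (hf : ∀ s ∈ S, avg f s ≤ f s) : ∑ y ∈ outb S, hp S x y * f y ≤ f x := by
  obtain ⟨c, hc⟩ : ∃ c : ℝ, ∀ s ∈ S ∪ outb S, 0 ≤ f s + c := by
    refine ⟨∑ s ∈ S ∪ outb S, |f s|, fun s hs => ?_⟩
    have := Finset.single_le_sum (f := fun s => |f s|) (fun j _ => abs_nonneg _) hs
    have := neg_abs_le (f s)
    linarith
  let g : V d → ℝ≥0∞ := fun y => ENNReal.ofReal (f y + c)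
  have h1 := lintegral_hitPt_le hd S x g (by
    intro s hs
    rw [ofReal_avg hd (fun y => f y + c) s (fun e he => hc _ (nbr_mem hs he)), avg_add, avg_const hd]
    exact ENNReal.ofReal_le_ofReal (by linarith [hf s hs]))
  have h2 := lintegral_hitPt_real hd S x hx (fun y => f y + c)
    (fun y hy => hc y (Finset.mem_union_right _ hy))
  rw [h2, ENNReal.ofReal_le_ofReal_iff (hc x (Finset.mem_union_left _ hx))] at h1
  simp only [mul_add, Finset.sum_add_distrib, ← Finset.sum_mul, sum_hp hd S x hx] at h1
  linarith

/-- Maximum (minimum) principle. -/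
theorem min_principle (hd : 0 < d) (S : Finset (V d)) (f : V d → ℝ)
    (hf : ∀ s ∈ S, avg f s ≤ f s) (c : ℝ) (hb : ∀ y ∈ outb S, c ≤ f y) : ∀ x ∈ S, c ≤ f x := by
  intro x hx
  refine le_trans ?_ (hp_super hd S x hx f hf)
  calc c = ∑ y ∈ outb S, hp S x y * c := by rw [← Finset.sum_mul, sum_hp hd S x hx, one_mul]
    _ ≤ _ := Finset.sum_le_sum fun y hy => mul_le_mul_of_nonneg_left (hb y hy) (hp_nonneg _ _ _)

end exit

/-! ### One step of uIDLA -/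
section step
variable {d : ℕ}

lemma measurable_addPt (S : Finset (V d)) (x : V d) : Measurable (fun ω => addPt S x ω) :=
  (Measurable.of_discrete (f := fun y : V d => insert y S)).comp (measurable_hitPt S x)

lemma measurable_uStep (S : Finset (V d)) : Measurable (fun ω => uStep S ω) := by
  have h : Measurable (fun p : V d × ℝ => addPt S p.1 p.2) :=
    measurable_uncurry_countable (F := addPt S) (fun x => measurable_addPt S x)
  have h1 : Measurable (fun ω => pick S (uSlice ω 0)) := (measurable_pick S).comp (measurable_uSlice 0)
  have h2 := h.comp (h1.prodMk (measurable_uSlice 1))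
  simp only [Function.comp_def] at h2
  simpa only [uStep] using h2

lemma indep_slices (i j : ℕ) (hij : i ≠ j) :
    μ0.map (fun ω => (uSlice ω i, uSlice ω j)) = μ0.prod μ0 := by
  have := (ProbabilityTheory.indepFun_iff_map_prod_eq_prod_map_map (measurable_uSlice i).aemeasurable
    (measurable_uSlice j).aemeasurable).1 (iIndep_uSlice.indepFun hij)
  rwa [map_uSlice, map_uSlice] at this

lemma lintegral_uStep (hd : 0 < d) (S : Finset (V d)) (hS : S.Nonempty) (h : Finset (V d) → ℝ≥0∞) :
    ∫⁻ ω, h (uStep S ω) ∂μ0 =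
      (∑ x ∈ S, ∑ y ∈ outb S, h (insert y S) * ENNReal.ofReal (hp S x y)) * (S.card : ℝ≥0∞)⁻¹ := by
  have hm : Measurable (fun p : V d × ℝ => h (addPt S p.1 p.2)) :=
    measurable_uncurry_countable (F := fun x ω => h (addPt S x ω))
      (fun x => Measurable.of_discrete.comp (measurable_addPt S x))
  have hm1 : Measurable (fun p : ℝ × ℝ => (pick S p.1, p.2)) :=
    ((measurable_pick S).comp measurable_fst).prodMk measurable_snd
  have hm2 : Measurable (fun p : ℝ × ℝ => h (addPt S (pick S p.1) p.2)) := by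
    have := hm.comp hm1
    simpa only [Function.comp_def] using this
  have e1 : ∫⁻ ω, h (uStep S ω) ∂μ0 =
      ∫⁻ p, h (addPt S (pick S p.1) p.2) ∂(μ0.map (fun ω => (uSlice ω 0, uSlice ω 1))) := by
    rw [lintegral_map hm2 ((measurable_uSlice 0).prodMk (measurable_uSlice 1))]; simp only [uStep]
  rw [e1, indep_slices 0 1 (by norm_num), lintegral_prod _ hm2.aemeasurable]
  rw [lintegral_pick hS (fun x => ∫⁻ ω, h (addPt S x ω) ∂μ0)]
  congr 1
  refine Finset.sum_congr rfl fun x hx => ?_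
  exact lintegral_hitPt hd S x hx (fun y => h (insert y S))

/-- One-step expectation of a nonnegative functional. -/
lemma lintegral_uStep_real (hd : 0 < d) (S : Finset (V d)) (hS : S.Nonempty) (h : Finset (V d) → ℝ)
    (h0 : ∀ y ∈ outb S, 0 ≤ h (insert y S)) :
    ∫⁻ ω, ENNReal.ofReal (h (uStep S ω)) ∂μ0 =
      ENNReal.ofReal ((∑ x ∈ S, ∑ y ∈ outb S, hp S x y * h (insert y S)) / S.card) := by
  have hc : (0:ℝ) < S.card := by exact_mod_cast Finset.card_pos.2 hS
  rw [lintegral_uStep hd S hS (fun T => ENNReal.ofReal (h T)), ENNReal.ofReal_div_of_pos hc, ENNReal.ofReal_natCast, div_eq_mul_inv]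
  congr 1
  rw [ENNReal.ofReal_sum_of_nonneg (fun x _ => Finset.sum_nonneg fun y hy =>
    mul_nonneg (hp_nonneg _ _ _) (h0 y hy))]
  refine Finset.sum_congr rfl fun x hx => ?_
  rw [ENNReal.ofReal_sum_of_nonneg (fun y hy => mul_nonneg (hp_nonneg _ _ _) (h0 y hy))]
  refine Finset.sum_congr rfl fun y hy => ?_
  rw [mul_comm, ENNReal.ofReal_mul (hp_nonneg _ _ _)]

/-- almost sure step -/
lemma uStep_ae (hd : 0 < d) (S : Finset (V d)) (hS : S.Nonempty) :
    ∀ᵐ ω ∂μ0, ∃ y ∈ outb S, uStep S ω = insert y S := by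
  classical
  have := lintegral_uStep hd S hS (fun T => if ∃ y ∈ outb S, T = insert y S then 0 else 1)
  rw [Finset.sum_eq_zero, zero_mul] at this
  · exact ae_of_lintegral_ite (measurable_uStep S) (fun T => ∃ y ∈ outb S, T = insert y S) this
  · intro x _
    apply Finset.sum_eq_zero
    intro y hy
    rw [if_pos ⟨y, hy, rfl⟩, zero_mul]

lemma uAgg_eq_chain (S : Finset (V d)) (ω : ℝ) (k : ℕ) :
    uAggFrom S ω k = chain uStep S (uSlice ω) k := by
  induction k with
  | zero => rfl
  | succ k ih => rw [uAggFrom, chain, ih]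

instance instDiscreteFinsetV : DiscreteMeasurableSpace (Finset (V d)) := ⟨fun _ => trivial⟩

/-- Invariants along the chain. -/
lemma chain_ae_inv (hd : 0 < d) (P : ℕ → Finset (V d) → Prop) (h0 : P 0 {0})
    (hne : ∀ k S, P k S → S.Nonempty)
    (hs : ∀ k S, P k S → ∀ y ∈ outb S, P (k+1) (insert y S)) (k : ℕ) :
    ∀ᵐ ω ∂μ0, P k (uAggFrom {0} ω k) := by
  classical
  simp only [uAgg_eq_chain]
  induction k with
  | zero => exact ae_of_all _ fun ω => h0
  | succ k ih =>
    have h := lintegral_chain_succ (F := uStep) measurable_uStep ({0} : Finset (V d)) k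
      (fun T => if P (k+1) T then 0 else 1)
    have h2 : ∫⁻ ω, ∫⁻ u, (if P (k+1) (uStep (chain uStep {0} (uSlice ω) k) u)
        then (0:ℝ≥0∞) else 1) ∂μ0 ∂μ0 = ∫⁻ ω, (0:ℝ≥0∞) ∂μ0 := by
      apply lintegral_congr_ae
      filter_upwards [ih] with ω hω
      rw [lintegral_congr_ae (g := fun _ => 0)]
      · simp
      filter_upwards [uStep_ae hd _ (hne k _ hω)] with u hu
      obtain ⟨y, hy, hu⟩ := hu
      simp only [hu]
      rw [if_pos (hs k _ hω y hy)]
    rw [h2, lintegral_zero] at h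
    exact ae_of_lintegral_ite (X := fun ω => chain uStep {0} (uSlice ω) (k+1))
      ((measurable_chain (F := uStep) measurable_uStep {0} (k+1)).comp measurable_uSlices) (P (k+1)) h

lemma notMem_of_outb {S : Finset (V d)} {y : V d} (h : y ∈ outb S) : y ∉ S := ((mem_outb S y).1 h).1

end step

end

section

/-! ### The radial potential and Taylor estimates -/

lemma mv_step {F F' : ℝ → ℝ} {t r B : ℝ} (hr : 0 ≤ r)
    (hF : ∀ x ∈ Set.Icc (t-r) (t+r), HasDerivAt F (F' x) x) (h0 : F t = 0)
    (hB : ∀ x ∈ Set.Icc (t-r) (t+r), |F' x| ≤ B) :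
    ∀ x ∈ Set.Icc (t-r) (t+r), |F x| ≤ B * r := by
  intro x hx
  have ht : t ∈ Set.Icc (t-r) (t+r) := ⟨by linarith, by linarith⟩
  have hB0 : 0 ≤ B := (abs_nonneg _).trans (hB t ht)
  have := Convex.norm_image_sub_le_of_norm_hasDerivWithin_le (s := Set.Icc (t-r) (t+r))
    (f := F) (f' := F') (C := B) (fun y hy => (hF y hy).hasDerivWithinAt) (fun y hy => hB y hy)
    (convex_Icc _ _) ht hx
  rw [h0, sub_zero, Real.norm_eq_abs, Real.norm_eq_abs] at this
  refine this.trans (mul_le_mul_of_nonneg_left ?_ hB0)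
  rw [abs_le]; constructor <;> linarith [hx.1, hx.2]

lemma taylor4 {g g1 g2 g3 g4 : ℝ → ℝ} {t r M : ℝ} (hr : 0 ≤ r)
    (h1 : ∀ x ∈ Set.Icc (t-r) (t+r), HasDerivAt g (g1 x) x)
    (h2 : ∀ x ∈ Set.Icc (t-r) (t+r), HasDerivAt g1 (g2 x) x)
    (h3 : ∀ x ∈ Set.Icc (t-r) (t+r), HasDerivAt g2 (g3 x) x)
    (h4 : ∀ x ∈ Set.Icc (t-r) (t+r), HasDerivAt g3 (g4 x) x)
    (hM : ∀ x ∈ Set.Icc (t-r) (t+r), |g4 x| ≤ M) :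
    ∀ x ∈ Set.Icc (t-r) (t+r), |g x - g t - g1 t * (x-t) - g2 t * (x-t)^2/2 - g3 t * (x-t)^3/6|
      ≤ M * r * r * r * r := by
  have d1 : ∀ x : ℝ, HasDerivAt (fun x => x - t) 1 x := fun x => (hasDerivAt_id x).sub_const t
  have d2 : ∀ x : ℝ, HasDerivAt (fun x => (x - t)^2/2) (x-t) x := fun x => by
    have := ((d1 x).pow 2).div_const 2
    exact this.congr_deriv (by push_cast; ring)
  have d3 : ∀ x : ℝ, HasDerivAt (fun x => (x - t)^3/6) ((x-t)^2/2) x := fun x => by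
    have := ((d1 x).pow 3).div_const 6
    exact this.congr_deriv (by push_cast; ring)
  have s3 := mv_step (F := fun x => g3 x - g3 t) hr (fun x hx => (h4 x hx).sub_const _) (by simp) hM
  have s2 := mv_step (F := fun x => g2 x - g2 t - g3 t * (x-t)) (F' := fun x => g3 x - g3 t) hr
    (fun x hx => by
      have := ((h3 x hx).sub_const (g2 t)).sub ((d1 x).const_mul (g3 t))
      exact this.congr_deriv (by ring)) (by simp) s3
  have s1 := mv_step (F := fun x => g1 x - g1 t - g2 t * (x-t) - g3 t * ((x-t)^2/2))
    (F' := fun x => g2 x - g2 t - g3 t * (x-t)) hr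
    (fun x hx => by
      have := (((h2 x hx).sub_const (g1 t)).sub ((d1 x).const_mul (g2 t))).sub ((d2 x).const_mul (g3 t))
      exact this.congr_deriv (by ring)) (by simp) s2
  have s0 := mv_step (F := fun x => g x - g t - g1 t * (x-t) - g2 t * ((x-t)^2/2) - g3 t * ((x-t)^3/6))
    (F' := fun x => g1 x - g1 t - g2 t * (x-t) - g3 t * ((x-t)^2/2)) hr
    (fun x hx => by
      have := ((((h1 x hx).sub_const (g t)).sub ((d1 x).const_mul (g1 t))).sub
        ((d2 x).const_mul (g2 t))).sub ((d3 x).const_mul (g3 t))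
      exact this.congr_deriv (by ring)) (by simp) s1
  intro x hx
  have := s0 x hx
  simpa only [mul_div_assoc] using this

noncomputable def psi (a : ℝ) (t : ℝ) : ℝ := -∫ u in (1:ℝ)..t, u ^ (-a)

lemma hasDerivAt_psi (a : ℝ) {t : ℝ} (ht : 0 < t) : HasDerivAt (psi a) (-(t ^ (-a))) t := by
  unfold psi
  apply HasDerivAt.neg
  have hc : ∀ x ∈ Set.Ioi (0:ℝ), ContinuousAt (fun u : ℝ => u ^ (-a)) x := fun x hx =>
    Real.continuousAt_rpow_const x (-a) (Or.inl (ne_of_gt hx))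
  apply intervalIntegral.integral_hasDerivAt_right
  · apply ContinuousOn.intervalIntegrable
    intro x hx
    refine (hc x ?_).continuousWithinAt
    have := hx.1
    have h1 : (0:ℝ) < min 1 t := lt_min one_pos ht
    exact lt_of_lt_of_le h1 this
  · exact ContinuousOn.stronglyMeasurableAtFilter isOpen_Ioi (fun x hx => (hc x hx).continuousWithinAt) t ht
  · exact hc t ht

lemma hasDerivAt_rp (b : ℝ) {t : ℝ} (ht : 0 < t) :
    HasDerivAt (fun x : ℝ => x ^ b) (b * t ^ (b-1)) t :=
  Real.hasDerivAt_rpow_const (Or.inl ht.ne')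

/-- mean value for psi -/
lemma psi_mv (a : ℝ) {s t : ℝ} (hs : 0 < s) (hst : s ≤ t) (ha : 0 ≤ a) :
    (t - s) * t ^ (-a) ≤ psi a s - psi a t ∧ psi a s - psi a t ≤ (t - s) * s ^ (-a) := by
  rcases hst.eq_or_lt with rfl | hlt
  · simp
  obtain ⟨c, hc, hc2⟩ := exists_hasDerivAt_eq_slope (psi a) (fun x => -(x ^ (-a))) hlt
    (fun x hx => (hasDerivAt_psi a (hs.trans_le hx.1)).continuousAt.continuousWithinAt)
    (fun x hx => hasDerivAt_psi a (hs.trans hx.1))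
  have hts : 0 < t - s := by linarith
  rw [eq_div_iff hts.ne'] at hc2
  have h1 : t ^ (-a) ≤ c ^ (-a) :=
    Real.rpow_le_rpow_of_nonpos (hs.trans hc.1) hc.2.le (by linarith)
  have h2 : c ^ (-a) ≤ s ^ (-a) :=
    Real.rpow_le_rpow_of_nonpos hs hc.1.le (by linarith)
  constructor <;> nlinarith

lemma psi_anti (a : ℝ) (ha : 0 ≤ a) {s t : ℝ} (hs : 0 < s) (hst : s ≤ t) : psi a t ≤ psi a s := by
  have := (psi_mv a hs hst ha).1
  have h2 : 0 ≤ (t - s) * t ^ (-a) := mul_nonneg (by linarith) (Real.rpow_nonneg (by linarith) _)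
  linarith

/-- logarithmic bound for psi differences -/
lemma psi_log (a : ℝ) (ha : 1 ≤ a) {s t : ℝ} (hs : 0 < s) (hst : s ≤ t) :
    psi a s - psi a t ≤ s ^ (1-a) * (Real.log t - Real.log s) := by
  have hd : ∀ x ∈ Set.Icc s t, HasDerivAt (fun x => psi a x + s^(1-a) * Real.log x)
      (-(x ^ (-a)) + s^(1-a) * x⁻¹) x := fun x hx =>
    (hasDerivAt_psi a (hs.trans_le hx.1)).add
      ((Real.hasDerivAt_log (hs.trans_le hx.1).ne').const_mul _)
  have hmono : MonotoneOn (fun x => psi a x + s^(1-a) * Real.log x) (Set.Icc s t) := by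
    apply monotoneOn_of_deriv_nonneg (convex_Icc s t)
    · exact fun x hx => (hd x hx).continuousAt.continuousWithinAt
    · exact fun x hx => (hd x (interior_subset hx)).differentiableAt.differentiableWithinAt
    · intro x hx
      have hx := interior_subset hx
      rw [(hd x hx).deriv]
      have hx0 := hs.trans_le hx.1
      have h1 : x ^ (-a) = x ^ (1-a) * x⁻¹ := by
        rw [← Real.rpow_neg_one x, ← Real.rpow_add hx0]; congr 1; ring
      have h2 : x ^ (1-a) ≤ s ^ (1-a) := Real.rpow_le_rpow_of_nonpos hs hx.1 (by linarith)
      have h3 : 0 < x⁻¹ := inv_pos.2 hx0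
      rw [h1]; nlinarith
  have := hmono ⟨le_rfl, hst⟩ ⟨hst, le_rfl⟩ hst
  simp only at this
  linarith

lemma psi_taylor (a : ℝ) (ha : 0 ≤ a) {t δ : ℝ} (ht : 0 < t) (hδ : |δ| ≤ t/2) :
    |psi a (t+δ) - psi a t + t^(-a) * δ - a * t^(-a-1) * δ^2/2 + a*(a+1) * t^(-a-2) * δ^3/6| ≤
      a*(a+1)*(a+2) * (t/2)^(-a-3) * δ^4 := by
  have hpos : ∀ x ∈ Set.Icc (t-|δ|) (t+|δ|), 0 < x := fun x hx => by linarith [hx.1]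
  have h := taylor4 (g := psi a) (g1 := fun x => -(x^(-a))) (g2 := fun x => a * x^(-a-1))
    (g3 := fun x => -(a*(a+1)) * x^(-a-2)) (g4 := fun x => a*(a+1)*(a+2) * x^(-a-3))
    (t := t) (r := |δ|) (M := a*(a+1)*(a+2) * (t/2)^(-a-3)) (abs_nonneg δ)
    (fun x hx => hasDerivAt_psi a (hpos x hx))
    (fun x hx => by
      have := (hasDerivAt_rp (-a) (hpos x hx)).neg
      exact this.congr_deriv (by ring))
    (fun x hx => by
      have := (hasDerivAt_rp (-a-1) (hpos x hx)).const_mul a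
      exact this.congr_deriv (by rw [show -a-1-1 = -a-2 by ring]; ring))
    (fun x hx => by
      have := (hasDerivAt_rp (-a-2) (hpos x hx)).const_mul (-(a*(a+1)))
      exact this.congr_deriv (by rw [show -a-2-1 = -a-3 by ring]; ring))
    (fun x hx => by
      have hx0 := hpos x hx
      rw [abs_of_nonneg (by positivity)]
      apply mul_le_mul_of_nonneg_left _ (by positivity)
      apply Real.rpow_le_rpow_of_nonpos (by linarith) (by linarith [hx.1]) (by linarith))
    (t + δ) ⟨by linarith [neg_abs_le δ], by linarith [le_abs_self δ]⟩
  have e : |δ| * |δ| * |δ| * |δ| = δ^4 := by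
    have : |δ| * |δ| = δ^2 := by rw [abs_mul_abs_self]; ring
    rw [this, mul_assoc, this]; ring
  rw [show a*(a+1)*(a+2) * (t/2)^(-a-3) * |δ| * |δ| * |δ| * |δ| =
    a*(a+1)*(a+2) * (t/2)^(-a-3) * (|δ| * |δ| * |δ| * |δ|) by ring, e] at h
  refine le_trans (le_of_eq ?_) h
  congr 1
  ring

lemma coord_le {d : ℕ} (y : V d) (i : Fin d) : (y i : ℝ)^2 ≤ nsq y :=
  Finset.single_le_sum (f := fun j => ((y j:ℝ))^2) (fun j _ => sq_nonneg _) (Finset.mem_univ i)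

theorem lap_psi (d : ℕ) (hd : 0 < d) : ∃ C1 : ℝ, 0 ≤ C1 ∧ ∀ (y : V d) (κ : ℝ),
    64 ≤ nsq y + κ → nsq y ≤ 2 * (nsq y + κ) →
    |avg (fun z => psi (d/2) (nsq z + κ)) y - psi (d/2) (nsq y + κ) + κ * (nsq y + κ)^(-(d/2:ℝ)-1)| ≤
      C1 * (nsq y + κ)^(-(d/2:ℝ)-1) := by
  set a : ℝ := d/2 with ha
  have hdR : (0:ℝ) < d := by exact_mod_cast hd
  have ha0 : 0 < a := by positivity
  refine ⟨a/2 + a*(a+1)/6*(1+24/d) + a*(a+1)*(a+2)*2^(a+3)*500, by positivity, ?_⟩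
  intro y κ ht hy
  set t := nsq y + κ with htdef
  have ht0 : 0 < t := by linarith
  have hs0 := nsq_nonneg y
  set R : V d → ℝ → ℝ := fun _ δ => psi a (t+δ) - psi a t + t^(-a) * δ - a * t^(-a-1) * δ^2/2
    + a*(a+1) * t^(-a-2) * δ^3/6 with hR
  set E : ℝ := a*(a+1)*(a+2)*2^(a+3)*500 * t^(-a-1) with hE
  have hbound : ∀ δ : ℝ, (δ - 1)^2 ≤ 4 * nsq y → |R y δ| ≤ E := by
    intro δ hδ
    have hδ8 : (δ-1)^2 ≤ 8 * t := by linarith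
    have h2 : δ^2 ≤ 17 * t := by nlinarith [sq_nonneg (δ-2), sq_nonneg (δ - 1 - 1)]
    have h3 : |δ| ≤ t/2 := by
      have : |δ-1| ≤ 3 * t / 8 := by
        apply abs_le_of_sq_le_sq _ (by positivity)
        nlinarith
      rw [abs_le] at this ⊢
      constructor <;> linarith [this.1, this.2]
    refine (psi_taylor a ha0.le ht0 h3).trans ?_
    have h4 : δ^4 ≤ 500 * t^2 := by
      have : δ^4 = (δ^2)^2 := by ring
      rw [this]
      have : (δ^2)^2 ≤ (17*t)^2 := pow_le_pow_left₀ (sq_nonneg _) h2 2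
      nlinarith
    have h5 : (t/2)^(-a-3) = 2^(a+3) * t^(-a-3) := by
      rw [Real.div_rpow ht0.le (by norm_num), show (-a-3) = -(a+3) by ring,
        Real.rpow_neg (by norm_num : (0:ℝ) ≤ 2)]
      field_simp
    have h6 : t^(-a-1) = t^(-a-3) * t^2 := by
      rw [← Real.rpow_natCast t 2, ← Real.rpow_add ht0]; congr 1; push_cast; ring
    rw [hE, h6, h5]
    have : 0 ≤ a*(a+1)*(a+2) * (2^(a+3) * t^(-a-3)) := by positivity
    calc _ ≤ a*(a+1)*(a+2) * (2^(a+3) * t^(-a-3)) * (500 * t^2) :=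
          mul_le_mul_of_nonneg_left h4 this
      _ = _ := by ring
  have hp : ∀ i, |R y (1 + 2 * y i)| ≤ E := fun i => hbound _ (by nlinarith [coord_le y i])
  have hm : ∀ i, |R y (1 - 2 * y i)| ≤ E := fun i => hbound _ (by nlinarith [coord_le y i])
  -- the sum
  have hsum : avg (fun z => psi a (nsq z + κ)) y =
      psi a t - t^(-a) + a * t^(-a-1) * (1 + 4 * nsq y / d)/2
        - a*(a+1)*t^(-a-2)*(1 + 12 * nsq y/d)/6
        + (∑ i, (R y (1 + 2 * y i) + R y (1 - 2 * y i)))/(2*d) := by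
    unfold avg
    have e1 : ∀ i, psi a (nsq (y + ev i) + κ) + psi a (nsq (y - ev i) + κ) =
        (2 * psi a t - 2 * t^(-a) + a * t^(-a-1) - a*(a+1)*t^(-a-2)/3)
          + (4 * a * t^(-a-1) - 4 * a*(a+1)*t^(-a-2)) * (y i:ℝ)^2
        + (R y (1 + 2 * y i) + R y (1 - 2 * y i)) := by
      intro i
      rw [nsq_add, nsq_sub, hR]
      simp only
      rw [show nsq y + (1 + 2 * (y i:ℝ)) + κ = t + (1 + 2 * y i) by rw [htdef]; ring,
        show nsq y + (1 - 2 * (y i:ℝ)) + κ = t + (1 - 2 * y i) by rw [htdef]; ring]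
      ring
    simp only [e1, Finset.sum_add_distrib, ← Finset.mul_sum, Finset.sum_const, Finset.card_univ,
      Fintype.card_fin, nsmul_eq_mul]
    rw [show ∑ i, (y i:ℝ)^2 = nsq y from rfl]
    field_simp
    ring
  have hrem : |(∑ i, (R y (1 + 2 * y i) + R y (1 - 2 * y i)))/(2*d)| ≤ E := by
    rw [abs_div, abs_of_pos (by positivity : (0:ℝ) < 2*d), div_le_iff₀ (by positivity)]
    refine (Finset.abs_sum_le_sum_abs _ _).trans ?_
    calc _ ≤ ∑ i : Fin d, (E + E) := Finset.sum_le_sum fun i _ =>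
          (abs_add_le _ _).trans (add_le_add (hp i) (hm i))
      _ = E * (2 * d) := by simp; ring
  have h6 : t^(-a) = t^(-a-1) * t := by
    nth_rewrite 3 [← Real.rpow_one t]
    rw [← Real.rpow_add ht0]; congr 1; ring
  have h7 : t^(-a-2) * t = t^(-a-1) := by
    nth_rewrite 2 [← Real.rpow_one t]
    rw [← Real.rpow_add ht0]; congr 1; ring
  set q := t^(-a-1) with hq
  have hq0 : 0 < q := Real.rpow_pos_of_pos ht0 _
  have hp2 : 0 < t^(-a-2) := Real.rpow_pos_of_pos ht0 _
  have hmain : avg (fun z => psi a (nsq z + κ)) y - psi a t + κ * q =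
      a/2 * q - a*(a+1)/6*(t^(-a-2)*(1 + 12 * nsq y/d))
        + (∑ i, (R y (1 + 2 * y i) + R y (1 - 2 * y i)))/(2*d) := by
    rw [hsum, h6]
    have : a * q * (1 + 4 * nsq y / d)/2 = a/2*q + q * nsq y := by
      rw [ha]; field_simp; ring
    rw [this, show nsq y = t - κ by rw [htdef]; ring]
    ring
  have h8 : t^(-a-2)*(1 + 12 * nsq y/d) ≤ q * (1 + 24/d) := by
    rw [← h7, mul_assoc]
    apply mul_le_mul_of_nonneg_left _ hp2.le
    have : nsq y / d ≤ 2 * t / d := div_le_div_of_nonneg_right hy hdR.le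
    calc 1 + 12 * nsq y / d = 1 + 12 * (nsq y/d) := by ring
      _ ≤ t + 12 * (2*t/d) := by linarith
      _ = _ := by ring
  have h9 : 0 ≤ t^(-a-2)*(1 + 12 * nsq y/d) := by positivity
  rw [hmain]
  have hE2 : (a/2 + a*(a+1)/6*(1+24/d) + a*(a+1)*(a+2)*2^(a+3)*500) * q =
    a/2*q + a*(a+1)/6*(q*(1+24/d)) + E := by rw [hE]; ring
  rw [hE2]
  rw [abs_le] at hrem ⊢
  have h10 : a*(a+1)/6*(t^(-a-2)*(1 + 12 * nsq y/d)) ≤ a*(a+1)/6*(q*(1+24/d)) :=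
    mul_le_mul_of_nonneg_left h8 (by positivity)
  have h11 : 0 ≤ a*(a+1)/6*(t^(-a-2)*(1 + 12 * nsq y/d)) := by positivity
  have h12 : 0 ≤ a/2*q := by positivity
  constructor <;> linarith [hrem.1, hrem.2]

end

section

/-! ### Potential kernels -/

theorem exists_K0 (d : ℕ) (hd : 0 < d) : ∃ K : ℝ, 64 ≤ K ∧
    (∀ y : V d, avg (fun z => psi (d/2) (nsq z + K)) y ≤ psi (d/2) (nsq y + K)) ∧
    (∀ y : V d, 2 * K + 64 ≤ nsq y →
      psi (d/2) (nsq y - K) ≤ avg (fun z => psi (d/2) (nsq z - K)) y) := by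
  obtain ⟨C1, hC0, hC⟩ := lap_psi d hd
  refine ⟨max 64 C1, le_max_left _ _, fun y => ?_, fun y hy => ?_⟩
  · have h1 := le_max_left 64 C1
    have h2 := le_max_right 64 C1
    set K := max 64 C1
    have hs := nsq_nonneg y
    have h := hC y K (by linarith) (by linarith)
    have hq : 0 < (nsq y + K)^(-(d/2:ℝ)-1) := Real.rpow_pos_of_pos (by linarith) _
    have := (abs_le.1 h).2
    nlinarith
  · have h1 := le_max_left 64 C1
    have h2 := le_max_right 64 C1
    set K := max 64 C1
    have hs := nsq_nonneg y
    have h := hC y (-K) (by linarith) (by linarith)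
    have hq : 0 < (nsq y + -K)^(-(d/2:ℝ)-1) := Real.rpow_pos_of_pos (by linarith) _
    have := (abs_le.1 h).1
    have e : ∀ x : ℝ, x - K = x + -K := fun x => sub_eq_add_neg x K
    simp only [e]
    nlinarith

lemma nsq_zero {d : ℕ} : nsq (0 : V d) = 0 := by simp [nsq]

theorem pot_exists (d : ℕ) (hd : 2 ≤ d) : ∃ C : ℝ, 1 ≤ C ∧ ∀ S : ℝ, 0 ≤ S →
    ∃ g : V d → ℝ, (∀ y, avg g y ≤ g y) ∧ (1 ≤ g 0 - avg g 0) ∧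
      ∀ v, nsq v ≤ S → 0 ≤ g v ∧ g v ≤ C * Real.log (S + C) * (nsq v + 1)^(1 - (d/2:ℝ)) := by
  have hd0 : 0 < d := by omega
  have hdR : (2:ℝ) ≤ d := by exact_mod_cast hd
  obtain ⟨K, hK, hsup, -⟩ := exists_K0 d hd0
  set a : ℝ := d/2 with ha
  have ha1 : 1 ≤ a := by rw [ha]; linarith
  set c0 : ℝ := (1+K)^(-a) with hc0
  have hc0pos : 0 < c0 := Real.rpow_pos_of_pos (by linarith) _
  refine ⟨max K c0⁻¹, le_trans (by linarith) (le_max_left _ _), fun S hS => ?_⟩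
  refine ⟨fun v => c0⁻¹ * (psi a (nsq v + K) - psi a (S + K)), ?_, ?_, ?_⟩
  · intro y
    rw [avg_smul, avg_sub, avg_const hd0]
    exact mul_le_mul_of_nonneg_left (by linarith [hsup y]) (inv_pos.2 hc0pos).le
  · rw [avg_smul, avg_sub, avg_const hd0]
    have h1 : avg (fun z => psi a (nsq z + K)) (0 : V d) = psi a (1 + K) := by
      unfold avg
      simp only [nsq_add, nsq_sub, nsq_zero]
      simp
      field_simp
      ring
    have h2 := (psi_mv a (s := K) (t := 1 + K) (by linarith) (by linarith) (by linarith)).1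
    simp only [h1, nsq_zero, zero_add, ← mul_sub]
    rw [show (1 + K - K) = 1 by ring, one_mul] at h2
    have : c0⁻¹ * c0 ≤ c0⁻¹ * (psi a K - psi a (S+K) - (psi a (1+K) - psi a (S+K))) :=
      mul_le_mul_of_nonneg_left (by linarith) (inv_pos.2 hc0pos).le
    rwa [inv_mul_cancel₀ hc0pos.ne'] at this
  · intro v hv
    have hv0 := nsq_nonneg v
    constructor
    · apply mul_nonneg (inv_pos.2 hc0pos).le
      linarith [psi_anti a (by linarith) (s := nsq v + K) (t := S + K) (by linarith) (by linarith)]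
    · have h1 := psi_log a ha1 (s := nsq v + K) (t := S + K) (by linarith) (by linarith)
      have h2 : 0 ≤ Real.log (nsq v + K) := Real.log_nonneg (by linarith)
      have h3 : Real.log (S+K) ≤ Real.log (S + max K c0⁻¹) :=
        Real.log_le_log (by linarith) (by linarith [le_max_left K c0⁻¹])
      have h4 : (nsq v + K)^(1-a) ≤ (nsq v + 1)^(1-a) :=
        Real.rpow_le_rpow_of_nonpos (by linarith) (by linarith) (by linarith)
      have h5 : 0 ≤ (nsq v + K)^(1-a) := Real.rpow_nonneg (by linarith) _
      have h6 : psi a (nsq v + K) - psi a (S+K) ≤ Real.log (S + max K c0⁻¹) * (nsq v + 1)^(1-a) := by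
        refine h1.trans ?_
        rw [mul_comm]
        refine mul_le_mul (by linarith) h4 h5 ?_
        refine le_trans ?_ h3
        exact Real.log_nonneg (by linarith)
      rw [mul_assoc]
      refine mul_le_mul (le_max_right _ _) h6 ?_ (le_trans (inv_pos.2 hc0pos).le (le_max_right _ _))
      linarith [psi_anti a (by linarith) (s := nsq v + K) (t := S + K) (by linarith) (by linarith)]

lemma sum_rpow_le (γ : ℝ) (hγ : 0 < γ) (hγ1 : γ ≤ 1) (M : ℕ) :
    ∑ j ∈ Finset.range M, ((j:ℝ)+1)^(γ-1) ≤ γ⁻¹ * (M:ℝ)^γ := by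
  induction M with
  | zero => simp [Real.zero_rpow hγ.ne']
  | succ M ih =>
    rw [Finset.sum_range_succ]
    have hM : (0:ℝ) < (M:ℝ)+1 := by positivity
    have h1 := rpow_one_add_le_one_add_mul_self (s := -(1/((M:ℝ)+1))) (p := γ) (by
      rw [neg_le_neg_iff, div_le_one hM]; linarith [(Nat.cast_nonneg M : (0:ℝ) ≤ M)]) hγ.le hγ1
    have h2 : (1 + -(1/((M:ℝ)+1))) = M/((M:ℝ)+1) := by field_simp; ring
    rw [h2, Real.div_rpow (by positivity) hM.le] at h1
    have h3 : 0 < ((M:ℝ)+1)^γ := Real.rpow_pos_of_pos hM _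
    rw [div_le_iff₀ h3] at h1
    have h4 : ((M:ℝ)+1)^(γ-1) = ((M:ℝ)+1)^γ / ((M:ℝ)+1) := by
      rw [Real.rpow_sub_one hM.ne']
    have h5 : (1 + γ * -(1/((M:ℝ)+1))) * ((M:ℝ)+1)^γ = ((M:ℝ)+1)^γ - γ * ((M:ℝ)+1)^(γ-1) := by
      rw [h4]; field_simp; ring
    rw [h5] at h1
    push_cast
    have : γ⁻¹ * (M:ℝ)^γ ≤ γ⁻¹ * (((M:ℝ)+1)^γ - γ * ((M:ℝ)+1)^(γ-1)) :=
      mul_le_mul_of_nonneg_left h1 (inv_pos.2 hγ).le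
    rw [mul_sub, ← mul_assoc, inv_mul_cancel₀ hγ.ne', one_mul] at this
    linarith

lemma sum_int_symm (f : ℤ → ℝ) (hf : ∀ j, f (-j) = f j) (M : ℕ) :
    ∑ j ∈ Finset.Icc (-(M:ℤ)) M, f j = f 0 + 2 * ∑ j ∈ Finset.range M, f ((j:ℤ)+1) := by
  induction M with
  | zero => simp
  | succ M ih =>
    have : Finset.Icc (-((M+1:ℕ):ℤ)) ((M+1:ℕ):ℤ) =
        insert (-((M:ℤ)+1)) (insert ((M:ℤ)+1) (Finset.Icc (-(M:ℤ)) M)) := by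
      ext j; simp only [Finset.mem_insert, Finset.mem_Icc]; push_cast; omega
    rw [this, Finset.sum_insert, Finset.sum_insert, ih, hf, Finset.sum_range_succ]
    · ring
    · simp
    · simp; omega

lemma sum_1d (d : ℕ) (hd : 2 ≤ d) (R : ℝ) (hR : 1 ≤ R) :
    ∑ j ∈ Finset.Icc (-(⌊R⌋₊:ℤ)) ⌊R⌋₊, ((j:ℝ)^2+1)^(-((d:ℝ)-2)/(2*d)) ≤ (1 + d) * R^(2/(d:ℝ)) := by
  have hdR : (2:ℝ) ≤ d := by exact_mod_cast hd
  set β : ℝ := -((d:ℝ)-2)/(2*d) with hβ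
  have hβ0 : β ≤ 0 := by rw [hβ]; apply div_nonpos_of_nonpos_of_nonneg <;> linarith
  have hg1 : 2/(d:ℝ) ≤ 1 := by rw [div_le_one (by linarith)]; linarith
  have hg0 : 0 < 2/(d:ℝ) := by positivity
  rw [sum_int_symm (fun j => ((j:ℝ)^2+1)^β) (fun j => by simp)]
  have h1 : ∑ j ∈ Finset.range ⌊R⌋₊, ((((j:ℤ)+1:ℤ):ℝ)^2+1)^β ≤
      ∑ j ∈ Finset.range ⌊R⌋₊, ((j:ℝ)+1)^(2/(d:ℝ)-1) := by
    apply Finset.sum_le_sum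
    intro j _
    have hj : (0:ℝ) < (j:ℝ)+1 := by positivity
    have : ((j:ℝ)+1)^(2/(d:ℝ)-1) = (((j:ℝ)+1)^2)^β := by
      rw [← Real.rpow_natCast, ← Real.rpow_mul hj.le]
      congr 1; rw [hβ]; push_cast; field_simp; ring
    rw [this]
    apply Real.rpow_le_rpow_of_nonpos (by positivity) _ hβ0
    push_cast; linarith
  have h2 := sum_rpow_le (2/(d:ℝ)) hg0 hg1 ⌊R⌋₊
  have h3 : ((⌊R⌋₊:ℝ))^(2/(d:ℝ)) ≤ R^(2/(d:ℝ)) :=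
    Real.rpow_le_rpow (by positivity) (Nat.floor_le (by linarith)) hg0.le
  have h4 : 1 ≤ R^(2/(d:ℝ)) := Real.one_le_rpow hR hg0.le
  have h5 : (2/(d:ℝ))⁻¹ = d/2 := by rw [inv_div]
  rw [h5] at h2
  have h6 : (d:ℝ)/2 * ((⌊R⌋₊:ℝ))^(2/(d:ℝ)) ≤ d/2 * R^(2/(d:ℝ)) :=
    mul_le_mul_of_nonneg_left h3 (by linarith)
  simp only [Int.cast_zero]
  norm_num
  push_cast at h1
  nlinarith

/-- Sum of the kernel over a set of bounded cardinality. -/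
theorem kernel_sum (d : ℕ) (hd : 2 ≤ d) : ∃ C : ℝ, 0 < C ∧ ∀ (E : Finset (V d)) (y : V d) (m : ℝ),
    1 ≤ m → (E.card : ℝ) ≤ m →
    ∑ w ∈ E, (nsq (y - w) + 1)^(1 - (d/2:ℝ)) ≤ C * m^(2/(d:ℝ)) := by
  classical
  have hdR : (2:ℝ) ≤ d := by exact_mod_cast hd
  refine ⟨1 + (1+(d:ℝ))^d, by positivity, ?_⟩
  intro E y m hm hE
  set a : ℝ := d/2 with ha
  set R : ℝ := m^(1/(d:ℝ)) with hR
  have hR1 : 1 ≤ R := Real.one_le_rpow hm (by positivity)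
  have hR0 : 0 < R := by linarith
  have hRd : R^(d:ℝ) = m := by
    rw [hR, ← Real.rpow_mul (by linarith), one_div, inv_mul_cancel₀ (by linarith), Real.rpow_one]
  have hR2 : R^2 = m^(2/(d:ℝ)) := by
    rw [hR, ← Real.rpow_natCast, ← Real.rpow_mul (by linarith)]; congr 1; push_cast; ring
  rw [← Finset.sum_filter_add_sum_filter_not E (fun w => ∀ i, |((y - w) i : ℝ)| ≤ R)]
  have hfar : ∑ w ∈ E with ¬ (∀ i, |((y - w) i : ℝ)| ≤ R), (nsq (y - w) + 1)^(1 - a) ≤ R^2 := by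
    calc _ ≤ ∑ w ∈ E with ¬ (∀ i, |((y - w) i : ℝ)| ≤ R), (R^2)^(1-a) := by
          apply Finset.sum_le_sum
          intro w hw
          obtain ⟨-, hw⟩ := Finset.mem_filter.1 hw
          push Not at hw
          obtain ⟨i, hi⟩ := hw
          apply Real.rpow_le_rpow_of_nonpos (by positivity) _ (by rw [ha]; linarith)
          have h1 := coord_le (y-w) i
          have h2 : R^2 ≤ ((y-w) i : ℝ)^2 := by
            rw [← sq_abs ((y-w) i : ℝ)]
            exact pow_le_pow_left₀ hR0.le hi.le 2
          linarith
      _ ≤ m * (R^2)^(1-a) := by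
          rw [Finset.sum_const, nsmul_eq_mul]
          apply mul_le_mul_of_nonneg_right _ (by positivity)
          refine le_trans ?_ hE
          exact_mod_cast Finset.card_filter_le _ _
      _ = R^2 := by
          rw [← hRd, ← Real.rpow_natCast R 2, ← Real.rpow_mul hR0.le, ← Real.rpow_add hR0]
          congr 1; rw [ha]; push_cast; ring
  have hnear : ∑ w ∈ E with (∀ i, |((y - w) i : ℝ)| ≤ R), (nsq (y - w) + 1)^(1 - a) ≤
      (1+(d:ℝ))^d * R^2 := by
    set β : ℝ := -((d:ℝ)-2)/(2*d) with hβ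
    have hβ0 : β ≤ 0 := by rw [hβ]; apply div_nonpos_of_nonpos_of_nonneg <;> linarith
    have hprod : ∀ v : V d, (nsq v + 1)^(1-a) ≤ ∏ i, ((v i:ℝ)^2+1)^β := by
      intro v
      have h0 := nsq_nonneg v
      calc (nsq v + 1)^(1-a) = ∏ i : Fin d, (nsq v + 1)^β := by
            rw [Finset.prod_const, Finset.card_univ, Fintype.card_fin, ← Real.rpow_natCast,
              ← Real.rpow_mul (by linarith)]
            congr 1; rw [ha, hβ]; field_simp; ring
        _ ≤ _ := by
            apply Finset.prod_le_prod
            · intro i _; exact Real.rpow_nonneg (by linarith) _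
            · intro i _
              exact Real.rpow_le_rpow_of_nonpos (by positivity) (by linarith [coord_le v i]) hβ0
    calc _ ≤ ∑ w ∈ E with (∀ i, |((y - w) i : ℝ)| ≤ R), ∏ i, (((y-w) i:ℝ)^2+1)^β :=
          Finset.sum_le_sum fun w _ => hprod (y-w)
      _ = ∑ v ∈ (Finset.filter (fun w => (∀ i, |((y - w) i : ℝ)| ≤ R)) E).image (fun w => y - w),
            ∏ i, ((v i:ℝ)^2+1)^β := by
          rw [Finset.sum_image]
          intro a _ b _ h
          exact sub_right_injective h
      _ ≤ ∑ v ∈ Fintype.piFinset (fun _ : Fin d => Finset.Icc (-(⌊R⌋₊:ℤ)) ⌊R⌋₊),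
            ∏ i, ((v i:ℝ)^2+1)^β := by
          apply Finset.sum_le_sum_of_subset_of_nonneg
          · intro v hv
            rw [Finset.mem_image] at hv
            obtain ⟨w, hw, rfl⟩ := hv
            obtain ⟨-, hw⟩ := Finset.mem_filter.1 hw
            rw [Fintype.mem_piFinset]
            intro i
            have hi := hw i
            have h1 : ((y-w) i).natAbs ≤ ⌊R⌋₊ := by
              apply Nat.le_floor
              rw [Nat.cast_natAbs]; exact_mod_cast hi
            rw [Finset.mem_Icc]; omega
          · intro v _ _
            exact Finset.prod_nonneg fun i _ => Real.rpow_nonneg (by positivity) _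
      _ = ∏ i : Fin d, ∑ j ∈ Finset.Icc (-(⌊R⌋₊:ℤ)) ⌊R⌋₊, ((j:ℝ)^2+1)^β := by
          rw [Finset.prod_univ_sum]
      _ ≤ ∏ i : Fin d, ((1 + d) * R^(2/(d:ℝ))) := by
          apply Finset.prod_le_prod
          · intro i _; exact Finset.sum_nonneg fun j _ => Real.rpow_nonneg (by positivity) _
          · intro i _; exact sum_1d d hd R hR1
      _ = (1+(d:ℝ))^d * R^2 := by
          rw [Finset.prod_const, Finset.card_univ, Fintype.card_fin, mul_pow, ← Real.rpow_natCast (R^(2/(d:ℝ))),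
            ← Real.rpow_mul hR0.le, ← Real.rpow_natCast R 2]
          congr 2; push_cast; field_simp
  rw [← hR2]
  linarith

end

section

/-! ### Euclidean norm, balls -/
section nm
variable {d : ℕ}

noncomputable def nm (y : V d) : ℝ := Real.sqrt (nsq y)

noncomputable def toE (y : V d) : EuclideanSpace ℝ (Fin d) := WithLp.toLp 2 (fun i => (y i : ℝ))

lemma nm_eq (y : V d) : nm y = ‖toE y‖ := by
  rw [EuclideanSpace.norm_eq]
  simp [nm, nsq, toE]

lemma nm_add (x y : V d) : nm (x + y) ≤ nm x + nm y := by
  simp only [nm_eq]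
  have : toE (x + y) = toE x + toE y := by ext i; simp [toE]
  rw [this]; exact norm_add_le _ _

lemma nm_neg (x : V d) : nm (-x) = nm x := by simp [nm, nsq]

lemma nm_sub (x y : V d) : nm (x - y) ≤ nm x + nm y := by
  rw [sub_eq_add_neg, ← nm_neg y]; exact nm_add _ _

lemma nm_sub_comm (x y : V d) : nm (x - y) = nm (y - x) := by rw [← nm_neg, neg_sub]

lemma nm_nonneg (x : V d) : 0 ≤ nm x := Real.sqrt_nonneg _

lemma nm_sq (x : V d) : nm x ^ 2 = nsq x := Real.sq_sqrt (nsq_nonneg x)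

lemma nm_zero : nm (0 : V d) = 0 := by simp [nm, nsq_zero]

lemma nsq_ev (i : Fin d) : nsq (ev i) = 1 := by
  have := nsq_add (0 : V d) i
  simpa [nsq_zero] using this

lemma nm_unit {e : V d} (he : e ∈ unitVecs d) : nm e = 1 := by
  obtain ⟨i, rfl | rfl⟩ := (mem_unitVecs e).1 he
  · simp [nm, nsq_ev]
  · rw [nm_neg]; simp [nm, nsq_ev]

lemma nm_nbr (x : V d) {e : V d} (he : e ∈ unitVecs d) : nm (x + e) ≤ nm x + 1 := by
  have := nm_add x e
  rwa [nm_unit he] at this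

lemma nm_nbr' (x : V d) {e : V d} (he : e ∈ unitVecs d) : nm x - 1 ≤ nm (x + e) := by
  have := nm_sub (x + e) e
  rw [nm_unit he, add_sub_cancel_right] at this
  linarith

lemma mem_ball {r : ℝ} {y : V d} : y ∈ ball d r ↔ nm y ≤ r := by
  unfold ball
  rw [Finset.mem_filter]
  constructor
  · exact fun h => h.2
  · intro h
    refine ⟨?_, h⟩
    rw [Finset.mem_Icc]
    have hi : ∀ i, |(y i : ℝ)| ≤ ⌈r⌉ := by
      intro i
      refine le_trans ?_ (Int.le_ceil r)
      refine le_trans ?_ h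
      exact Real.abs_le_sqrt (coord_le y i)
    constructor
    · intro i
      have := (abs_le.1 (hi i)).1
      exact_mod_cast this
    · intro i
      have := (abs_le.1 (hi i)).2
      exact_mod_cast this

lemma nsq_le_of_mem {r : ℝ} {y : V d} (h : y ∈ ball d r) : nsq y ≤ r^2 := by
  rw [mem_ball] at h
  rw [← nm_sq]
  exact pow_le_pow_left₀ (nm_nonneg y) h 2

lemma mem_ball_of_nsq {r : ℝ} (hr : 0 ≤ r) {y : V d} (h : nsq y ≤ r^2) : y ∈ ball d r := by
  rw [mem_ball]; exact Real.sqrt_le_iff.2 ⟨hr, h⟩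

lemma ball_mono {r s : ℝ} (h : r ≤ s) : ball d r ⊆ ball d s := by
  intro y hy; rw [mem_ball] at *; linarith

lemma outb_ball {r : ℝ} {y : V d} (h : y ∈ outb (ball d r)) : r < nm y ∧ nm y ≤ r + 1 := by
  obtain ⟨h1, x, hx, e, he, rfl⟩ := (mem_outb _ _).1 h
  rw [mem_ball] at h1 hx
  exact ⟨not_le.1 h1, by linarith [nm_nbr x he]⟩

lemma nsq_of_nm_le {y : V d} {r : ℝ} (h : nm y ≤ r) : nsq y ≤ r^2 := by
  rw [← nm_sq]; exact pow_le_pow_left₀ (nm_nonneg y) h 2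

lemma nsq_of_le_nm {y : V d} {r : ℝ} (hr : 0 ≤ r) (h : r ≤ nm y) : r^2 ≤ nsq y := by
  rw [← nm_sq]; exact pow_le_pow_left₀ hr h 2

end nm

/-! ### Green functions -/
section green
variable {d : ℕ}

lemma neg_mem_unitVecs {e : V d} (he : e ∈ unitVecs d) : -e ∈ unitVecs d := by
  rw [mem_unitVecs] at *
  obtain ⟨i, rfl | rfl⟩ := he
  · exact ⟨i, Or.inr rfl⟩
  · exact ⟨i, Or.inl (neg_neg _)⟩

lemma sum_unitVecs_neg (g : V d → ℝ) : ∑ e ∈ unitVecs d, g (-e) = ∑ e ∈ unitVecs d, g e := by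
  rw [sum_unitVecs, sum_unitVecs]
  refine Finset.sum_congr rfl fun i _ => ?_
  rw [neg_neg, add_comm]

lemma avg_nonneg {f : V d → ℝ} (h : ∀ y, 0 ≤ f y) (y : V d) : 0 ≤ avg f y := by
  rw [avg_eq_unitVecs]
  exact div_nonneg (Finset.sum_nonneg fun e _ => h _) (by positivity)

lemma sum_by_parts (S : Finset (V d)) (f w : V d → ℝ) (hf : ∀ y, y ∉ S → f y = 0) :
    ∑ y ∈ S, f y * (w y - avg w y) = ∑ y ∈ S ∪ outb S, w y * (f y - avg f y) := by
  classical
  have h1 : ∀ e ∈ unitVecs d, ∑ y ∈ S, f y * w (y + e) = ∑ y ∈ S ∪ outb S, w y * f (y + -e) := by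
    intro e he
    have : ∑ y ∈ S, f y * w (y + e) = ∑ y ∈ S.image (fun y => y + e), w y * f (y + -e) := by
      rw [Finset.sum_image (fun a _ b _ h => add_right_cancel h)]
      refine Finset.sum_congr rfl fun y _ => ?_
      rw [add_neg_cancel_right, mul_comm]
    rw [this]
    apply Finset.sum_subset
    · intro y hy
      obtain ⟨x, hx, rfl⟩ := Finset.mem_image.1 hy
      exact nbr_mem hx he
    · intro y _ hy
      rw [hf, mul_zero]
      intro hc
      exact hy (Finset.mem_image.2 ⟨_, hc, by simp⟩)
  have h2 : ∑ y ∈ S, f y * avg w y = ∑ y ∈ S ∪ outb S, w y * avg f y := by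
    simp only [avg_eq_unitVecs, mul_div_assoc', ← Finset.sum_div, Finset.mul_sum]
    congr 1
    rw [Finset.sum_comm, Finset.sum_congr rfl h1, Finset.sum_comm]
    refine Finset.sum_congr rfl fun y _ => ?_
    rw [← sum_unitVecs_neg (fun e => w y * f (y + e))]
  have h3 : ∑ y ∈ S, f y * w y = ∑ y ∈ S ∪ outb S, w y * f y := by
    rw [← Finset.sum_subset (Finset.subset_union_left (s₁ := S) (s₂ := outb S))]
    · exact Finset.sum_congr rfl fun y _ => mul_comm _ _
    · intro y _ hy; rw [hf y hy, mul_zero]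
  simp only [mul_sub, Finset.sum_sub_distrib, h2, h3]

open Classical in
noncomputable def extS (S : Finset (V d)) : (S → ℝ) →ₗ[ℝ] (V d → ℝ) where
  toFun f := fun y => if h : y ∈ S then f ⟨y, h⟩ else 0
  map_add' f g := by
    funext y; by_cases h : y ∈ S <;> simp [h]
  map_smul' c f := by
    funext y; by_cases h : y ∈ S <;> simp [h]

lemma extS_not (S : Finset (V d)) (f : S → ℝ) {y : V d} (hy : y ∉ S) : extS S f y = 0 := by
  simp [extS, hy]

noncomputable def lapS (S : Finset (V d)) : (S → ℝ) →ₗ[ℝ] (S → ℝ) where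
  toFun f := fun y => extS S f y - avg (extS S f) y
  map_add' f g := by
    funext y
    have : extS S (f + g) = fun z => extS S f z + extS S g z := by rw [map_add]; rfl
    rw [this]
    simp only [avg_add, Pi.add_apply]
    ring
  map_smul' c f := by
    funext y
    have : extS S (c • f) = fun z => c * extS S f z := by rw [map_smul]; rfl
    rw [this]
    simp only [avg_smul, Pi.smul_apply, smul_eq_mul, RingHom.id_apply]
    ring

lemma lapS_inj (hd : 0 < d) (S : Finset (V d)) : Function.Injective (lapS S) := by
  rw [← LinearMap.ker_eq_bot, LinearMap.ker_eq_bot']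
  intro f hf
  have h0 : ∀ y (hy : y ∈ S), extS S f y - avg (extS S f) y = 0 := fun y hy => congrFun hf ⟨y, hy⟩
  have h1 := min_principle hd S (extS S f) (fun s hs => by linarith [h0 s hs]) 0
    (fun y hy => by rw [extS_not S f (notMem_of_outb hy)])
  have h2 := min_principle hd S (fun y => - extS S f y) (fun s hs => by
      rw [avg_neg]; linarith [h0 s hs]) 0
    (fun y hy => by rw [extS_not S f (notMem_of_outb hy)]; simp)
  funext ⟨y, hy⟩
  have h3 := h1 y hy
  have h4 := h2 y hy
  have : extS S f y = f ⟨y, hy⟩ := by simp [extS, hy]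
  rw [this] at h3 h4
  simp only [Pi.zero_apply]
  linarith

open Classical in
theorem green_exists (hd : 0 < d) (S : Finset (V d)) (z : V d) :
    ∃ f : V d → ℝ, (∀ y, y ∉ S → f y = 0) ∧
      (∀ y ∈ S, f y - avg f y = if y = z then 1 else 0) := by
  have hs := (LinearMap.injective_iff_surjective (f := lapS S)).1 (lapS_inj hd S)
  obtain ⟨f, hf⟩ := hs (fun y => if (y:V d) = z then 1 else 0)
  refine ⟨extS S f, fun y hy => extS_not S f hy, fun y hy => ?_⟩
  exact congrFun hf ⟨y, hy⟩

open Classical in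
noncomputable def green (S : Finset (V d)) (z : V d) : V d → ℝ :=
  if hd : 0 < d then (green_exists hd S z).choose else 0

lemma green_off (hd : 0 < d) (S : Finset (V d)) (z : V d) {y : V d} (hy : y ∉ S) :
    green S z y = 0 := by
  unfold green; rw [dif_pos hd]
  exact (green_exists hd S z).choose_spec.1 y hy

open Classical in
lemma green_lap (hd : 0 < d) (S : Finset (V d)) (z : V d) {y : V d} (hy : y ∈ S) :
    green S z y - avg (green S z) y = if y = z then 1 else 0 := by
  unfold green; rw [dif_pos hd]
  exact (green_exists hd S z).choose_spec.2 y hy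

lemma green_super (hd : 0 < d) (S : Finset (V d)) (z : V d) {y : V d} (hy : y ∈ S) :
    avg (green S z) y ≤ green S z y := by
  have := green_lap hd S z hy
  split_ifs at this <;> linarith

lemma green_nonneg (hd : 0 < d) (S : Finset (V d)) (z y : V d) : 0 ≤ green S z y := by
  by_cases hy : y ∈ S
  · exact min_principle hd S (green S z) (fun s hs => green_super hd S z hs) 0
      (fun y hy => by rw [green_off hd S z (notMem_of_outb hy)]) y hy
  · rw [green_off hd S z hy]

/-- subharmonic away from z -/
lemma green_sub (hd : 0 < d) (S : Finset (V d)) (z : V d) {y : V d} (hy : y ≠ z) :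
    green S z y ≤ avg (green S z) y := by
  by_cases h : y ∈ S
  · have := green_lap hd S z h
    rw [if_neg hy] at this; linarith
  · rw [green_off hd S z h]
    exact avg_nonneg (green_nonneg hd S z) y

lemma green_parts (hd : 0 < d) (S : Finset (V d)) (z : V d) (hz : z ∈ S) (w : V d → ℝ) :
    ∑ y ∈ S, green S z y * (w y - avg w y) = w z - ∑ y ∈ outb S, w y * avg (green S z) y := by
  classical
  rw [sum_by_parts S _ w (fun y hy => green_off hd S z hy), Finset.sum_union]
  · rw [Finset.sum_congr rfl (fun y hy => by rw [green_lap hd S z hy])]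
    rw [Finset.sum_congr (s₁ := outb S) rfl
      (fun y hy => by rw [green_off hd S z (notMem_of_outb hy)])]
    simp [hz, sub_eq_add_neg]
  · rw [Finset.disjoint_right]
    exact fun y hy => notMem_of_outb hy

lemma green_sum_le (hd : 0 < d) (S : Finset (V d)) (z : V d) (hz : z ∈ S) (w : V d → ℝ)
    (hw : ∀ y ∈ outb S, 0 ≤ w y) : ∑ y ∈ S, green S z y * (w y - avg w y) ≤ w z := by
  rw [green_parts hd S z hz w]
  have : 0 ≤ ∑ y ∈ outb S, w y * avg (green S z) y := Finset.sum_nonneg fun y hy =>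
    mul_nonneg (hw y hy) (avg_nonneg (green_nonneg hd S z) y)
  linarith

lemma green_sum_ge (hd : 0 < d) (S : Finset (V d)) (z : V d) (hz : z ∈ S) (w : V d → ℝ)
    (hw : ∀ y ∈ outb S, w y ≤ 0) : w z ≤ ∑ y ∈ S, green S z y * (w y - avg w y) := by
  rw [green_parts hd S z hz w]
  have : ∑ y ∈ outb S, w y * avg (green S z) y ≤ 0 := Finset.sum_nonpos fun y hy =>
    mul_nonpos_of_nonpos_of_nonneg (hw y hy) (avg_nonneg (green_nonneg hd S z) y)
  linarith

lemma green_symm (hd : 0 < d) (S : Finset (V d)) {x z : V d} (hx : x ∈ S) (hz : z ∈ S) :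
    green S z x = green S x z := by
  classical
  have key : ∀ x z, x ∈ S → z ∈ S → green S z x ≤ green S x z := by
    intro x z hx hz
    have := green_sum_le hd S z hz (green S x) (fun y _ => green_nonneg hd S x y)
    rw [Finset.sum_congr rfl (fun y hy => by rw [green_lap hd S x hy])] at this
    simpa [hx] using this
  exact le_antisymm (key x z hx hz) (key z x hz hx)

lemma green_le (hd : 0 < d) (S : Finset (V d)) (z : V d) (g : V d → ℝ)
    (hg : ∀ y ∈ S, avg g y ≤ g y) (hz : 1 ≤ g z - avg g z) (hb : ∀ y ∈ outb S, 0 ≤ g y) :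
    ∀ y ∈ S, green S z y ≤ g y := by
  intro y hy
  have := min_principle hd S (fun y => g y - green S z y) (fun s hs => by
    rw [avg_sub]
    have h1 := green_lap hd S z hs
    split_ifs at h1 with h
    · subst h; linarith
    · linarith [hg s hs]) 0 (fun y hy => by
      rw [green_off hd S z (notMem_of_outb hy)]; simpa using hb y hy) y hy
  linarith

lemma green_total_le (hd : 0 < d) (n : ℕ) (z : V d) (hz : z ∈ ball d n) :
    ∑ y ∈ ball d n, green (ball d n) z y ≤ ((n:ℝ)+1)^2 - nsq z := by
  have := green_sum_le hd (ball d n) z hz (fun y => ((n:ℝ)+1)^2 - nsq y) (fun y hy => by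
    have := nsq_of_nm_le (outb_ball hy).2
    linarith)
  refine le_trans (le_of_eq ?_) this
  refine Finset.sum_congr rfl fun y _ => ?_
  rw [avg_sub, avg_const hd, avg_nsq hd]; ring

lemma green_total_ge (hd : 0 < d) (n : ℕ) (z : V d) (hz : z ∈ ball d n) :
    (n:ℝ)^2 - nsq z ≤ ∑ y ∈ ball d n, green (ball d n) z y := by
  have := green_sum_ge hd (ball d n) z hz (fun y => (n:ℝ)^2 - nsq y) (fun y hy => by
    have := nsq_of_le_nm (by positivity) (outb_ball hy).1.le
    linarith)
  refine le_trans this (le_of_eq ?_)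
  refine Finset.sum_congr rfl fun y _ => ?_
  rw [avg_sub, avg_const hd, avg_nsq hd]; ring

/-- Upper bounds for the Green function of a ball. -/
theorem green_bound (d : ℕ) (hd : 2 ≤ d) : ∃ C : ℝ, 1 ≤ C ∧ ∀ (n : ℕ), 2 ≤ n → ∀ z ∈ ball d n, ∀ y,
    green (ball d n) z y ≤ C * Real.log n * (nsq (y - z) + 1)^(1 - (d/2:ℝ)) := by
  obtain ⟨C, hC, h⟩ := pot_exists d hd
  have hd0 : 0 < d := by omega
  have hl2 : 0 < Real.log 2 := Real.log_pos (by norm_num)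
  have hlC : 0 ≤ Real.log (9 + C) := Real.log_nonneg (by linarith)
  refine ⟨C * (2 + Real.log (9+C) / Real.log 2) , ?_, ?_⟩
  · have : 0 ≤ Real.log (9+C)/Real.log 2 := by positivity
    nlinarith
  intro n hn z hz y
  have hnR : (2:ℝ) ≤ n := by exact_mod_cast hn
  have hln : Real.log 2 ≤ Real.log n := Real.log_le_log (by norm_num) hnR
  have hlog : Real.log ((2*(n:ℝ)+1)^2 + C) ≤ (2 + Real.log (9+C) / Real.log 2) * Real.log n := by
    have h1 : (2*(n:ℝ)+1)^2 + C ≤ (n:ℝ)^2 * (9 + C) := by nlinarith [mul_nonneg (by linarith : (0:ℝ) ≤ C) (by nlinarith : (0:ℝ) ≤ (n:ℝ)^2 - 1)]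
    calc _ ≤ Real.log ((n:ℝ)^2 * (9+C)) := Real.log_le_log (by positivity) h1
      _ = 2 * Real.log n + Real.log (9+C) := by
          rw [Real.log_mul (by positivity) (by positivity), Real.log_pow]; push_cast; ring
      _ ≤ 2 * Real.log n + Real.log (9+C) / Real.log 2 * Real.log n := by
          have : Real.log (9+C) = Real.log (9+C) / Real.log 2 * Real.log 2 := by field_simp
          have h3 : Real.log (9+C) / Real.log 2 * Real.log 2 ≤ Real.log (9+C) / Real.log 2 * Real.log n :=
            mul_le_mul_of_nonneg_left hln (by positivity)
          linarith
      _ = _ := by ring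
  obtain ⟨g, hg1, hg2, hg3⟩ := h ((2*(n:ℝ)+1)^2) (by positivity)
  have hpos : 0 ≤ (nsq (y - z) + 1)^(1 - (d/2:ℝ)) := Real.rpow_nonneg (by linarith [nsq_nonneg (y-z)]) _
  by_cases hy : y ∈ ball d n
  · have hzn := mem_ball.1 hz
    have := green_le hd0 (ball d n) z (fun v => g (v - z)) (fun v _ => by
      rw [avg_translate]; exact hg1 _) (by rw [avg_translate, sub_self]; exact hg2) (fun v hv => by
      refine (hg3 _ ?_).1
      apply nsq_of_nm_le
      linarith [nm_sub v z, (outb_ball hv).2]) y hy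
    refine this.trans ?_
    refine (hg3 (y-z) ?_).2.trans ?_
    · apply nsq_of_nm_le
      linarith [nm_sub y z, mem_ball.1 hy]
    · apply mul_le_mul_of_nonneg_right _ hpos
      rw [mul_assoc]
      exact mul_le_mul_of_nonneg_left hlog (by linarith)
  · rw [green_off hd0 _ _ hy]
    have : 0 ≤ Real.log n := by linarith
    positivity

end green

end

section

/-! volume of lattice balls -/

def eD (d : ℕ) (ρ : ℝ) : Set (Fin d → ℝ) := {x | ∑ i, x i ^ 2 ≤ ρ ^ 2}

def cubeQ {d : ℕ} (y : V d) : Set (Fin d → ℝ) :=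
  Set.pi Set.univ (fun i => Set.Ico (y i : ℝ) ((y i : ℝ) + 1))

lemma volume_cubeQ {d : ℕ} (y : V d) : volume (cubeQ y) = 1 := by
  rw [cubeQ, Real.volume_pi_Ico]
  simp

lemma measurable_cubeQ {d : ℕ} (y : V d) : MeasurableSet (cubeQ y) :=
  MeasurableSet.univ_pi (fun _ => measurableSet_Ico)

lemma mem_cubeQ {d : ℕ} (y : V d) (x : Fin d → ℝ) : x ∈ cubeQ y ↔ ∀ i, ⌊x i⌋ = y i := by
  simp [cubeQ, Int.floor_eq_iff]

lemma volume_cubes {d : ℕ} (S : Finset (V d)) : volume (⋃ y ∈ S, cubeQ y) = S.card := by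
  rw [measure_biUnion_finset]
  · simp [volume_cubeQ]
  · intro y _ z _ hyz
    rw [Function.onFun, Set.disjoint_left]
    intro x hx hx'
    rw [mem_cubeQ] at hx hx'
    exact hyz (funext fun i => (hx i).symm.trans (hx' i))
  · intro y _
    exact measurable_cubeQ y

lemma eD_eq {d : ℕ} (ρ : ℝ) (hρ : 0 ≤ ρ) (x : Fin d → ℝ) :
    x ∈ eD d ρ ↔ ‖(WithLp.toLp 2 x : EuclideanSpace ℝ (Fin d))‖ ≤ ρ := by
  rw [EuclideanSpace.norm_eq, Real.sqrt_le_left hρ]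
  simp [eD]

lemma cube_norm {d : ℕ} (y : V d) (x : Fin d → ℝ) (hx : x ∈ cubeQ y) :
    ‖(WithLp.toLp 2 x : EuclideanSpace ℝ (Fin d)) - toE y‖ ≤ Real.sqrt d := by
  rw [EuclideanSpace.norm_eq]
  apply Real.sqrt_le_sqrt
  calc _ ≤ ∑ i : Fin d, (1:ℝ) := by
        apply Finset.sum_le_sum
        intro i _
        have := (Set.mem_univ_pi.1 hx i)
        simp only [toE, PiLp.sub_apply]
        rw [Real.norm_eq_abs, sq_abs]
        have h1 := this.1
        have h2 := this.2
        nlinarith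
    _ = d := by simp

open scoped Pointwise in
lemma volume_eD {d : ℕ} (ρ : ℝ) (hρ : 0 < ρ) :
    volume (eD d ρ) = ENNReal.ofReal (ρ ^ d) * volume (eD d 1) := by
  have : eD d ρ = (ρ • eD d 1 : Set (Fin d → ℝ)) := by
    ext x
    rw [Set.mem_smul_set_iff_inv_smul_mem₀ hρ.ne']
    simp only [eD, Set.mem_ofPred_eq, Pi.smul_apply, smul_eq_mul, mul_pow, ← Finset.mul_sum]
    have : 0 < ρ^2 := by positivity
    rw [inv_pow, inv_mul_le_iff₀ this]
    simp
  rw [this, Measure.addHaar_smul]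
  simp [abs_of_pos hρ]

theorem card_ball (d : ℕ) (hd : 0 < d) : ∃ w : ℝ, 0 < w ∧ ∀ r : ℝ, 0 ≤ r →
    ((ball d r).card : ℝ) ≤ w * (r + Real.sqrt d) ^ d ∧
    (Real.sqrt d ≤ r → w * (r - Real.sqrt d) ^ d ≤ (ball d r).card) := by
  have hfin : volume (eD d 1) ≠ ⊤ := by
    have : eD d 1 ⊆ Set.pi Set.univ (fun _ => Set.Icc (-1:ℝ) 1) := by
      intro x hx i _
      have : x i ^ 2 ≤ ∑ i, x i ^ 2 := Finset.single_le_sum (f := fun i => x i ^2)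
        (fun i _ => sq_nonneg _) (Finset.mem_univ i)
      have h2 : ∑ i, x i ^ 2 ≤ 1 ^ 2 := hx
      exact abs_le.1 (abs_le_of_sq_le_sq (by linarith) (by norm_num))
    refine ne_top_of_le_ne_top ?_ (measure_mono this)
    rw [MeasureTheory.volume_pi_pi]
    exact ENNReal.prod_ne_top (by simp)
  have hpos : volume (eD d 1) ≠ 0 := by
    have : Set.pi Set.univ (fun _ => Set.Icc (0:ℝ) (1/d)) ⊆ eD d 1 := by
      intro x hx
      have hd' : (1:ℝ) ≤ d := by exact_mod_cast hd
      show ∑ i, x i ^ 2 ≤ 1 ^ 2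
      calc _ ≤ ∑ i : Fin d, (1/d:ℝ) := by
            apply Finset.sum_le_sum
            intro i _
            have h1 := hx i (Set.mem_univ i)
            have h2 : (1/d:ℝ) ≤ 1 := by rw [div_le_one (by linarith)]; exact hd'
            nlinarith [h1.1, h1.2]
        _ = _ := by simp; field_simp
    intro h0
    have := measure_mono_null this h0
    rw [MeasureTheory.volume_pi_pi] at this
    simp only [Real.volume_Icc, sub_zero, Finset.prod_const] at this
    have h3 : ENNReal.ofReal (1/d) ≠ 0 := by
      simp; omega
    exact pow_ne_zero _ h3 this
  refine ⟨(volume (eD d 1)).toReal, ENNReal.toReal_pos hpos hfin, ?_⟩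
  have key : ∀ ρ : ℝ, 0 < ρ → (volume (eD d ρ)).toReal = (volume (eD d 1)).toReal * ρ ^ d := by
    intro ρ hρ
    rw [volume_eD ρ hρ, ENNReal.toReal_mul, ENNReal.toReal_ofReal (by positivity), mul_comm]
  have keyfin : ∀ ρ : ℝ, 0 < ρ → volume (eD d ρ) ≠ ⊤ := by
    intro ρ hρ
    rw [volume_eD ρ hρ]
    exact ENNReal.mul_ne_top ENNReal.ofReal_ne_top hfin
  have hsd : 0 < Real.sqrt d := Real.sqrt_pos.2 (by exact_mod_cast hd)
  intro r hr
  constructor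
  · rw [← key _ (by positivity)]
    have : ((ball d r).card : ℝ) = (volume (⋃ y ∈ ball d r, cubeQ y)).toReal := by
      rw [volume_cubes]; simp
    rw [this]
    apply ENNReal.toReal_mono (keyfin _ (by positivity))
    apply measure_mono
    intro x hx
    simp only [Set.mem_iUnion, exists_prop] at hx
    obtain ⟨y, hy, hx⟩ := hx
    rw [eD_eq _ (by positivity)]
    have h1 := cube_norm y x hx
    have h2 := mem_ball.1 hy
    rw [nm_eq] at h2
    have := norm_le_norm_add_norm_sub' (WithLp.toLp 2 x : EuclideanSpace ℝ (Fin d)) (toE y)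
    linarith
  · intro h
    rcases eq_or_lt_of_le h with h | h
    · rw [h]; simp [hd.ne']
    rw [← key _ (by linarith)]
    have : ((ball d r).card : ℝ) = (volume (⋃ y ∈ ball d r, cubeQ y)).toReal := by
      rw [volume_cubes]; simp
    rw [this]
    apply ENNReal.toReal_mono (by rw [volume_cubes]; simp)
    apply measure_mono
    intro x hx
    rw [eD_eq _ (by linarith)] at hx
    simp only [Set.mem_iUnion, exists_prop]
    have hq : x ∈ cubeQ (fun i => ⌊x i⌋) := by rw [mem_cubeQ]; intro i; rfl
    refine ⟨fun i => ⌊x i⌋, ?_, hq⟩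
    have h1 := cube_norm _ x hq
    rw [mem_ball, nm_eq]
    have := norm_le_norm_add_norm_sub (WithLp.toLp 2 x : EuclideanSpace ℝ (Fin d)) (toE fun i => ⌊x i⌋)
    linarith

end

section

/-! quadrature -/

/-- `A ψ(s-K)` continued linearly below `M`. -/
noncomputable def hq (a A K M s : ℝ) : ℝ :=
  if M ≤ s then A * psi a (s - K) else A * psi a (M - K) + A * (M - K) ^ (-a) * (M - s)

lemma hq_tangent {a A K M : ℝ} (ha : 0 ≤ a) (hA : 0 ≤ A) (hM : 0 < M - K) (s : ℝ) :
    ∃ q, 0 ≤ q ∧ q ≤ A * (M - K) ^ (-a) ∧ ∀ t, hq a A K M s - q * (t - s) ≤ hq a A K M t := by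
  have hp : 0 ≤ (M - K) ^ (-a) := Real.rpow_nonneg hM.le _
  by_cases hs : M ≤ s
  · have hsK : 0 < s - K := by linarith
    have hle : (s - K) ^ (-a) ≤ (M - K) ^ (-a) :=
      Real.rpow_le_rpow_of_nonpos hM (by linarith) (by linarith)
    have hp2 : 0 ≤ (s - K) ^ (-a) := Real.rpow_nonneg hsK.le _
    refine ⟨A * (s - K) ^ (-a), by positivity, by gcongr, fun t => ?_⟩
    unfold hq
    rw [if_pos hs]
    split_ifs with ht
    · rcases le_total s t with h | h
      · have := (psi_mv a hsK (show s - K ≤ t - K by linarith) ha).2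
        nlinarith [mul_le_mul_of_nonneg_left this hA]
      · have := (psi_mv a (show 0 < t - K by linarith) (show t - K ≤ s - K by linarith) ha).1
        nlinarith [mul_le_mul_of_nonneg_left this hA]
    · have := (psi_mv a hM (show M - K ≤ s - K by linarith) ha).1
      have h1 := mul_le_mul_of_nonneg_left this hA
      have h2 : A * (s - K) ^ (-a) * (M - t) ≤ A * (M - K) ^ (-a) * (M - t) := by
        apply mul_le_mul_of_nonneg_right (mul_le_mul_of_nonneg_left hle hA); linarith
      nlinarith
  · refine ⟨A * (M - K) ^ (-a), by positivity, le_rfl, fun t => ?_⟩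
    unfold hq
    rw [if_neg hs]
    split_ifs with ht
    · have := (psi_mv a hM (show M - K ≤ t - K by linarith) ha).2
      nlinarith [mul_le_mul_of_nonneg_left this hA]
    · nlinarith

lemma psi_quad {a s t : ℝ} (ha : 1 ≤ a) (hs : 0 < s) (hst : s ≤ t) :
    (t - s) + (t - s)^2 / (4 * t) ≤ t ^ a * (psi a s - psi a t) := by
  set m := (s+t)/2 with hm
  have ht : 0 < t := by linarith
  have hm0 : 0 < m := by rw [hm]; linarith
  have h1 := (psi_mv a hs (show s ≤ m by rw [hm]; linarith) (by linarith)).1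
  have h2 := (psi_mv a hm0 (show m ≤ t by rw [hm]; linarith) (by linarith)).1
  have hta : 0 < t ^ a := Real.rpow_pos_of_pos ht a
  have e2 : t ^ a * t ^ (-a) = 1 := by rw [← Real.rpow_add ht]; simp
  have e1 : 1 + (t - m)/t ≤ t ^ a * m ^ (-a) := by
    have : t ^ a * m ^ (-a) = (t/m)^a := by
      rw [Real.div_rpow ht.le hm0.le, Real.rpow_neg hm0.le, div_eq_mul_inv]
    rw [this]
    have h1m : 1 ≤ t/m := by rw [le_div_iff₀ hm0, hm]; linarith
    calc 1 + (t-m)/t ≤ t/m := by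
          rw [show 1 + (t-m)/t = (2*t-m)/t by field_simp; ring, div_le_div_iff₀ ht hm0]
          nlinarith [sq_nonneg (t-m)]
      _ = (t/m)^(1:ℝ) := by simp
      _ ≤ _ := Real.rpow_le_rpow_of_exponent_le h1m ha
  have h3 : t^a * (psi a s - psi a t) ≥ (m-s) * (t^a * m^(-a)) + (t - m) * (t^a*t^(-a)) := by
    nlinarith [mul_le_mul_of_nonneg_left h1 hta.le, mul_le_mul_of_nonneg_left h2 hta.le]
  rw [e2] at h3
  have h4 : (m-s) * (1 + (t - m)/t) ≤ (m-s) * (t^a * m^(-a)) :=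
    mul_le_mul_of_nonneg_left e1 (by rw [hm]; linarith)
  have h5 : (m-s) * (1 + (t - m)/t) + (t-m) = (t - s) + (t - s)^2 / (4 * t) := by
    rw [hm]; field_simp; ring
  linarith

theorem quad_raw {d : ℕ} (hd : 2 ≤ d) {K : ℝ} (hK : 0 ≤ K)
    (hsub : ∀ y : V d, 2 * K + 64 ≤ nsq y →
      psi (d/2) (nsq y - K) ≤ avg (fun z => psi (d/2) (nsq z - K)) y)
    (n : ℕ) (m : ℝ) (hm0 : 0 ≤ m) (hm : 2 * K + 64 ≤ m^2) (hmn : m + 1 ≤ n) (z : V d) (hz : z ∈ ball d n)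
    (hmz : m ≤ nm z) (F : ℝ) (hF0 : 0 ≤ F) (hF : ∀ y ∈ ball d (m+1), green (ball d n) z y ≤ F) :
    ∑ y ∈ ball d n, green (ball d n) z y + ((n:ℝ)^2 - nsq z)^2/(4*(n:ℝ)^2) ≤
      F * ((((n:ℝ)+1)^2 - K) ^ ((d:ℝ)/2) * (m^2 - K) ^ (-((d:ℝ)/2)) * (ball d (m+1)).card) := by
  have hd0 : 0 < d := by omega
  set a : ℝ := (d:ℝ)/2 with ha
  have hd' : (2:ℝ) ≤ d := by exact_mod_cast hd
  have ha1 : 1 ≤ a := by rw [ha]; linarith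
  set A : ℝ := (((n:ℝ)+1)^2 - K) ^ a with hA
  have hn1 : (1:ℝ) ≤ n := by linarith
  have hmnsq : m^2 ≤ (n:ℝ)^2 := by gcongr; linarith
  have hApos : 0 < A := Real.rpow_pos_of_pos (by nlinarith) _
  set q := A * (m^2 - K) ^ (-a) with hqdef
  have hMK : 0 < m^2 - K := by linarith
  have hq0 : 0 ≤ q := mul_nonneg hApos.le (Real.rpow_nonneg hMK.le _)
  set H := hq a A K (m^2) with hH
  set w : V d → ℝ := fun y => (nsq y - (n:ℝ)^2) + (H (nsq y) - H ((n:ℝ)^2)) with hw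
  have hHbig : ∀ s, m^2 ≤ s → H s = A * psi a (s - K) := fun s hs => by
    rw [hH, hq, if_pos hs]
  -- boundary
  have hwb : ∀ y ∈ outb (ball d n), w y ≤ 0 := by
    intro y hy
    have h1 := outb_ball hy
    have h2 := nsq_of_le_nm (by positivity) h1.1.le
    have h3 := nsq_of_nm_le h1.2
    simp only [hw]
    rw [hHbig _ (by linarith), hHbig _ hmnsq]
    have := (psi_mv a (show 0 < (n:ℝ)^2 - K by linarith) (show (n:ℝ)^2 - K ≤ nsq y - K by linarith) (by linarith)).1
    have h4 : 1 ≤ A * (nsq y - K) ^ (-a) := by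
      have hyK : 0 < nsq y - K := by linarith
      rw [Real.rpow_neg hyK.le, ← div_eq_mul_inv, le_div_iff₀ (Real.rpow_pos_of_pos hyK _), one_mul, hA]
      exact Real.rpow_le_rpow hyK.le (by linarith) (by linarith)
    have h5 := mul_le_mul_of_nonneg_left this hApos.le
    have h6 : (nsq y - (n:ℝ)^2) * 1 ≤ (nsq y - (n:ℝ)^2) * (A * (nsq y - K) ^ (-a)) :=
      mul_le_mul_of_nonneg_left h4 (by linarith)
    nlinarith
  have hsum := green_sum_ge hd0 (ball d n) z hz w hwb
  -- the Laplacian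
  have havg : ∀ y, w y - avg w y = -1 + (H (nsq y) - avg (fun u => H (nsq u)) y) := by
    intro y
    simp only [hw]
    rw [avg_add, avg_sub, avg_sub, avg_const hd0, avg_const hd0]
    have := avg_nsq hd0 y
    rw [this]; ring
  have hlap1 : ∀ y : V d, H (nsq y) - avg (fun u => H (nsq u)) y ≤ q := by
    intro y
    obtain ⟨q', h0, h1, h2⟩ := hq_tangent (a := a) (A := A) (by linarith) hApos.le hMK (nsq y)
    have h3 : avg (fun u => H (nsq y) - q' * (nsq u - nsq y)) y ≤ avg (fun u => H (nsq u)) y :=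
      avg_mono (fun e he => h2 _)
    rw [avg_sub, avg_const hd0, avg_smul, avg_sub, avg_const hd0] at h3
    have := avg_nsq hd0 y
    rw [this] at h3
    linarith
  have hlap2 : ∀ y, y ∉ ball d (m+1) → H (nsq y) - avg (fun u => H (nsq u)) y ≤ 0 := by
    intro y hy
    rw [mem_ball, not_le] at hy
    have h1 : m^2 ≤ nsq y := nsq_of_le_nm hm0 (by linarith)
    have h2 : avg (fun u => H (nsq u)) y = avg (fun u => A * psi a (nsq u - K)) y := by
      apply avg_congr
      intro e he
      exact hHbig _ (nsq_of_le_nm hm0 (by linarith [nm_nbr' y he]))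
    rw [h2, avg_smul, hHbig _ h1]
    have := hsub y (by linarith)
    nlinarith [mul_le_mul_of_nonneg_left this hApos.le]
  have hbound : ∑ y ∈ ball d n, green (ball d n) z y * (w y - avg w y) ≤
      - ∑ y ∈ ball d n, green (ball d n) z y + F * (q * (ball d (m+1)).card) := by
    have h1 : ∀ y ∈ ball d n, green (ball d n) z y * (w y - avg w y) ≤
        - green (ball d n) z y + (if y ∈ ball d (m+1) then F * q else 0) := by
      intro y hy
      rw [havg]
      have hg := green_nonneg hd0 (ball d n) z y
      split_ifs with h
      · have := mul_le_mul (hF y h) (le_refl q) hq0 hF0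
        nlinarith [mul_le_mul_of_nonneg_left (hlap1 y) hg]
      · nlinarith [mul_le_mul_of_nonneg_left (hlap2 y h) hg]
    refine (Finset.sum_le_sum h1).trans ?_
    rw [Finset.sum_add_distrib, Finset.sum_neg_distrib, ← Finset.sum_filter]
    have h2 : (ball d n).filter (fun y => y ∈ ball d (m+1)) = ball d (m+1) := by
      ext y
      simp only [Finset.mem_filter]
      exact ⟨fun h => h.2, fun h => ⟨ball_mono hmn h, h⟩⟩
    rw [h2, Finset.sum_const, nsmul_eq_mul]
    apply le_of_eq; ring
  have hwz : ((n:ℝ)^2 - nsq z)^2/(4*(n:ℝ)^2) ≤ w z := by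
    have h1 : m^2 ≤ nsq z := nsq_of_le_nm hm0 hmz
    have h2 := nsq_le_of_mem hz
    simp only [hw]
    rw [hHbig _ h1, hHbig _ hmnsq]
    have h3 := psi_quad ha1 (show 0 < nsq z - K by linarith) (show nsq z - K ≤ (n:ℝ)^2 - K by linarith)
    have h4 : ((n:ℝ)^2 - K)^a ≤ A := by
      rw [hA]; exact Real.rpow_le_rpow (by linarith) (by nlinarith) (by linarith)
    have h5 := psi_anti a (by linarith) (show 0 < nsq z - K by linarith) (show nsq z - K ≤ (n:ℝ)^2 - K by linarith)
    have h6 := mul_le_mul_of_nonneg_right h4 (sub_nonneg.2 h5)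
    have h7 : ((n:ℝ)^2 - nsq z)^2/(4*(n:ℝ)^2) ≤ ((n:ℝ)^2 - K - (nsq z - K))^2/(4*((n:ℝ)^2-K)) := by
      rw [show (n:ℝ)^2 - K - (nsq z - K) = (n:ℝ)^2 - nsq z by ring]
      apply div_le_div_of_nonneg_left (sq_nonneg _) (by linarith) (by linarith)
    nlinarith
  linarith

lemma one_add_pow_le (k : ℕ) {x : ℝ} (h0 : 0 ≤ x) (h1 : x ≤ 1) : (1+x)^k ≤ 1 + (2^k - 1) * x := by
  induction k with
  | zero => simp
  | succ k ih =>
    have h2 : (1:ℝ) ≤ 2^k := one_le_pow₀ (by norm_num)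
    calc (1+x)^(k+1) = (1+x)^k * (1+x) := pow_succ _ _
      _ ≤ (1 + (2^k - 1) * x) * (1+x) := by gcongr
      _ ≤ _ := by
        rw [pow_succ]
        have : (2^k-1) * (x*x) ≤ (2^k-1) * (x * 1) := by gcongr
        nlinarith

theorem quad (d : ℕ) (hd : 2 ≤ d) : ∃ C : ℝ, 1 ≤ C ∧ ∃ m0 : ℝ, 1 ≤ m0 ∧
    ∀ (n : ℕ) (m : ℝ), m0 ≤ m → m + 1 ≤ n → ∀ z ∈ ball d n, m ≤ nm z → ∀ F : ℝ, 0 ≤ F →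
    (∀ y ∈ ball d (m+1), green (ball d n) z y ≤ F) →
    ∑ y ∈ ball d n, green (ball d n) z y + ((n:ℝ)^2 - nsq z)^2/(4*(n:ℝ)^2) ≤
      F * (ball d n).card * (1 + C/m) := by
  have hd0 : 0 < d := by omega
  obtain ⟨K, hK, -, hsub⟩ := exists_K0 d hd0
  obtain ⟨w, hw0, hw⟩ := card_ball d hd0
  set b : ℝ := K + 1 + Real.sqrt d with hb
  have hsd : 0 ≤ Real.sqrt d := Real.sqrt_nonneg _
  refine ⟨2^(4*d) * (2*b), ?_, 2*b + 2*K + 64, by linarith, ?_⟩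
  · have : (1:ℝ) ≤ 2^(4*d) := one_le_pow₀ (by norm_num)
    nlinarith
  intro n m hm hmn z hz hmz F hF0 hF
  have hm1 : 1 ≤ m := by linarith
  refine (quad_raw hd (by linarith) hsub n m (by linarith) (by nlinarith) hmn z hz hmz F hF0 hF).trans ?_
  rw [mul_assoc F]
  apply mul_le_mul_of_nonneg_left _ hF0
  set t : ℝ := 2*b/m with ht
  have hmpos : 0 < m := by linarith
  have hb0 : 0 ≤ b := by linarith
  have ht0 : 0 ≤ t := by positivity
  have ht1 : t ≤ 1 := by rw [ht, div_le_one hmpos]; linarith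
  have htm : t * m = 2*b := by rw [ht]; field_simp
  have hnm : m ≤ n := by linarith
  have htn : 2*b ≤ t * n := by nlinarith
  have e1 : ((ball d (m+1)).card : ℝ) ≤ w * (m^d * (1+t)^d) := by
    refine (hw (m+1) (by linarith)).1.trans ?_
    rw [← mul_pow]; gcongr; nlinarith
  have sqd : ∀ x : ℝ, 0 ≤ x → (x^2)^((d:ℝ)/2) = x^d := by
    intro x hx
    rw [← Real.rpow_natCast x 2, ← Real.rpow_mul hx, ← Real.rpow_natCast x d]
    congr 1; push_cast; ring
  have e2 : (((n:ℝ)+1)^2 - K) ^ ((d:ℝ)/2) ≤ (n:ℝ)^d * (1+t)^d := by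
    rw [← mul_pow, ← sqd _ (by positivity)]
    apply Real.rpow_le_rpow (by nlinarith) _ (by positivity)
    have : ((n:ℝ)+1)^2 ≤ (n * (1+t))^2 := by gcongr; nlinarith
    linarith
  have e3 : (m^2 - K) ^ (-((d:ℝ)/2)) * m^d ≤ (1+t)^d := by
    have hp : 0 < m^2 - K := by nlinarith
    rw [Real.rpow_neg hp.le, inv_mul_le_iff₀ (Real.rpow_pos_of_pos hp _), ← sqd m hmpos.le,
      ← sqd (1+t) (by positivity), ← Real.mul_rpow hp.le (by positivity)]
    apply Real.rpow_le_rpow (by positivity) _ (by positivity)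
    have : K * (1+t) ≤ t * m^2 := by
      have : t * m^2 = 2*b*m := by rw [← htm]; ring
      rw [this]; nlinarith
    nlinarith
  have e4 : w * (n:ℝ)^d ≤ (ball d n).card * (1+t)^d := by
    have h1 := (hw n (by positivity)).2 (by linarith)
    calc w * (n:ℝ)^d ≤ w * (((n:ℝ) - Real.sqrt d) * (1+t))^d := by
          gcongr; nlinarith
      _ = w * ((n:ℝ) - Real.sqrt d)^d * (1+t)^d := by rw [mul_pow]; ring
      _ ≤ _ := by gcongr
  have hr : 0 ≤ (m^2 - K) ^ (-((d:ℝ)/2)) := Real.rpow_nonneg (by nlinarith) _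
  calc (((n:ℝ)+1)^2 - K) ^ ((d:ℝ)/2) * (m^2 - K) ^ (-((d:ℝ)/2)) * (ball d (m+1)).card
      ≤ ((n:ℝ)^d * (1+t)^d) * (m^2 - K) ^ (-((d:ℝ)/2)) * (w * (m^d * (1+t)^d)) := by gcongr
    _ = (w * (n:ℝ)^d) * ((m^2 - K) ^ (-((d:ℝ)/2)) * m^d) * (1+t)^d * (1+t)^d := by ring
    _ ≤ ((ball d n).card * (1+t)^d) * (1+t)^d * (1+t)^d * (1+t)^d := by gcongr
    _ = (ball d n).card * (1+t)^(4*d) := by ring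
    _ ≤ (ball d n).card * (1 + 2^(4*d) * t) := by
        gcongr
        have := one_add_pow_le (4*d) ht0 ht1
        nlinarith
    _ = _ := by rw [ht]; ring

end

section

/-! gradient estimate by reflection -/

variable {d : ℕ}

def rfl0 (x : V d) (i : Fin d) (y : V d) : V d := fun j => if j = i then 2 * x i + 1 - y j else y j

lemma avg_refl (x : V d) (i : Fin d) (f : V d → ℝ) (y : V d) :
    avg (fun u => f (rfl0 x i u)) y = avg f (rfl0 x i y) := by
  unfold avg
  congr 1
  refine Finset.sum_congr rfl fun j _ => ?_
  by_cases h : j = i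
  · subst h
    have h1 : rfl0 x j (y + ev j) = rfl0 x j y - ev j := by
      ext k; by_cases hk : k = j
      · subst hk; simp [rfl0, ev]; ring
      · simp [rfl0, ev, hk]
    have h2 : rfl0 x j (y - ev j) = rfl0 x j y + ev j := by
      ext k; by_cases hk : k = j
      · subst hk; simp [rfl0, ev]; ring
      · simp [rfl0, ev, hk]
    simp only [h1, h2]; rw [add_comm]
  · have h1 : rfl0 x i (y + ev j) = rfl0 x i y + ev j := by
      ext k; by_cases hk : k = i
      · subst hk; simp [rfl0, ev, Ne.symm h]
      · simp [rfl0, hk]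
    have h2 : rfl0 x i (y - ev j) = rfl0 x i y - ev j := by
      ext k; by_cases hk : k = i
      · subst hk; simp [rfl0, ev, Ne.symm h]
      · simp [rfl0, hk]
    simp only [h1, h2]

lemma avg_coord (hd : 0 < d) (i : Fin d) (c : ℝ) (y : V d) :
    avg (fun u : V d => ((u i : ℝ) - c)) y = (y i : ℝ) - c := by
  have hd' : (d:ℝ) ≠ 0 := by exact_mod_cast hd.ne'
  unfold avg
  have : ∀ j, ((((y + ev j : V d)) i : ℤ) : ℝ) - c + (((((y - ev j : V d)) i : ℤ) : ℝ) - c) = 2 * ((y i : ℝ) - c) := by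
    intro j; simp [ev]; ring
  simp only [this, Finset.sum_const, Finset.card_univ, Fintype.card_fin, nsmul_eq_mul]
  field_simp

lemma avg_coord_sq (hd : 0 < d) (i : Fin d) (c : ℝ) (y : V d) :
    avg (fun u : V d => ((u i : ℝ) - c)^2) y = ((y i : ℝ) - c)^2 + 1/d := by
  have hd' : (d:ℝ) ≠ 0 := by exact_mod_cast hd.ne'
  unfold avg
  have : ∀ j, (((((y + ev j : V d)) i : ℤ) : ℝ) - c)^2 + (((((y - ev j : V d)) i : ℤ) : ℝ) - c)^2 =
      2 * ((y i : ℝ) - c)^2 + (if j = i then 2 else 0) := by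
    intro j
    by_cases h : j = i
    · subst h; simp [ev]; ring
    · simp [ev, h, Ne.symm h]; ring
  simp only [this, Finset.sum_add_distrib, Finset.sum_const, Finset.card_univ, Fintype.card_fin, nsmul_eq_mul,
    Finset.sum_ite_eq', Finset.mem_univ, if_true]
  field_simp

lemma nsq_refl_le (x : V d) (i : Fin d) (y : V d) (h : x i + 1 ≤ y i) :
    nm (rfl0 x i y - x) ≤ nm (y - x) := by
  unfold nm
  apply Real.sqrt_le_sqrt
  unfold nsq
  apply Finset.sum_le_sum
  intro j _
  by_cases hj : j = i
  · subst hj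
    simp only [rfl0, Pi.sub_apply, if_true]
    have : (x j : ℝ) + 1 ≤ y j := by exact_mod_cast h
    push_cast
    nlinarith
  · simp [rfl0, hj]

theorem grad_one (hd : 0 < d) (x : V d) (i : Fin d) (ρ : ℝ) (hρ : 1 ≤ ρ) (f : V d → ℝ) (M : ℝ)
    (hM : ∀ y, nm (y - x) ≤ ρ + 1 → |f y| ≤ M) (hf : ∀ y, nm (y - x) ≤ ρ → avg f y = f y) :
    f (x + ev i) - f x ≤ 4 * d * M / ρ := by
  classical
  have hM0 : 0 ≤ M := (abs_nonneg _).trans (hM x (by simp [nm_zero]; linarith))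
  have hd1 : (1:ℝ) ≤ d := by exact_mod_cast hd
  set h : V d → ℝ := fun y => f y - f (rfl0 x i y) with hh
  have hx1 : rfl0 x i (x + ev i) = x := by
    ext j; by_cases hj : j = i
    · subst hj; simp [rfl0, ev]; ring
    · simp [rfl0, ev, hj]
  have hgoal : f (x + ev i) - f x = h (x + ev i) := by simp [hh, hx1]
  rw [hgoal]
  set Om : Finset (V d) := (ball d (nm x + ρ)).filter
    (fun y => nm (y - x) ≤ ρ ∧ x i + 1 ≤ y i ∧ 0 < h y) with hOm
  have memOm : ∀ y, y ∈ Om ↔ nm (y - x) ≤ ρ ∧ x i + 1 ≤ y i ∧ 0 < h y := by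
    intro y
    rw [hOm, Finset.mem_filter, mem_ball]
    refine ⟨fun h => h.2, fun h => ⟨?_, h⟩⟩
    have := nm_add (y - x) x
    rw [sub_add_cancel] at this
    linarith [h.1]
  set k : ℝ := 2 * M / ρ^2 with hk
  have hk0 : 0 ≤ k := by positivity
  set b : V d → ℝ := fun y => (2*d*ρ) * ((y i : ℝ) - x i) + (nsq (y - x) - d * ((y i : ℝ) - x i)^2) with hb
  have hbval : b (x + ev i) ≤ 2 * d * ρ := by
    simp only [hb, add_sub_cancel_left, nsq_ev]
    simp [ev]; linarith
  have hfin : k * (2 * d * ρ) = 4 * d * M / ρ := by rw [hk]; field_simp; ring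
  by_cases hmem : x + ev i ∈ Om
  swap
  · rw [memOm] at hmem
    have : h (x + ev i) ≤ 0 := by
      by_contra hc
      push Not at hc
      refine hmem ⟨?_, ?_, hc⟩
      · simp [nm, nsq_ev]; exact hρ
      · simp [ev]
    refine this.trans (by positivity)
  have hsuper : ∀ y ∈ Om, avg (fun u => k * b u - h u) y ≤ k * b y - h y := by
    intro y hy
    rw [memOm] at hy
    have e1 : avg h y = h y := by
      simp only [hh]
      rw [avg_sub, avg_refl, hf y hy.1, hf _ ((nsq_refl_le x i y hy.2.1).trans hy.1)]
    have e2 : avg b y = b y := by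
      simp only [hb]
      rw [avg_add, avg_smul, avg_coord hd, avg_sub, avg_smul, avg_coord_sq hd]
      have : avg (fun u => nsq (u - x)) y = nsq (y - x) + 1 := by
        have := avg_translate (fun u : V d => nsq u) x y
        rw [this]; exact avg_nsq hd _
      rw [this]; field_simp; ring
    rw [avg_sub, avg_smul, e1, e2]
  have hbd : ∀ y ∈ outb Om, 0 ≤ k * b y - h y := by
    intro y hy
    rw [mem_outb] at hy
    obtain ⟨hyn, u, hu, e, he, rfl⟩ := hy
    rw [memOm] at hu
    have hnm : nm (u + e - x) ≤ ρ + 1 := by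
      have := nm_nbr (u - x) he
      rw [show u - x + e = u + e - x by abel] at this
      linarith [hu.1]
    have hti : (((u + e) i : ℤ) : ℝ) - x i ≤ ρ + 1 := by
      have h1 := coord_le (u + e - x) i
      have h2 := nsq_of_nm_le hnm
      have h3 : (((u+e-x) i : ℤ) : ℝ) ≤ ρ + 1 := by
        exact abs_le_of_sq_le_sq' (h1.trans h2) (by linarith) |>.2
      simpa using h3
    have hbnn : x i ≤ (u + e) i → nsq (u + e - x) ≤ b (u + e) := by
      intro hle
      have h0 : (0:ℝ) ≤ (((u + e) i : ℤ) : ℝ) - x i := by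
        have : ((x i : ℤ) : ℝ) ≤ (((u + e) i : ℤ) : ℝ) := by exact_mod_cast hle
        linarith
      simp only [hb]
      have h5 : (((u + e) i : ℤ) : ℝ) - x i ≤ 2 * ρ := by linarith
      have : 0 ≤ d * (((((u + e) i : ℤ) : ℝ) - x i) * (2 * ρ - ((((u + e) i : ℤ) : ℝ) - x i))) := by
        apply mul_nonneg (by linarith) (mul_nonneg h0 (by linarith))
      nlinarith
    by_cases ht : x i + 1 ≤ (u + e) i
    · have hbn := hbnn (by linarith)
      by_cases hin : nm (u + e - x) ≤ ρ
      · have : h (u + e) ≤ 0 := by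
          by_contra hc
          push Not at hc
          exact hyn ((memOm _).2 ⟨hin, ht, hc⟩)
        have h2 : 0 ≤ k * b (u + e) := mul_nonneg hk0 ((nsq_nonneg _).trans hbn)
        linarith
      · push Not at hin
        have h1 : ρ^2 ≤ b (u + e) := (nsq_of_le_nm (by linarith) hin.le).trans hbn
        have h2 : 2 * M ≤ k * b (u+e) := by
          calc 2 * M = k * ρ^2 := by rw [hk]; field_simp
            _ ≤ _ := by gcongr
        have h3 := abs_le.1 (hM (u+e) hnm)
        have h4 := abs_le.1 (hM (rfl0 x i (u+e)) ((nsq_refl_le x i _ ht).trans hnm))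
        simp only [hh]
        linarith [h3.2, h4.1]
    · -- crossing the reflection plane
      have he' : e = - ev i := by
        obtain ⟨j, hj | hj⟩ := (mem_unitVecs e).1 he
        · exfalso; subst hj
          apply ht
          have : (0:ℤ) ≤ (ev j : V d) i := by
            by_cases hji : j = i
            · subst hji; simp [ev]
            · simp [ev, Ne.symm hji]
          simp only [Pi.add_apply]
          linarith [hu.2.1]
        · subst hj
          by_cases hji : j = i
          · rw [hji]
          · exfalso; apply ht
            simp [ev, Ne.symm hji]; linarith [hu.2.1]
      have hui : u i = x i + 1 := by
        subst he'
        simp [ev] at ht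
        linarith [hu.2.1]
      have hre : rfl0 x i (u + e) = u := by
        subst he'
        ext j; by_cases hj : j = i
        · subst hj; simp [rfl0, ev]; linarith
        · simp [rfl0, ev, hj]
      have hre2 : rfl0 x i u = u + e := by
        subst he'
        ext j; by_cases hj : j = i
        · subst hj; simp [rfl0, ev]; linarith
        · simp [rfl0, ev, hj]
      have h1 : h (u + e) = - h u := by
        simp only [hh, hre, hre2]; ring
      have hbn := hbnn (by subst he'; simp [ev]; linarith)
      have h2 : 0 ≤ k * b (u + e) := mul_nonneg hk0 ((nsq_nonneg _).trans hbn)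
      rw [h1]; linarith [hu.2.2]
  have := min_principle hd Om (fun u => k * b u - h u) hsuper 0 hbd _ hmem
  have h2 : k * b (x + ev i) ≤ k * (2 * d * ρ) := by gcongr
  linarith

theorem grad_est (hd : 0 < d) (x : V d) (i : Fin d) (ρ : ℝ) (hρ : 1 ≤ ρ) (f : V d → ℝ) (M : ℝ)
    (hM : ∀ y, nm (y - x) ≤ ρ + 1 → |f y| ≤ M) (hf : ∀ y, nm (y - x) ≤ ρ → avg f y = f y) :
    |f (x + ev i) - f x| ≤ 4 * d * M / ρ := by
  rw [abs_le]
  have h1 := grad_one hd x i ρ hρ f M hM hf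
  have h2 := grad_one hd x i ρ hρ (fun y => - f y) M (fun y hy => by rw [abs_neg]; exact hM y hy)
    (fun y hy => by rw [avg_neg, hf y hy])
  constructor <;> linarith

end

section

/-! lower bound for the Green function near the origin -/

variable {d : ℕ}

lemma nm_le_of_nsq_le {x y : V d} (h : nsq x ≤ nsq y) : nm x ≤ nm y := Real.sqrt_le_sqrt h

lemma telescope (g : V d → ℝ) (L r : ℝ)
    (hg : ∀ w i, nm w ≤ r → |g (w + ev i) - g w| ≤ L) :
    ∀ N : ℕ, ∀ x : V d, nm x ≤ r → ∑ i, (x i).natAbs = N → |g x - g 0| ≤ L * N := by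
  intro N
  induction N with
  | zero =>
    intro x hx hN
    have : x = 0 := by
      ext i
      have := (Finset.sum_eq_zero_iff.1 hN) i (Finset.mem_univ i)
      simpa using this
    simp [this]
  | succ N ih =>
    intro x hx hN
    have : ∃ i, x i ≠ 0 := by
      by_contra hc
      push Not at hc
      simp [hc] at hN
    obtain ⟨i, hi⟩ := this
    have hsum : ∀ y : V d, (∀ j, j ≠ i → y j = x j) → (y i).natAbs + 1 = (x i).natAbs →
        ∑ j, (y j).natAbs = N := by
      intro y hy hyi
      have h1 := Finset.add_sum_erase Finset.univ (fun j => (x j).natAbs) (Finset.mem_univ i)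
      have h2 := Finset.add_sum_erase Finset.univ (fun j => (y j).natAbs) (Finset.mem_univ i)
      have h3 : ∑ j ∈ Finset.univ.erase i, (y j).natAbs = ∑ j ∈ Finset.univ.erase i, (x j).natAbs :=
        Finset.sum_congr rfl fun j hj => by rw [hy j (Finset.ne_of_mem_erase hj)]
      omega
    rcases lt_or_gt_of_ne hi with h | h
    · have hle : nm (x + ev i) ≤ nm x := by
        apply nm_le_of_nsq_le
        rw [nsq_add]
        have : (x i : ℝ) ≤ -1 := by exact_mod_cast Int.le_sub_one_of_lt h
        linarith
      have h1 := ih (x + ev i) (hle.trans hx) (hsum _ (fun j hj => by simp [ev, hj])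
        (by simp [ev]; omega))
      have h2 := hg x i hx
      have h3 : g x - g 0 = -(g (x + ev i) - g x) + (g (x + ev i) - g 0) := by ring
      rw [h3]
      refine (abs_add_le _ _).trans ?_
      rw [abs_neg]; push_cast; linarith
    · have hle : nm (x - ev i) ≤ nm x := by
        apply nm_le_of_nsq_le
        rw [nsq_sub]
        have : (1:ℝ) ≤ x i := by exact_mod_cast h
        linarith
      have h1 := ih (x - ev i) (hle.trans hx) (hsum _ (fun j hj => by simp [ev, hj])
        (by simp [ev]; omega))
      have h2 := hg (x - ev i) i (hle.trans hx)
      rw [sub_add_cancel] at h2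
      have h3 : g x - g 0 = (g x - g (x - ev i)) + (g (x - ev i) - g 0) := by ring
      rw [h3]
      refine (abs_add_le _ _).trans ?_
      push_cast; linarith

lemma osc_bound (g : V d → ℝ) (L r : ℝ) (hL : 0 ≤ L)
    (hg : ∀ w i, nm w ≤ r → |g (w + ev i) - g w| ≤ L) (x : V d) (hx : nm x ≤ r) :
    |g x - g 0| ≤ L * (d * r) := by
  refine (telescope g L r hg _ x hx rfl).trans ?_
  gcongr
  push_cast
  calc ∑ i, ((x i).natAbs : ℝ) ≤ ∑ i : Fin d, r := by
        apply Finset.sum_le_sum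
        intro i _
        have h1 := coord_le x i
        have h2 := nsq_of_nm_le hx
        have h3 := abs_le_of_sq_le_sq (h1.trans h2) ((nm_nonneg x).trans hx)
        rw [Nat.cast_natAbs]; exact_mod_cast h3
    _ = _ := by simp

set_option maxHeartbeats 1000000 in
theorem green_low (d : ℕ) (hd : 2 ≤ d) : ∃ C : ℝ, 1 ≤ C ∧ ∃ m0 : ℝ, 1 ≤ m0 ∧
    ∀ (n : ℕ) (m : ℝ), m0 ≤ m → 64 * m ≤ n → ∀ z ∈ ball d n, (n:ℝ)/4 ≤ nm z → ∀ x ∈ ball d m,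
    ∑ y ∈ ball d n, green (ball d n) z y + ((n:ℝ)^2 - nsq z)^2/(4*(n:ℝ)^2)
        - (n:ℝ)^2 * (C * (1/m + m/n * Real.log n)) ≤
      green (ball d n) z x * (ball d n).card := by
  have hd0 : 0 < d := by omega
  obtain ⟨C1, hC1, m1, hm1, hquad⟩ := quad d hd
  obtain ⟨C2, hC2, hgb⟩ := green_bound d hd
  obtain ⟨w, hw0, hw⟩ := card_ball d hd0
  have hsd : 0 ≤ Real.sqrt d := Real.sqrt_nonneg _
  have hd' : (2:ℝ) ≤ d := by exact_mod_cast hd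
  set C3 : ℝ := 256 * d^2 * (C2 * (16^d * (w * 2^d))) with hC3
  have hC30 : 0 ≤ C3 := by positivity
  refine ⟨5*C1 + C3, by linarith, max m1 (max 2 (Real.sqrt d)), le_max_of_le_left hm1, ?_⟩
  intro n m hm hmn z hz hzn x hx
  have hmm1 : m1 ≤ m := (le_max_left _ _).trans hm
  have hm2 : 2 ≤ m := ((le_max_left _ _).trans (le_max_right _ _)).trans hm
  have hmd : Real.sqrt d ≤ m := ((le_max_right _ _).trans (le_max_right _ _)).trans hm
  have hn : (128:ℝ) ≤ n := by linarith
  have hn2 : 2 ≤ n := by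
    have : (2:ℝ) ≤ n := by linarith
    exact_mod_cast this
  have hlog : 0 ≤ Real.log n := Real.log_nonneg (by linarith)
  set f := green (ball d n) z with hf
  set N : ℝ := ((ball d n).card : ℝ) with hN
  have hN0 : 0 ≤ N := by positivity
  -- the bound M
  set M : ℝ := C2 * Real.log n * (((n:ℝ)/16)^2)^(1-(d/2:ℝ)) with hM
  have hM0 : 0 ≤ M := by positivity
  have hfar : ∀ y, nm y ≤ 3*n/16 → |f y| ≤ M ∧ avg f y = f y := by
    intro y hy
    have h1 : (n:ℝ)/16 ≤ nm (y - z) := by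
      have := nm_add (z - y) y
      rw [sub_add_cancel, nm_sub_comm z y] at this
      linarith
    have hyz : y ≠ z := by
      rintro rfl
      rw [sub_self, nm_zero] at h1
      linarith
    constructor
    · rw [abs_of_nonneg (green_nonneg hd0 _ _ _)]
      refine (hgb n hn2 z hz y).trans ?_
      rw [hM]
      apply mul_le_mul_of_nonneg_left _ (by positivity)
      apply Real.rpow_le_rpow_of_nonpos (by positivity) _ (by linarith)
      have := nsq_of_le_nm (by positivity) h1
      linarith
    · have := green_lap hd0 (ball d n) z (y := y) (mem_ball.2 (by linarith))
      rw [if_neg hyz] at this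
      linarith
  set L : ℝ := 4 * d * M / ((n:ℝ)/16) with hL
  have hL0 : 0 ≤ L := by positivity
  have hgrad : ∀ u i, nm u ≤ m + 1 → |f (u + ev i) - f u| ≤ L := by
    intro u i hu
    have hb : ∀ y, nm (y - u) ≤ (n:ℝ)/16 + 1 → nm y ≤ 3*n/16 := by
      intro y hy
      have := nm_add (y - u) u
      rw [sub_add_cancel] at this
      linarith
    exact grad_est hd0 u i ((n:ℝ)/16) (by linarith) f M (fun y hy => (hfar y (hb y hy)).1)
      (fun y hy => (hfar y (hb y (by linarith))).2)
  have hosc : ∀ u, nm u ≤ m + 1 → |f u - f 0| ≤ L * (d * (m+1)) :=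
    fun u hu => osc_bound f L (m+1) hL0 hgrad u hu
  have hf0 : 0 ≤ f 0 := green_nonneg hd0 _ _ _
  set F : ℝ := f 0 + L * (d * (m+1)) with hF
  have hF0 : 0 ≤ F := by positivity
  have hq := hquad n m hmm1 (by linarith) z hz (by linarith) F hF0 (fun y hy => by
    have := (abs_le.1 (hosc y (mem_ball.1 hy))).2
    linarith)
  have hx' := (abs_le.1 (hosc x ((mem_ball.1 hx).trans (by linarith)))).1
  have hfx : F - 2 * (L * (d * (m+1))) ≤ f x := by linarith
  -- L N bound
  have hMN : M * N ≤ C2 * (16^d * (w * 2^d)) * (n:ℝ)^2 * Real.log n := by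
    have h1 : N ≤ w * (2*n)^d := by
      refine (hw n (by positivity)).1.trans ?_
      gcongr; linarith
    have h2 : (((n:ℝ)/16)^2)^(1-(d/2:ℝ)) * (2*(n:ℝ))^d = 2^d * (16^d * ((n:ℝ)/16)^2) := by
      have hp : (0:ℝ) < (n:ℝ)/16 := by linarith
      have : (2*(n:ℝ))^d = 2^d * (16^d * ((n:ℝ)/16)^(d:ℝ)) := by
        rw [Real.rpow_natCast, ← mul_pow, ← mul_pow]; congr 1; ring
      rw [this, ← Real.rpow_natCast ((n:ℝ)/16) 2, ← Real.rpow_mul hp.le]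
      have : ((n:ℝ)/16)^(((2:ℕ):ℝ)*(1-(d/2:ℝ))) * ((n:ℝ)/16)^(d:ℝ) = ((n:ℝ)/16)^((2:ℕ):ℝ) := by
        rw [← Real.rpow_add hp]; congr 1; push_cast; ring
      rw [← this]; ring
    calc M * N ≤ M * (w * (2*n)^d) := by gcongr
      _ = C2 * Real.log n * w * ((((n:ℝ)/16)^2)^(1-(d/2:ℝ)) * (2*(n:ℝ))^d) := by rw [hM]; ring
      _ = C2 * Real.log n * w * (2^d * (16^d * ((n:ℝ)/16)^2)) := by rw [h2]
      _ ≤ C2 * Real.log n * w * (2^d * (16^d * ((n:ℝ))^2)) := by gcongr; linarith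
      _ = _ := by ring
  have hLN : 2 * (L * (d * (m+1))) * N ≤ (n:ℝ)^2 * (C3 * (m/n * Real.log n)) := by
    have hnpos : (0:ℝ) < n := by linarith
    calc 2 * (L * (d * (m+1))) * N = 128 * d^2 * ((m+1)/n) * (M * N) := by rw [hL]; field_simp; ring
      _ ≤ 128 * d^2 * ((2*m)/n) * (C2 * (16^d * (w * 2^d)) * (n:ℝ)^2 * Real.log n) := by
        gcongr; linarith
      _ = _ := by rw [hC3]; ring
  -- total
  set Sg := ∑ y ∈ ball d n, f y with hSg
  have hS1 : Sg ≤ ((n:ℝ)+1)^2 - nsq z := green_total_le hd0 n z hz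
  have hS0 : 0 ≤ Sg := Finset.sum_nonneg fun y _ => green_nonneg hd0 _ _ _
  set W := ((n:ℝ)^2 - nsq z)^2/(4*(n:ℝ)^2) with hW
  have hW0 : 0 ≤ W := by positivity
  have hW1 : W ≤ (n:ℝ)^2 := by
    rw [hW, div_le_iff₀ (by positivity)]
    have := nsq_nonneg z
    have := nsq_le_of_mem hz
    nlinarith
  have hFN : Sg + W - 5 * C1 * (n:ℝ)^2 / m ≤ F * N := by
    have hmpos : 0 < m := by linarith
    set c := C1/m with hc
    have hc0 : 0 ≤ c := by positivity
    have h1 : Sg + W ≤ 5 * (n:ℝ)^2 := by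
      have a1 : ((n:ℝ)+1)^2 ≤ (2*(n:ℝ))^2 := by gcongr; linarith
      have a2 := nsq_nonneg z
      rw [mul_pow] at a1
      linarith
    have h2 : 5 * C1 * (n:ℝ)^2 / m = 5 * (n:ℝ)^2 * c := by rw [hc]; ring
    rw [h2]
    by_cases h3 : F * N ≤ 5 * (n:ℝ)^2
    · have : F * N * c ≤ 5 * (n:ℝ)^2 * c := by gcongr
      linarith
    · push Not at h3
      have : 0 ≤ 5 * (n:ℝ)^2 * c := by positivity
      linarith
  have hfin : (F - 2 * (L * (d * (m+1)))) * N ≤ f x * N := by gcongr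
  have h9 : (n:ℝ)^2 * (C3 * (m/n * Real.log n)) + 5 * C1 * (n:ℝ)^2 / m ≤
      (n:ℝ)^2 * ((5*C1+C3) * (1/m + m/n * Real.log n)) := by
    have a1 : 0 ≤ 1/m := by positivity
    have a2 : 0 ≤ m/n * Real.log n := by positivity
    have a3 : (n:ℝ)^2 * ((5*C1+C3) * (1/m + m/n * Real.log n)) =
      (n:ℝ)^2 * (C3 * (m/n * Real.log n)) + 5 * C1 * (n:ℝ)^2 / m +
        ((n:ℝ)^2 * (5 * C1 * (m/n * Real.log n)) + (n:ℝ)^2 * (C3 * (1/m))) := by ring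
    rw [a3]
    have : 0 ≤ ((n:ℝ)^2 * (5 * C1 * (m/n * Real.log n)) + (n:ℝ)^2 * (C3 * (1/m))) := by positivity
    linarith
  linarith

theorem green_main (d : ℕ) (hd : 2 ≤ d) : ∃ C : ℝ, 1 ≤ C ∧ ∃ m0 : ℝ, 2 ≤ m0 ∧
    ∀ (n : ℕ) (m ε : ℝ), m0 ≤ m → 64 * m ≤ n → 0 < ε → ε ≤ 1/10 →
    C * (1/m + m/n * Real.log n) ≤ ε^2/8 →
    ∀ z ∈ ball d ((n:ℝ)*(1-ε)), ∀ x ∈ ball d m,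
    ∑ y ∈ ball d n, green (ball d n) z y + ε^2 * (n:ℝ)^2/8 ≤
      green (ball d n) z x * (ball d n).card := by
  have hd0 : 0 < d := by omega
  obtain ⟨C, hC, m0, hm0, hlow⟩ := green_low d hd
  refine ⟨C, hC, max 2 m0, le_max_left _ _, ?_⟩
  intro n m ε hm hmn hε hε1 hδ z hz x hx
  have hm2 : 2 ≤ m := (le_max_left _ _).trans hm
  have hm0' : m0 ≤ m := (le_max_right _ _).trans hm
  have hn : (128:ℝ) ≤ n := by linarith
  have hnpos : (0:ℝ) < n := by linarith
  have hδ' : (n:ℝ)^2 * (C * (1/m + m/n * Real.log n)) ≤ (n:ℝ)^2 * (ε^2/8) := by gcongr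
  have hzn : z ∈ ball d n := ball_mono (by nlinarith) hz
  by_cases h : (n:ℝ)/4 ≤ nm z
  · have h1 := hlow n m hm0' hmn z hzn h x hx
    have h2 := nsq_le_of_mem hz
    have h3 : ε * (n:ℝ)^2 ≤ (n:ℝ)^2 - nsq z := by nlinarith [sq_nonneg (n:ℝ)]
    have h4 : ε^2 * (n:ℝ)^2/4 ≤ ((n:ℝ)^2 - nsq z)^2/(4*(n:ℝ)^2) := by
      rw [le_div_iff₀ (by positivity)]
      have : (ε * (n:ℝ)^2)^2 ≤ ((n:ℝ)^2 - nsq z)^2 := by gcongr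
      nlinarith
    linarith
  · push Not at h
    have hxn : x ∈ ball d n := ball_mono (by linarith) hx
    have hmin := min_principle hd0 (ball d ((n:ℝ)/4)) (fun y => green (ball d n) x y * (ball d n).card)
      (fun y hy => by
        have := green_super hd0 (ball d n) x (y := y) (ball_mono (by linarith) hy)
        simp only [mul_comm _ ((ball d n).card : ℝ)]
        rw [avg_smul]
        gcongr)
      (((n:ℝ)+1)^2 + ε^2 * (n:ℝ)^2/8) (fun y hy => by
        have hy' := outb_ball hy
        have hyn : y ∈ ball d n := mem_ball.2 (by linarith)
        rw [green_symm hd0 _ hyn hxn]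
        have h1 := hlow n m hm0' hmn y hyn hy'.1.le x hx
        have h2 := green_total_ge hd0 n y hyn
        have h3 := nsq_of_nm_le hy'.2
        have h5 : nsq y ≤ (0.26 * (n:ℝ))^2 := h3.trans (by gcongr; linarith)
        have h4 : ((0.93) * (n:ℝ)^2)^2/(4*(n:ℝ)^2) ≤ ((n:ℝ)^2 - nsq y)^2/(4*(n:ℝ)^2) := by
          gcongr; nlinarith
        have h6 : ((0.93) * (n:ℝ)^2)^2/(4*(n:ℝ)^2) = 0.93^2/4 * (n:ℝ)^2 := by field_simp
        have h7 : ε^2 ≤ 1/100 := by nlinarith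
        have h8 : (n:ℝ)^2 * ε^2 ≤ (n:ℝ)^2 * (1/100) := by gcongr
        nlinarith) z (mem_ball.2 h.le)
    have h1 := green_total_le hd0 n z hzn
    have h2 := nsq_nonneg z
    rw [green_symm hd0 _ hzn hxn] at hmin
    linarith

end

section

/-! outer estimate -/

variable {d : ℕ}

noncomputable def cutc (a ρ t : ℝ) : ℝ := Real.cosh (a * max (t - ρ) 0)

lemma one_le_cutc (a ρ t : ℝ) : 1 ≤ cutc a ρ t := Real.one_le_cosh _

lemma cutc_small {a ρ t : ℝ} (h : t ≤ ρ) : cutc a ρ t = 1 := by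
  rw [cutc, max_eq_right (by linarith)]; simp

lemma cutc_avg {a : ℝ} (ha : 0 ≤ a) (ρ t h : ℝ) (hh : |h| ≤ 1) :
    cutc a ρ (t + h) + cutc a ρ (t - h) ≤ 2 * (Real.cosh a * cutc a ρ t) := by
  have hb := abs_le.1 hh
  rcases le_total ρ t with ht | ht
  · have e : cutc a ρ t = Real.cosh (a * (t - ρ)) := by
      rw [cutc, max_eq_left (by linarith)]
    have key : ∀ s, cutc a ρ s ≤ Real.cosh (a * (s - ρ)) := by
      intro s
      rw [cutc, Real.cosh_le_cosh, abs_mul, abs_mul]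
      apply mul_le_mul_of_nonneg_left _ (abs_nonneg a)
      rcases le_total (s - ρ) 0 with h1 | h1
      · rw [max_eq_right h1, abs_zero]; exact abs_nonneg _
      · rw [max_eq_left h1]
    have k1 := key (t + h)
    have k2 := key (t - h)
    rw [show a * (t + h - ρ) = a * (t - ρ) + a * h by ring, Real.cosh_add] at k1
    rw [show a * (t - h - ρ) = a * (t - ρ) - a * h by ring, Real.cosh_sub] at k2
    have h3 : Real.cosh (a * h) ≤ Real.cosh a := by
      rw [Real.cosh_le_cosh, abs_mul, abs_of_nonneg ha]
      nlinarith [abs_nonneg h]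
    have h4 := mul_le_mul_of_nonneg_left h3 (Real.cosh_pos (a * (t - ρ))).le
    rw [e]; linarith
  · rw [cutc_small ht]
    have key : ∀ s, |s| ≤ 1 → cutc a ρ (t + s) ≤ Real.cosh a := by
      intro s hs
      have hs' := abs_le.1 hs
      rw [cutc, Real.cosh_le_cosh, abs_mul, abs_of_nonneg ha]
      have : |max (t + s - ρ) 0| ≤ 1 := by
        rw [abs_of_nonneg (le_max_right _ _)]
        exact max_le (by linarith) (by norm_num)
      nlinarith
    have k1 := key h hh
    have k2 := key (-h) (by rwa [abs_neg])
    rw [← sub_eq_add_neg] at k2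
    linarith

lemma cosh_le_one_add {a : ℝ} (ha : 0 ≤ a) (ha1 : a ≤ 1) : Real.cosh a ≤ 1 + a^2 := by
  refine (Real.cosh_le_exp_half_sq a).trans ?_
  have := Real.abs_exp_sub_one_le (x := a^2/2) (by rw [abs_of_nonneg (by positivity)]; nlinarith)
  rw [abs_of_nonneg (show 0 ≤ a^2/2 by positivity)] at this
  linarith [(abs_le.1 this).2]

noncomputable def lin (x y : V d) : ℝ := (∑ i, (x i : ℝ) * (y i : ℝ)) / nm x

lemma lin_self (x : V d) : lin x x = nm x := by
  unfold lin
  have : ∑ i, (x i : ℝ) * (x i : ℝ) = nm x * nm x := by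
    rw [← sq, nm_sq]; unfold nsq; simp [sq]
  rw [this]
  by_cases h : nm x = 0
  · simp [h]
  · field_simp

lemma lin_le (x y : V d) : lin x y ≤ nm y := by
  unfold lin
  by_cases h : nm x = 0
  · simp [h, nm_nonneg]
  have hx : 0 < nm x := lt_of_le_of_ne (nm_nonneg x) (Ne.symm h)
  rw [div_le_iff₀ hx]
  have := Finset.sum_mul_sq_le_sq_mul_sq Finset.univ (fun i => (x i : ℝ)) (fun i => (y i : ℝ))
  apply le_of_sq_le_sq _ (mul_nonneg (nm_nonneg _) (nm_nonneg _))
  rw [mul_pow, nm_sq, nm_sq]; unfold nsq; linarith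

lemma lin_add (x y e : V d) : lin x (y + e) = lin x y + lin x e := by
  unfold lin
  rw [← add_div, ← Finset.sum_add_distrib]
  congr 1
  refine Finset.sum_congr rfl fun i _ => ?_
  simp; ring

lemma lin_neg (x e : V d) : lin x (-e) = - lin x e := by
  unfold lin; simp [neg_div]

lemma lin_ev (x : V d) (i : Fin d) : |lin x (ev i)| ≤ 1 := by
  rw [abs_le]
  have h1 := lin_le x (ev i)
  have h2 := lin_le x (-ev i)
  rw [lin_neg] at h2
  have h3 : nm (ev i) = 1 := by simp [nm, nsq_ev]
  rw [nm_neg, h3] at h2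
  rw [h3] at h1
  constructor <;> linarith

lemma avg_cutc (hd : 0 < d) {a : ℝ} (ha : 0 ≤ a) (ρ : ℝ) (x y : V d) :
    avg (fun u => cutc a ρ (lin x u)) y ≤ Real.cosh a * cutc a ρ (lin x y) := by
  unfold avg
  have hd' : (0:ℝ) < d := by exact_mod_cast hd
  rw [div_le_iff₀ (by positivity)]
  calc _ ≤ ∑ i : Fin d, 2 * (Real.cosh a * cutc a ρ (lin x y)) := by
        apply Finset.sum_le_sum
        intro i _
        simp only
        rw [sub_eq_add_neg, lin_add, lin_add, lin_neg, ← sub_eq_add_neg]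
        exact cutc_avg ha ρ _ _ (lin_ev x i)
    _ = _ := by simp; ring

lemma avg_sqrt_mul (f g : V d → ℝ) (y : V d) (hf : ∀ e ∈ unitVecs d, 0 ≤ f (y + e))
    (hg : ∀ e ∈ unitVecs d, 0 ≤ g (y + e)) :
    avg (fun u => Real.sqrt (f u) * Real.sqrt (g u)) y ≤ Real.sqrt (avg f y) * Real.sqrt (avg g y) := by
  rw [avg_eq_unitVecs, avg_eq_unitVecs, avg_eq_unitVecs]
  have h1 : (∑ e ∈ unitVecs d, Real.sqrt (f (y+e)) * Real.sqrt (g (y+e)))^2 ≤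
      (∑ e ∈ unitVecs d, f (y + e)) * (∑ e ∈ unitVecs d, g (y + e)) := by
    refine (Finset.sum_mul_sq_le_sq_mul_sq _ _ _).trans (le_of_eq ?_)
    congr 1
    · exact Finset.sum_congr rfl fun e he => Real.sq_sqrt (hf e he)
    · exact Finset.sum_congr rfl fun e he => Real.sq_sqrt (hg e he)
  have hf' := Finset.sum_nonneg hf
  rw [← Real.sqrt_mul (by positivity)]
  apply Real.le_sqrt_of_sq_le
  rw [div_pow, div_mul_div_comm, ← sq]
  gcongr

lemma hp_out (hd : 2 ≤ d) : ∃ C : ℝ, 1 ≤ C ∧ ∀ (S : Finset (V d)) (K ρ m a : ℝ) (x0 : V d),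
    0 ≤ K → 1 ≤ m → 0 ≤ a → a ≤ 1 → S ⊆ ball d K → (((S \ ball d (ρ - 1)).card : ℕ) : ℝ) ≤ m →
    a^2 * (C * Real.log (K + C) * m^(2/(d:ℝ))) ≤ 1 → ∀ x ∈ S,
    ∑ y ∈ outb S, hp S x y * Real.sqrt (cutc a ρ (lin x0 y)) ≤ 2 * Real.sqrt (cutc a ρ (lin x0 x)) := by
  have hd0 : 0 < d := by omega
  obtain ⟨C1, hC1, hpot⟩ := pot_exists d hd
  obtain ⟨C2, hC2, hker⟩ := kernel_sum d hd
  refine ⟨8 * C1 * C2 + 1 + C1, by nlinarith [mul_pos (show 0 < C1 by linarith) hC2], ?_⟩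
  intro S K ρ m a x0 hK hm ha ha1 hSK hE haT x hx
  set E := S \ ball d (ρ - 1) with hEdef
  obtain ⟨g, hg1, hg2, hg3⟩ := hpot ((2*K+1)^2) (by positivity)
  set Cc := 8 * C1 * C2 + 1 + C1 with hCc
  have hCC : 1 + C1 ≤ Cc := by nlinarith [mul_pos (show 0 < C1 by linarith) hC2]
  set T : ℝ := C1 * Real.log ((2*K+1)^2 + C1) * (C2 * m^(2/(d:ℝ))) with hT
  have hlogpos : 0 < Real.log ((2*K+1)^2 + C1) := Real.log_pos (by nlinarith)
  have hmp : 0 < m^(2/(d:ℝ)) := Real.rpow_pos_of_pos (by linarith) _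
  have hTpos : 0 < T := by positivity
  have hTle : 2 * T ≤ Cc * Real.log (K + Cc) * m^(2/(d:ℝ)) := by
    have h1 : Real.log ((2*K+1)^2 + C1) ≤ 4 * Real.log (K + Cc) := by
      have : 4 * Real.log (K + Cc) = Real.log ((K+Cc)^4) := by rw [Real.log_pow]; norm_num
      rw [this]
      apply Real.log_le_log (by positivity)
      have a1 : 2*K + 1 + C1 ≤ (K+Cc)^2 := by nlinarith
      calc (2*K+1)^2 + C1 ≤ (2*K+1+C1)^2 := by nlinarith
        _ ≤ ((K+Cc)^2)^2 := by gcongr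
        _ = _ := by ring
    have h2 : 0 ≤ Real.log (K + Cc) := Real.log_nonneg (by linarith)
    calc 2 * T = 2 * C1 * C2 * Real.log ((2*K+1)^2 + C1) * m^(2/(d:ℝ)) := by rw [hT]; ring
      _ ≤ 2 * C1 * C2 * (4 * Real.log (K + Cc)) * m^(2/(d:ℝ)) := by gcongr
      _ = (8 * C1 * C2) * Real.log (K + Cc) * m^(2/(d:ℝ)) := by ring
      _ ≤ _ := by gcongr; linarith
  have haT2 : a^2 * (2 * T) ≤ 1 := le_trans (by gcongr) haT
  set U : V d → ℝ := fun v => ∑ w ∈ E, g (v - w) with hU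
  have hEK : ∀ w ∈ E, nm w ≤ K := fun w hw => mem_ball.1 (hSK (Finset.mem_sdiff.1 hw).1)
  have hnear : ∀ v w, nm v ≤ K + 1 → w ∈ E → nsq (v - w) ≤ (2*K+1)^2 := by
    intro v w hv hw
    apply nsq_of_nm_le
    have := nm_sub v w
    linarith [hEK w hw]
  have hU0 : ∀ v, nm v ≤ K + 1 → 0 ≤ U v := fun v hv =>
    Finset.sum_nonneg fun w hw => (hg3 _ (hnear v w hv hw)).1
  have hU1 : ∀ v, nm v ≤ K + 1 → U v ≤ T := by
    intro v hv
    calc U v ≤ ∑ w ∈ E, C1 * Real.log ((2*K+1)^2 + C1) * (nsq (v - w) + 1)^(1-(d/2:ℝ)) :=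
          Finset.sum_le_sum fun w hw => (hg3 _ (hnear v w hv hw)).2
      _ = C1 * Real.log ((2*K+1)^2 + C1) * ∑ w ∈ E, (nsq (v - w) + 1)^(1-(d/2:ℝ)) := by
          rw [Finset.mul_sum]
      _ ≤ _ := by
          rw [hT]
          apply mul_le_mul_of_nonneg_left (hker E v m hm hE) (by positivity)
  have hUavg : ∀ v, avg U v = ∑ w ∈ E, avg g (v - w) := by
    intro v
    simp only [hU]
    rw [avg_sum]
    refine Finset.sum_congr rfl fun w _ => ?_
    exact avg_translate g w v
  have hUsup : ∀ v, avg U v ≤ U v := fun v => by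
    rw [hUavg]; exact Finset.sum_le_sum fun w _ => hg1 _
  have hUE : ∀ v ∈ E, avg U v ≤ U v - 1 := by
    intro v hv
    rw [hUavg]
    have h1 := Finset.add_sum_erase E (fun w => g (v - w)) hv
    have h2 := Finset.add_sum_erase E (fun w => avg g (v - w)) hv
    have h3 : ∑ w ∈ E.erase v, avg g (v - w) ≤ ∑ w ∈ E.erase v, g (v - w) :=
      Finset.sum_le_sum fun w _ => hg1 _
    simp only [sub_self] at h1 h2
    have h4 : U v = ∑ w ∈ E, g (v - w) := rfl
    linarith
  set G : V d → ℝ := fun v => 1 + T⁻¹ * U v with hG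
  have hG1 : ∀ v, nm v ≤ K + 1 → 1 ≤ G v := fun v hv => by
    have := mul_nonneg (inv_nonneg.2 hTpos.le) (hU0 v hv)
    simp only [hG]; linarith
  have hG2 : ∀ v, nm v ≤ K + 1 → G v ≤ 2 := fun v hv => by
    have := mul_le_mul_of_nonneg_left (hU1 v hv) (inv_nonneg.2 hTpos.le)
    rw [inv_mul_cancel₀ hTpos.ne'] at this
    simp only [hG]; linarith
  have hGavg : ∀ v, avg G v = 1 + T⁻¹ * avg U v := fun v => by
    simp only [hG]; rw [avg_add, avg_const hd0, avg_smul]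
  set φ : V d → ℝ := fun u => cutc a ρ (lin x0 u) with hφ
  have hφ1 : ∀ u, 1 ≤ φ u := fun u => one_le_cutc _ _ _
  have hsuper : ∀ s ∈ S, avg (fun u => Real.sqrt (φ u) * Real.sqrt (G u)) s ≤
      Real.sqrt (φ s) * Real.sqrt (G s) := by
    intro s hs
    have hsK := mem_ball.1 (hSK hs)
    have hnb : ∀ e ∈ unitVecs d, nm (s + e) ≤ K + 1 := fun e he => by linarith [nm_nbr s he]
    refine (avg_sqrt_mul φ G s (fun e he => by linarith [hφ1 (s+e)])
      (fun e he => by linarith [hG1 _ (hnb e he)])).trans ?_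
    have hφa0 : 0 ≤ avg φ s := avg_nonneg (fun u => by linarith [hφ1 u]) s
    rw [← Real.sqrt_mul hφa0, ← Real.sqrt_mul (by linarith [hφ1 s])]
    apply Real.sqrt_le_sqrt
    have hGs1 := hG1 s (by linarith)
    have hGs2 := hG2 s (by linarith)
    have hGa0 : 0 ≤ avg G s := by
      rw [avg_eq_unitVecs]
      apply div_nonneg (Finset.sum_nonneg fun e he => by linarith [hG1 _ (hnb e he)]) (by positivity)
    by_cases hsE : s ∈ E
    · have h1 : avg φ s ≤ (1 + a^2) * φ s := (avg_cutc hd0 ha ρ x0 s).trans (by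
        have := cosh_le_one_add ha ha1
        have := hφ1 s
        exact mul_le_mul_of_nonneg_right ‹_› (by simp only [hφ] at this; linarith))
      have h2 : avg G s ≤ G s - T⁻¹ := by
        rw [hGavg]
        have := mul_le_mul_of_nonneg_left (hUE s hsE) (inv_nonneg.2 hTpos.le)
        simp only [hG]; linarith
      have h3 : (1 + a^2) * (G s - T⁻¹) ≤ G s := by
        have : 2 * a^2 ≤ T⁻¹ := by
          rw [← one_div, le_div_iff₀ hTpos]; linarith
        have hTi : 0 < T⁻¹ := inv_pos.2 hTpos
        have h5 : 0 ≤ a^2 := sq_nonneg a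
        have h6 := mul_nonneg h5 hTi.le
        have h7 : a^2 * G s ≤ a^2 * 2 := by gcongr
        nlinarith
      calc avg φ s * avg G s ≤ ((1 + a^2) * φ s) * (G s - T⁻¹) := by
            apply mul_le_mul h1 h2 hGa0
            have := hφ1 s
            positivity
        _ = φ s * ((1+a^2) * (G s - T⁻¹)) := by ring
        _ ≤ _ := by
            apply mul_le_mul_of_nonneg_left h3; linarith [hφ1 s]
    · have hsb : nm s ≤ ρ - 1 := by
        by_contra hc
        apply hsE
        rw [hEdef, Finset.mem_sdiff, mem_ball]
        exact ⟨hs, hc⟩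
      have hone : ∀ v, nm v ≤ ρ → φ v = 1 := fun v hv => cutc_small ((lin_le x0 v).trans hv)
      have h1 : avg φ s = 1 := by
        have : avg φ s = avg (fun _ => (1:ℝ)) s :=
          avg_congr fun e he => hone _ (by linarith [nm_nbr s he])
        rw [this, avg_const hd0]
      rw [h1, hone s (by linarith), one_mul, one_mul, hGavg]
      have := mul_le_mul_of_nonneg_left (hUsup s) (inv_nonneg.2 hTpos.le)
      simp only [hG]; linarith
  have hmain := hp_super hd0 S x hx _ hsuper
  have hxK := mem_ball.1 (hSK hx)
  calc ∑ y ∈ outb S, hp S x y * Real.sqrt (φ y)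
      ≤ ∑ y ∈ outb S, hp S x y * (Real.sqrt (φ y) * Real.sqrt (G y)) := by
        apply Finset.sum_le_sum
        intro y hy
        apply mul_le_mul_of_nonneg_left _ (hp_nonneg _ _ _)
        have hyK : nm y ≤ K + 1 := by
          obtain ⟨-, u, hu, e, he, rfl⟩ := (mem_outb _ _).1 hy
          linarith [nm_nbr u he, mem_ball.1 (hSK hu)]
        have : 1 ≤ Real.sqrt (G y) := Real.one_le_sqrt.2 (hG1 y hyK)
        nlinarith [Real.sqrt_nonneg (φ y)]
    _ ≤ Real.sqrt (φ x) * Real.sqrt (G x) := hmain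
    _ ≤ 2 * Real.sqrt (φ x) := by
        have : Real.sqrt (G x) ≤ 2 := by
          rw [Real.sqrt_le_left (by norm_num)]
          linarith [hG2 x (by linarith)]
        nlinarith [Real.sqrt_nonneg (φ x)]

end

section

variable {d : ℕ}

lemma nm_zero_le : nm (0 : V d) = 0 := by simp [nm_zero]

/-- the deterministic invariants of the aggregate -/
def AInv (k : ℕ) (S : Finset (V d)) : Prop := S.card = k + 1 ∧ S ⊆ ball d k

lemma AInv.ne {k : ℕ} {S : Finset (V d)} (h : AInv k S) : S.Nonempty :=
  Finset.card_pos.1 (by rw [h.1]; omega)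

lemma inv_ae (hd : 0 < d) (k : ℕ) : ∀ᵐ ω ∂μ0, AInv k (uAggFrom ({0} : Finset (V d)) ω k) := by
  apply chain_ae_inv hd
  · refine ⟨by simp, ?_⟩
    intro y hy
    rw [Finset.mem_singleton] at hy
    rw [mem_ball, hy, nm_zero_le]; simp
  · exact fun k S h => h.ne
  · rintro k S ⟨h1, h2⟩ y hy
    obtain ⟨hyS, u, hu, e, he, rfl⟩ := (mem_outb _ _).1 hy
    refine ⟨by rw [Finset.card_insert_of_notMem hyS, h1], ?_⟩
    intro v hv
    have hu' := mem_ball.1 (h2 hu)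
    rcases Finset.mem_insert.1 hv with rfl | hv
    · rw [mem_ball]; push_cast
      linarith [nm_nbr u he]
    · have := mem_ball.1 (h2 hv)
      rw [mem_ball]; push_cast; linarith

lemma measurable_uAgg (S : Finset (V d)) (k : ℕ) : Measurable (fun ω => uAggFrom S ω k) := by
  simp only [uAgg_eq_chain]
  exact (measurable_chain measurable_uStep S k).comp (measurable_pi_lambda _ fun i => measurable_uSlice i)

lemma super_agg (hd : 0 < d) (h : ℕ → Finset (V d) → ℝ)
    (h0 : ∀ k S, 0 ≤ h k S)
    (hs : ∀ k S, AInv k S → ∑ x ∈ S, ∑ y ∈ outb S, hp S x y * h (k+1) (insert y S) ≤ (k+1) * h k S)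
    (j k : ℕ) (hjk : j ≤ k) :
    ∫⁻ ω, ENNReal.ofReal (h k (uAggFrom {0} ω k)) ∂μ0 ≤
      ∫⁻ ω, ENNReal.ofReal (h j (uAggFrom {0} ω j)) ∂μ0 := by
  simp only [uAgg_eq_chain]
  refine chain_super (F := uStep) measurable_uStep {0} (fun k S => ENNReal.ofReal (h k S)) AInv
    (fun k => ?_) ?_ j k hjk
  · have := inv_ae hd k
    simpa only [uAgg_eq_chain] using this
  · intro k S hS
    rw [lintegral_uStep_real hd S hS.ne _ (fun y hy => h0 _ _)]
    apply ENNReal.ofReal_le_ofReal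
    rw [div_le_iff₀ (by exact_mod_cast Finset.card_pos.2 hS.ne), hS.1]
    push_cast
    linarith [hs k S hS]

open Classical in
lemma outer_bound (hd : 2 ≤ d) : ∃ C : ℝ, 1 ≤ C ∧ ∀ (N : ℕ) (ρ m a D : ℝ), 0 ≤ ρ → 1 ≤ m → 0 ≤ a →
    a ≤ 1 → 0 ≤ D → a^2 * (C * Real.log (N + C) * m^(2/(d:ℝ))) ≤ 1 →
    μ0 {ω | ((((uAggFrom ({0} : Finset (V d)) ω N) \ ball d (ρ - 1)).card : ℕ) : ℝ) ≤ m ∧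
      ¬ (uAggFrom ({0} : Finset (V d)) ω N ⊆ ball d (ρ + D))} ≤
      ENNReal.ofReal ((ball d N).card * ((N + 2)^2 * Real.exp (- (a * D / 2)))) := by
  have hd0 : 0 < d := by omega
  obtain ⟨C, hC, hout⟩ := hp_out hd
  refine ⟨C, hC, ?_⟩
  intro N ρ m a D hρ hm ha ha1 hD haC
  have single : ∀ x0 : V d, ρ + D < nm x0 →
      μ0 {ω | ((((uAggFrom ({0} : Finset (V d)) ω N) \ ball d (ρ - 1)).card : ℕ) : ℝ) ≤ m ∧
        x0 ∈ uAggFrom ({0} : Finset (V d)) ω N} ≤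
      ENNReal.ofReal ((N + 2)^2 * Real.exp (- (a * D / 2))) := by
    intro x0 hx0
    set w : V d → ℝ := fun y => Real.sqrt (cutc a ρ (lin x0 y)) with hw
    have hw0 : ∀ y, 0 ≤ w y := fun y => Real.sqrt_nonneg _
    set cond : Finset (V d) → Prop := fun S => (((S \ ball d (ρ - 1)).card : ℕ) : ℝ) ≤ m with hcond
    have hmono : ∀ y S, cond (insert y S) → cond S := by
      intro y S h
      refine le_trans ?_ h
      exact_mod_cast Finset.card_le_card (Finset.sdiff_subset_sdiff (Finset.subset_insert _ _) le_rfl)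
    set h : ℕ → Finset (V d) → ℝ := fun k S =>
      if k ≤ N ∧ cond S then (∑ y ∈ S, w y) / ((k+1)*(k+2)) else 0 with hh
    have hsum0 : ∀ S : Finset (V d), 0 ≤ ∑ y ∈ S, w y := fun S => Finset.sum_nonneg fun y _ => hw0 y
    have h0 : ∀ k S, 0 ≤ h k S := by
      intro k S
      simp only [hh]
      split_ifs
      · exact div_nonneg (hsum0 S) (by positivity)
      · exact le_rfl
    have hstep : ∀ k S, AInv k S →
        ∑ x ∈ S, ∑ y ∈ outb S, hp S x y * h (k+1) (insert y S) ≤ (k+1) * h k S := by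
      intro k S hS
      by_cases hc : k + 1 ≤ N ∧ cond S
      · have hSN : S ⊆ ball d (N:ℝ) := hS.2.trans (ball_mono (by exact_mod_cast (by omega : k ≤ N)))
        have e1 : h k S = (∑ y ∈ S, w y) / ((k+1)*(k+2)) := by
          simp only [hh]; rw [if_pos ⟨by omega, hc.2⟩]
        have e2 : ∀ y ∈ outb S, h (k+1) (insert y S) ≤ (∑ v ∈ S, w v + w y) / ((k+2)*(k+3)) := by
          intro y hy
          simp only [hh]
          have hsplit : ∑ v ∈ insert y S, w v = ∑ v ∈ S, w v + w y := by
            rw [Finset.sum_insert (notMem_of_outb hy), add_comm]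
          split_ifs
          · rw [hsplit]; apply le_of_eq; push_cast; ring
          · exact div_nonneg (add_nonneg (hsum0 S) (hw0 y)) (by positivity)
        have e3 : ∀ x ∈ S, ∑ y ∈ outb S, hp S x y * h (k+1) (insert y S) ≤
            (∑ v ∈ S, w v + 2 * w x) / ((k+2)*(k+3)) := by
          intro x hx
          have q1 := hout S N ρ m a x0 (by positivity) hm ha ha1 hSN hc.2 haC x hx
          have q2 := sum_hp hd0 S x hx
          calc ∑ y ∈ outb S, hp S x y * h (k+1) (insert y S)
              ≤ ∑ y ∈ outb S, hp S x y * ((∑ v ∈ S, w v + w y) / ((k+2)*(k+3))) :=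
                Finset.sum_le_sum fun y hy => mul_le_mul_of_nonneg_left (e2 y hy) (hp_nonneg _ _ _)
            _ = ((∑ v ∈ S, w v) * ∑ y ∈ outb S, hp S x y + ∑ y ∈ outb S, hp S x y * w y) / ((k+2)*(k+3)) := by
                rw [Finset.mul_sum, ← Finset.sum_add_distrib, Finset.sum_div]
                refine Finset.sum_congr rfl fun y _ => by ring
            _ ≤ _ := by
                rw [q2, mul_one]
                apply div_le_div_of_nonneg_right _ (by positivity)
                exact add_le_add le_rfl q1
        refine (Finset.sum_le_sum e3).trans ?_
        rw [e1, ← Finset.sum_div, Finset.sum_add_distrib, Finset.sum_const, hS.1, ← Finset.mul_sum,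
          nsmul_eq_mul]
        push_cast
        apply le_of_eq
        field_simp
        ring
      · have : ∀ y, h (k+1) (insert y S) = 0 := by
          intro y
          simp only [hh]
          rw [if_neg]
          exact fun ⟨q1, q2⟩ => hc ⟨q1, hmono y S q2⟩
        simp only [this, mul_zero, Finset.sum_const_zero]
        exact mul_nonneg (by positivity) (h0 _ _)
    have main := super_agg hd0 h h0 hstep 0 N (Nat.zero_le _)
    have init : ∫⁻ ω, ENNReal.ofReal (h 0 (uAggFrom ({0} : Finset (V d)) ω 0)) ∂μ0 ≤ ENNReal.ofReal (1/2) := by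
      have : ∀ ω, h 0 (uAggFrom ({0} : Finset (V d)) ω 0) ≤ 1/2 := by
        intro ω
        have hw1 : w 0 = 1 := by
          simp only [hw]
          rw [cutc_small ((lin_le x0 0).trans (by rw [nm_zero_le]; exact hρ)), Real.sqrt_one]
        simp only [hh, uAggFrom]
        split_ifs
        · rw [Finset.sum_singleton, hw1]; norm_num
        · norm_num
      calc _ ≤ ∫⁻ ω, ENNReal.ofReal (1/2) ∂μ0 :=
            lintegral_mono fun ω => ENNReal.ofReal_le_ofReal (this ω)
        _ = _ := by rw [lintegral_const, measure_univ, mul_one]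
    set M : ℝ := 2 * ((N + 2)^2 * Real.exp (- (a * D / 2))) with hM
    have hM0 : 0 ≤ M := by positivity
    have hmeas : Measurable (fun ω => ENNReal.ofReal (M * h N (uAggFrom ({0} : Finset (V d)) ω N))) :=
      (Measurable.of_discrete (f := fun S : Finset (V d) => ENNReal.ofReal (M * h N S))).comp
        (measurable_uAgg _ _)
    refine (meas_le_lintegral₀ hmeas.aemeasurable ?_).trans ?_
    · rintro ω ⟨q1, q2⟩
      rw [← ENNReal.ofReal_one]
      apply ENNReal.ofReal_le_ofReal
      have e1 : h N (uAggFrom ({0} : Finset (V d)) ω N) =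
          (∑ y ∈ uAggFrom ({0} : Finset (V d)) ω N, w y) / ((N+1)*(N+2)) := by
        simp only [hh]; rw [if_pos ⟨le_rfl, q1⟩]
      have e2 : w x0 ≤ ∑ y ∈ uAggFrom ({0} : Finset (V d)) ω N, w y :=
        Finset.single_le_sum (fun y _ => hw0 y) q2
      have e3 : Real.exp (a * D / 2) / 2 ≤ w x0 := by
        simp only [hw]
        apply Real.le_sqrt_of_sq_le
        rw [cutc, lin_self, max_eq_left (by linarith), Real.cosh_eq, div_pow, ← Real.exp_nat_mul]
        have : Real.exp (((2:ℕ):ℝ) * (a * D / 2)) ≤ Real.exp (a * (nm x0 - ρ)) := by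
          apply Real.exp_le_exp.2
          have := mul_le_mul_of_nonneg_left (show D ≤ nm x0 - ρ by linarith) ha
          push_cast; linarith
        have := Real.exp_pos (-(a * (nm x0 - ρ)))
        have := Real.exp_pos (a * (nm x0 - ρ))
        linarith
      rw [e1]
      have e4 : Real.exp (- (a*D/2)) * Real.exp (a * D / 2) = 1 := by
        rw [← Real.exp_add]; simp
      have e5 := mul_le_mul_of_nonneg_left (e3.trans e2) (Real.exp_pos (- (a*D/2))).le
      have e6 : 1 ≤ 2 * (Real.exp (- (a*D/2)) * ∑ y ∈ uAggFrom ({0} : Finset (V d)) ω N, w y) := by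
        linarith
      rw [hM, mul_div_assoc', le_div_iff₀ (by positivity)]
      have e7 : ((N:ℝ)+1)*(N+2) ≤ (N+2)^2 := by nlinarith
      calc 1 * (((N:ℝ)+1)*(N+2)) ≤ (N+2)^2 * 1 := by linarith
        _ ≤ (N+2)^2 * (2 * (Real.exp (- (a*D/2)) * ∑ y ∈ uAggFrom ({0} : Finset (V d)) ω N, w y)) := by
            gcongr
        _ = _ := by ring
    · simp only [ENNReal.ofReal_mul hM0]
      rw [lintegral_const_mul' _ _ ENNReal.ofReal_ne_top]
      calc _ ≤ ENNReal.ofReal M * ENNReal.ofReal (1/2) := by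
            gcongr; exact main.trans init
        _ = _ := by
            rw [← ENNReal.ofReal_mul hM0]; congr 1; rw [hM]; ring
  set U : V d → Set ℝ := fun x0 => {ω | ((((uAggFrom ({0} : Finset (V d)) ω N) \ ball d (ρ - 1)).card : ℕ) : ℝ) ≤ m ∧
        x0 ∈ uAggFrom ({0} : Finset (V d)) ω N} with hU
  have hsub : {ω | ((((uAggFrom ({0} : Finset (V d)) ω N) \ ball d (ρ - 1)).card : ℕ) : ℝ) ≤ m ∧
      ¬ (uAggFrom ({0} : Finset (V d)) ω N ⊆ ball d (ρ + D))} ≤ᵐ[μ0]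
      ⋃ x0 ∈ (ball d (N:ℝ)).filter (fun x0 => ρ + D < nm x0), U x0 := by
    filter_upwards [inv_ae hd0 N] with ω hω
    rintro ⟨q1, q2⟩
    obtain ⟨x0, hx0, hx1⟩ := Finset.not_subset.1 q2
    rw [mem_ball, not_le] at hx1
    exact Set.mem_biUnion (Finset.mem_coe.2 (Finset.mem_filter.2 ⟨hω.2 hx0, hx1⟩)) ⟨q1, hx0⟩
  refine (measure_mono_ae hsub).trans ((measure_biUnion_finset_le _ _).trans ?_)
  calc _ ≤ ∑ x0 ∈ (ball d (N:ℝ)).filter (fun x0 => ρ + D < nm x0),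
        ENNReal.ofReal ((N + 2)^2 * Real.exp (- (a * D / 2))) :=
        Finset.sum_le_sum fun x0 hx0 => single x0 (Finset.mem_filter.1 hx0).2
    _ ≤ ∑ x0 ∈ (ball d (N:ℝ)), ENNReal.ofReal ((N + 2)^2 * Real.exp (- (a * D / 2))) :=
        Finset.sum_le_sum_of_subset (Finset.filter_subset _ _)
    _ = _ := by
        rw [Finset.sum_const, nsmul_eq_mul, ← ENNReal.ofReal_natCast, ← ENNReal.ofReal_mul (by positivity)]

end

section

section chain2
variable {σ : Type*} [MeasurableSpace σ] [Countable σ] [DiscreteMeasurableSpace σ]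

open Classical in
noncomputable def memF (j : ℕ) (F : σ → ℝ → σ) (p : ℕ × σ × σ) (u : ℝ) : ℕ × σ × σ :=
  (p.1 + 1, F p.2.1 u, if p.1 + 1 ≤ j then F p.2.1 u else p.2.2)

lemma chain_memF (j : ℕ) (F : σ → ℝ → σ) (s0 : σ) (x : ℕ → ℝ) (k : ℕ) :
    chain (memF j F) (0, s0, s0) x k = (k, chain F s0 x k, chain F s0 x (min k j)) := by
  induction k with
  | zero => simp [chain]
  | succ k ih =>
    rw [chain, ih]
    simp only [memF, chain]
    split_ifs with h
    · rw [min_eq_left h]; rfl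
    · rw [min_eq_right (by omega), min_eq_right (by omega)]

theorem chain_super_from {F : σ → ℝ → σ} (hF : ∀ s, Measurable (F s)) (s0 : σ)
    (Ψ : ℕ → σ → ℝ≥0∞) (P : ℕ → σ → Prop)
    (hP : ∀ k, ∀ᵐ ω ∂μ0, P k (chain F s0 (uSlice ω) k)) (j : ℕ) (ind : σ → ℝ≥0∞)
    (hind : ∀ s, ind s ≠ ⊤)
    (h : ∀ k s, j ≤ k → P k s → ∫⁻ u, Ψ (k+1) (F s u) ∂μ0 ≤ Ψ k s) (k : ℕ) (hjk : j ≤ k) :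
    ∫⁻ ω, ind (chain F s0 (uSlice ω) j) * Ψ k (chain F s0 (uSlice ω) k) ∂μ0 ≤
      ∫⁻ ω, ind (chain F s0 (uSlice ω) j) * Ψ j (chain F s0 (uSlice ω) j) ∂μ0 := by
  have hF2 : ∀ p, Measurable (memF j F p) := by
    intro p
    refine measurable_const.prodMk ((hF _).prodMk ?_)
    split_ifs
    · exact hF _
    · exact measurable_const
  induction k, hjk using Nat.le_induction with
  | base => exact le_rfl
  | succ k hk ih =>
    refine le_trans ?_ ih
    have e := lintegral_chain_succ hF2 (0, s0, s0) k (fun p => ind p.2.2 * Ψ (k+1) p.2.1)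
    simp only [chain_memF, memF] at e
    rw [min_eq_right (by omega), min_eq_right hk] at e
    rw [e]
    apply lintegral_mono_ae
    filter_upwards [hP k] with ω hω
    simp only [if_neg (show ¬ (k + 1 ≤ j) by omega)]
    rw [lintegral_const_mul' _ _ (hind _)]
    gcongr
    exact h k _ hk hω

end chain2

variable {d : ℕ}

lemma super_agg_from (hd : 0 < d) (h : ℕ → Finset (V d) → ℝ) (E : Finset (V d) → Prop)
    (h0 : ∀ k S, 0 ≤ h k S) (j k : ℕ) (hjk : j ≤ k) (c : ℝ)
    (hs : ∀ k S, j ≤ k → AInv k S →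
      ∑ x ∈ S, ∑ y ∈ outb S, hp S x y * h (k+1) (insert y S) ≤ (k+1) * h k S)
    (hE : ∀ S, AInv j S → E S → h j S ≤ c) (t : ℝ) (ht : 0 < t) (Q : Finset (V d) → Prop)
    (hQ : ∀ S, AInv k S → Q S → t ≤ h k S) (hc : 0 ≤ c) :
    μ0 {ω | E (uAggFrom {0} ω j) ∧ Q (uAggFrom {0} ω k)} ≤ ENNReal.ofReal (c / t) := by
  classical
  set ind : Finset (V d) → ℝ≥0∞ := fun S => if E S then 1 else 0 with hind
  have main := chain_super_from (F := uStep) measurable_uStep {0}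
    (fun k S => ENNReal.ofReal (h k S)) AInv
    (fun k => by
      have := inv_ae hd k
      simpa only [uAgg_eq_chain] using this) j ind
    (fun s => by simp only [hind]; split_ifs <;> simp)
    (fun k S hk hS => by
      rw [lintegral_uStep_real hd S hS.ne _ (fun y hy => h0 _ _)]
      apply ENNReal.ofReal_le_ofReal
      rw [div_le_iff₀ (by exact_mod_cast Finset.card_pos.2 hS.ne), hS.1]
      push_cast
      linarith [hs k S hk hS]) k hjk
  simp only [← uAgg_eq_chain] at main
  have hrhs : ∫⁻ ω, ind (uAggFrom {0} ω j) * ENNReal.ofReal (h j (uAggFrom {0} ω j)) ∂μ0 ≤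
      ENNReal.ofReal c := by
    calc _ ≤ ∫⁻ ω, ENNReal.ofReal c ∂μ0 := by
          apply lintegral_mono_ae
          filter_upwards [inv_ae hd j] with ω hω
          simp only [hind]
          split_ifs with hh
          · rw [one_mul]; exact ENNReal.ofReal_le_ofReal (hE _ hω hh)
          · simp
      _ = _ := by rw [lintegral_const, measure_univ, mul_one]
  have hm1 : Measurable (fun ω => ind (uAggFrom {0} ω j)) :=
    (Measurable.of_discrete (f := ind)).comp (measurable_uAgg _ _)
  have hm2 : Measurable (fun ω => ENNReal.ofReal (h k (uAggFrom {0} ω k))) :=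
    (Measurable.of_discrete (f := fun S : Finset (V d) => ENNReal.ofReal (h k S))).comp
      (measurable_uAgg _ _)
  have hmark := mul_meas_ge_le_lintegral₀ (μ := μ0) (hm1.mul hm2).aemeasurable (ENNReal.ofReal t)
  have hsub : {ω | E (uAggFrom {0} ω j) ∧ Q (uAggFrom {0} ω k)} ≤ᵐ[μ0]
      {ω | ENNReal.ofReal t ≤ ((fun ω => ind (uAggFrom {0} ω j)) * (fun ω => ENNReal.ofReal (h k (uAggFrom {0} ω k)))) ω} := by
    filter_upwards [inv_ae hd k] with ω hω
    rintro ⟨q1, q2⟩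
    change ENNReal.ofReal t ≤ ind (uAggFrom {0} ω j) * ENNReal.ofReal (h k (uAggFrom {0} ω k))
    simp only [hind]
    rw [if_pos q1, one_mul]
    exact ENNReal.ofReal_le_ofReal (hQ _ hω q2)
  refine (measure_mono_ae hsub).trans ?_
  rw [ENNReal.ofReal_div_of_pos ht, ENNReal.le_div_iff_mul_le (Or.inl (by simpa using ht)) (Or.inl ENNReal.ofReal_ne_top), mul_comm]
  exact hmark.trans (main.trans hrhs)

lemma exp_neg_le {u : ℝ} (hu : 0 ≤ u) : Real.exp (-u) ≤ 1 - u + u^2/2 := by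
  have h := Real.quadratic_le_exp_of_nonneg hu
  have h1 : 0 < 1 + u + u^2/2 := by positivity
  rw [Real.exp_neg]
  refine (inv_anti₀ h1 h).trans ?_
  rw [inv_le_iff_one_le_mul₀ h1]
  nlinarith [sq_nonneg (u^2)]

lemma late_exp {L lam j F : ℝ} (hj : 1 ≤ j) (hL : 0 < L) (hlam : 0 ≤ lam) (hlj : lam * L ≤ j / 2)
    (hF : 0 ≤ F) :
    -(lam * (1 - lam*L/(j+1)) * (F/(j+1))) -
      (lam * (1 - lam*L/(j+1)))/(j+1) * (1 - (lam * (1 - lam*L/(j+1))) * L/(2*(j+1))) * (F/j) ≤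
    - (lam * (1 - lam*L/j) * (F/j)) := by
  set l' := lam * (1 - lam*L/(j+1)) with hl'
  have hj0 : 0 < j := by linarith
  have h1 : lam * L/(j+1) ≤ 1/2 := by rw [div_le_iff₀ (by linarith)]; linarith
  have h2 : 0 ≤ lam * L/(j+1) := by positivity
  have hl0 : 0 ≤ l' := mul_nonneg hlam (by linarith)
  have hl1 : l' ≤ lam := by
    have := mul_nonneg hlam h2
    rw [hl']; nlinarith
  have e : -(l' * (F/(j+1))) - l'/(j+1) * (1 - l' * L/(2*(j+1))) * (F/j) =
      - ((l' - l'^2 * L / (2*(j+1)^2)) * (F/j)) := by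
    field_simp; ring
  rw [e, neg_le_neg_iff]
  apply mul_le_mul_of_nonneg_right _ (by positivity)
  have h3 : l'^2 * L / (2*(j+1)^2) ≤ lam^2 * L / (2*(j+1)^2) := by gcongr
  have h4 : lam^2 * L / (2*(j+1)^2) ≤ lam^2 * L / (j*(j+1)) := by
    apply div_le_div_of_nonneg_left (by positivity) (by positivity)
    nlinarith
  have h5 : l' - lam * (1 - lam*L/j) = lam^2 * L / (j*(j+1)) := by
    rw [hl']; field_simp; ring
  linarith

/-- one-step supermartingale inequality -/
lemma late_step (hd : 0 < d) (f : V d → ℝ) (L : ℝ) (hL : 0 < L) (hf0 : ∀ y, 0 ≤ f y)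
    (hfL : ∀ y, f y ≤ L) (z : V d) (hsub : ∀ y, y ≠ z → f y ≤ avg f y)
    (S : Finset (V d)) (hS : S.Nonempty) (hz : z ∉ S) (lam : ℝ) (hlam : 0 ≤ lam)
    (hlj : lam * L ≤ (S.card:ℝ) / 2) :
    ∑ x ∈ S, ∑ y ∈ outb S, hp S x y *
      Real.exp (-(lam * (1 - lam*L/((S.card:ℝ)+1)) * ((∑ v ∈ insert y S, f v)/((S.card:ℝ)+1)))) ≤
      (S.card:ℝ) * Real.exp (-(lam * (1 - lam*L/(S.card:ℝ)) * ((∑ v ∈ S, f v)/(S.card:ℝ)))) := by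
  set j : ℝ := (S.card:ℝ) with hj
  have hj1 : 1 ≤ j := by rw [hj]; exact_mod_cast Finset.card_pos.2 hS
  set F := ∑ v ∈ S, f v with hF
  have hF0 : 0 ≤ F := Finset.sum_nonneg fun v _ => hf0 v
  have hexp := late_exp hj1 hL hlam hlj hF0
  set l' := lam * (1 - lam*L/(j+1)) with hl'
  have h1 : lam * L/(j+1) ≤ 1/2 := by rw [div_le_iff₀ (by linarith)]; linarith
  have h2 : 0 ≤ lam * L/(j+1) := by positivity
  have hl0 : 0 ≤ l' := mul_nonneg hlam (by linarith)
  have hl1 : l' ≤ lam := by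
    have := mul_nonneg hlam h2
    rw [hl']; nlinarith
  set θ := l' * L/(2*(j+1)) with hθ
  have hθ1 : θ ≤ 1 := by
    rw [hθ, div_le_iff₀ (by linarith)]
    have := mul_le_mul_of_nonneg_right hl1 hL.le
    linarith
  have e1 : ∀ y ∈ outb S, Real.exp (-(l' * ((∑ v ∈ insert y S, f v)/(j+1)))) ≤
      Real.exp (-(l' * (F/(j+1)))) * (1 - l'/(j+1) * (1 - θ) * f y) := by
    intro y hy
    rw [Finset.sum_insert (notMem_of_outb hy),
      show -(l' * ((f y + F)/(j+1))) = -(l' * (F/(j+1))) + -(l' * f y/(j+1)) by ring, Real.exp_add]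
    apply mul_le_mul_of_nonneg_left _ (Real.exp_pos _).le
    refine (exp_neg_le (div_nonneg (mul_nonneg hl0 (hf0 y)) (by linarith))).trans ?_
    have : (l' * f y/(j+1))^2/2 ≤ l'/(j+1) * θ * f y := by
      have q : f y ^ 2 ≤ L * f y := by rw [pow_two]; exact mul_le_mul_of_nonneg_right (hfL y) (hf0 y)
      calc (l' * f y/(j+1))^2/2 = l'^2/(2*(j+1)^2) * (f y)^2 := by field_simp
        _ ≤ l'^2/(2*(j+1)^2) * (L * f y) := by gcongr
        _ = _ := by rw [hθ]; field_simp
    have e : l' * f y/(j+1) = l'/(j+1) * f y := by ring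
    rw [e] at this ⊢
    linarith
  have e2 : ∀ x ∈ S, f x ≤ ∑ y ∈ outb S, hp S x y * f y := by
    intro x hx
    have q := hp_super hd S x hx (fun y => -f y) (fun s hs => by
      have q1 : avg (fun y => -f y) s = - avg f s := avg_neg _ _
      rw [q1]
      have := hsub s (fun h => hz (h ▸ hs))
      linarith)
    simp only [mul_neg, Finset.sum_neg_distrib] at q
    linarith
  set c := l'/(j+1) * (1 - θ) with hc
  have hc0 : 0 ≤ c := mul_nonneg (div_nonneg hl0 (by linarith)) (by linarith)
  have e3 : ∀ x ∈ S, ∑ y ∈ outb S, hp S x y * Real.exp (-(l' * ((∑ v ∈ insert y S, f v)/(j+1)))) ≤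
      Real.exp (-(l' * (F/(j+1)))) * (1 - c * f x) := by
    intro x hx
    calc _ ≤ ∑ y ∈ outb S, hp S x y * (Real.exp (-(l' * (F/(j+1)))) * (1 - c * f y)) :=
          Finset.sum_le_sum fun y hy => mul_le_mul_of_nonneg_left (e1 y hy) (hp_nonneg _ _ _)
      _ = Real.exp (-(l' * (F/(j+1)))) * (∑ y ∈ outb S, hp S x y - c * ∑ y ∈ outb S, hp S x y * f y) := by
          rw [Finset.mul_sum, ← Finset.sum_sub_distrib, Finset.mul_sum]
          exact Finset.sum_congr rfl fun y _ => by ring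
      _ ≤ _ := by
          rw [sum_hp hd S x hx]
          apply mul_le_mul_of_nonneg_left _ (Real.exp_pos _).le
          have := mul_le_mul_of_nonneg_left (e2 x hx) hc0
          linarith
  refine (Finset.sum_le_sum e3).trans ?_
  rw [← Finset.mul_sum, Finset.sum_sub_distrib, ← Finset.mul_sum, Finset.sum_const, nsmul_eq_mul,
    mul_one, ← hj, ← hF]
  calc Real.exp (-(l' * (F/(j+1)))) * (j - c * F)
      = j * (Real.exp (-(l' * (F/(j+1)))) * (1 - c * (F/j))) := by field_simp
    _ ≤ j * (Real.exp (-(l' * (F/(j+1)))) * Real.exp (-(c * (F/j)))) := by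
        have := Real.add_one_le_exp (-(c * (F/j)))
        gcongr
        linarith
    _ ≤ _ := by
        rw [← Real.exp_add]
        apply mul_le_mul_of_nonneg_left _ (by linarith)
        apply Real.exp_le_exp.2
        linarith

/-- the late-phase estimate -/
lemma late_bound (hd : 0 < d) (f : V d → ℝ) (L : ℝ) (hL : 0 < L) (hf0 : ∀ y, 0 ≤ f y)
    (hfL : ∀ y, f y ≤ L) (z : V d) (hsub : ∀ y, y ≠ z → f y ≤ avg f y)
    (B1 : Finset (V d)) (k1 N : ℕ) (hkN : k1 ≤ N) (y0 y1 : ℝ) (hy1 : 0 ≤ y1) (hy01 : y1 < y0)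
    (h0 : ∀ x ∈ B1, y0 ≤ f x) (h1 : ∀ S : Finset (V d), S.card = N + 1 → ∑ y ∈ S, f y ≤ y1 * (N + 1)) :
    μ0 {ω | uAggFrom {0} ω k1 ⊆ B1 ∧ z ∉ uAggFrom {0} ω N} ≤
      ENNReal.ofReal (Real.exp (-((y0 - y1)^2 * (k1 + 1) / (4 * L * y0)))) := by
  classical
  have hy0 : 0 < y0 := lt_of_le_of_lt hy1 hy01
  set j : ℝ := (k1:ℝ) + 1 with hj
  have hj1 : 1 ≤ j := by rw [hj]; linarith [Nat.cast_nonneg (α := ℝ) k1]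
  set lam : ℝ := (y0 - y1) * j / (2 * L * y0) with hlam
  have hlam0 : 0 ≤ lam := div_nonneg (mul_nonneg (by linarith) (by linarith)) (by positivity)
  have hlamL : lam * L = (y0 - y1) / y0 * (j / 2) := by rw [hlam]; field_simp
  have hlamL2 : lam * L ≤ j / 2 := by
    rw [hlamL]
    have : (y0 - y1)/y0 ≤ 1 := by rw [div_le_one hy0]; linarith
    nlinarith
  set h : ℕ → Finset (V d) → ℝ := fun k S =>
    if z ∉ S then Real.exp (-(lam * (1 - lam*L/((k:ℝ)+1)) * ((∑ v ∈ S, f v)/((k:ℝ)+1)))) else 0 with hh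
  have hh0 : ∀ k S, 0 ≤ h k S := by
    intro k S; simp only [hh]; split_ifs; swap
    · exact (Real.exp_pos _).le
    · exact le_rfl
  have key := super_agg_from hd h (fun S => S ⊆ B1) hh0 k1 N hkN
    (Real.exp (-(lam * (1 - lam*L/j) * y0))) ?_ ?_ (Real.exp (-(lam * y1))) (Real.exp_pos _)
    (fun S => z ∉ S) ?_ (Real.exp_pos _).le
  · refine key.trans (ENNReal.ofReal_le_ofReal ?_)
    rw [← Real.exp_sub]
    apply Real.exp_le_exp.2
    apply le_of_eq
    have : lam * L / j = (y0 - y1)/(2*y0) := by rw [hlamL]; field_simp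
    rw [this, hlam]
    field_simp
    ring
  · intro k S hk hS
    by_cases hz : z ∈ S
    · have : ∀ y, h (k+1) (insert y S) = 0 := fun y => by
        simp only [hh]; rw [if_neg]; simp [hz]
      simp only [this, mul_zero, Finset.sum_const_zero]
      exact mul_nonneg (by positivity) (hh0 _ _)
    · have hcard : (S.card : ℝ) = (k:ℝ) + 1 := by rw [hS.1]; push_cast; ring
      have hkj : j ≤ (k:ℝ) + 1 := by rw [hj]; have : (k1:ℝ) ≤ k := by exact_mod_cast hk
                                     linarith
      have q := late_step hd f L hL hf0 hfL z hsub S hS.ne hz lam hlam0 (by rw [hcard]; linarith)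
      rw [hcard] at q
      have e1 : h k S = Real.exp (-(lam * (1 - lam*L/((k:ℝ)+1)) * ((∑ v ∈ S, f v)/((k:ℝ)+1)))) := by
        simp only [hh]; rw [if_pos hz]
      rw [e1]
      refine le_trans ?_ q
      refine Finset.sum_le_sum fun x hx => Finset.sum_le_sum fun y hy => ?_
      apply mul_le_mul_of_nonneg_left _ (hp_nonneg _ _ _)
      simp only [hh]
      split_ifs; swap
      · push_cast; exact le_rfl
      · exact (Real.exp_pos _).le
  · intro S hS hB
    simp only [hh]
    split_ifs; swap
    · apply Real.exp_le_exp.2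
      rw [neg_le_neg_iff]
      apply mul_le_mul_of_nonneg_left
      · rw [le_div_iff₀ (by linarith)]
        have := Finset.card_nsmul_le_sum S f y0 (fun x hx => h0 x (hB hx))
        rw [hS.1, nsmul_eq_mul] at this
        push_cast at this
        linarith
      · apply mul_nonneg hlam0
        have : lam * L / j ≤ 1/2 := by rw [div_le_iff₀ (by linarith)]; linarith
        linarith
    · exact (Real.exp_pos _).le
  · intro S hS hz
    simp only [hh]
    rw [if_pos hz]
    apply Real.exp_le_exp.2
    rw [neg_le_neg_iff]
    have q1 : (∑ v ∈ S, f v)/((N:ℝ)+1) ≤ y1 := by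
      rw [div_le_iff₀ (by positivity)]
      exact h1 S (by rw [hS.1])
    have q2 : 0 ≤ (∑ v ∈ S, f v)/((N:ℝ)+1) :=
      div_nonneg (Finset.sum_nonneg fun v _ => hf0 v) (by positivity)
    have q3 : 0 ≤ lam * L / ((N:ℝ)+1) := by positivity
    have q4 : lam * (1 - lam*L/((N:ℝ)+1)) ≤ lam := by
      have := mul_nonneg hlam0 q3
      nlinarith
    calc _ ≤ lam * ((∑ v ∈ S, f v)/((N:ℝ)+1)) := mul_le_mul_of_nonneg_right q4 q2
      _ ≤ _ := mul_le_mul_of_nonneg_left q1 hlam0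

end

section

lemma ev_rpow_ge (A s : ℝ) (hs : 0 < s) : ∀ᶠ n : ℕ in atTop, A ≤ (n:ℝ)^s :=
  ((tendsto_rpow_atTop hs).comp tendsto_natCast_atTop_atTop).eventually_ge_atTop A

lemma ev_rpow_small (A s : ℝ) (hs : 0 < s) : ∀ᶠ n : ℕ in atTop, A * (n:ℝ)^(-s) ≤ 1 := by
  filter_upwards [ev_rpow_ge A s hs, eventually_gt_atTop 0] with n h1 h2
  have : (0:ℝ) < n := by exact_mod_cast h2
  rw [Real.rpow_neg this.le, ← div_eq_mul_inv, div_le_one (by positivity)]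
  exact h1

lemma ev_log_small (A s : ℝ) (hs : 0 < s) :
    ∀ᶠ n : ℕ in atTop, A * Real.log n * (n:ℝ)^(-s) ≤ 1 := by
  have h := (isLittleO_log_rpow_atTop hs).bound (c := (|A|+1)⁻¹) (by positivity)
  filter_upwards [tendsto_natCast_atTop_atTop.eventually h, eventually_gt_atTop 0] with n h1 h2
  have hn : (0:ℝ) < n := by exact_mod_cast h2
  have hlog : 0 ≤ Real.log n := Real.log_nonneg (by exact_mod_cast h2)
  have hp : 0 < (n:ℝ)^s := by positivity
  rw [Real.norm_eq_abs, Real.norm_eq_abs, abs_of_nonneg hlog, abs_of_pos hp] at h1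
  rw [Real.rpow_neg hn.le, ← div_eq_mul_inv, div_le_one hp]
  calc A * Real.log n ≤ (|A|+1) * Real.log n := by
        gcongr; linarith [le_abs_self A]
    _ ≤ (|A|+1) * ((|A|+1)⁻¹ * (n:ℝ)^s) := by gcongr
    _ = _ := by field_simp

lemma ev_exp_small (A p c s : ℝ) (hc : 0 < c) (hs : 0 < s) :
    ∀ᶠ n : ℕ in atTop, A * (n:ℝ)^p * Real.exp (-(c * (n:ℝ)^s)) ≤ (n:ℝ)^(-2:ℝ) := by
  have h := tendsto_rpow_mul_exp_neg_mul_atTop_nhds_zero ((p+2)/s) c hc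
  have h2 := (h.comp ((tendsto_rpow_atTop hs).comp tendsto_natCast_atTop_atTop)).const_mul A
  rw [mul_zero] at h2
  filter_upwards [h2.eventually_le_const (show (0:ℝ) < 1 by norm_num), eventually_gt_atTop 0] with n h1 h3
  have hn : (0:ℝ) < n := by exact_mod_cast h3
  simp only [Function.comp] at h1
  rw [← Real.rpow_mul hn.le, mul_div_cancel₀ _ hs.ne', Real.rpow_add hn] at h1
  have e : (n:ℝ)^(2:ℝ) * (n:ℝ)^(-2:ℝ) = 1 := by rw [← Real.rpow_add hn]; simp
  have h4 : 0 < (n:ℝ)^(-2:ℝ) := by positivity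
  calc A * (n:ℝ)^p * Real.exp (-(c * (n:ℝ)^s))
      = A * (n:ℝ)^p * Real.exp (-(c * (n:ℝ)^s)) * ((n:ℝ)^(2:ℝ) * (n:ℝ)^(-2:ℝ)) := by rw [e, mul_one]
    _ = (A * ((n:ℝ)^p * (n:ℝ)^(2:ℝ) * Real.exp (-c * (n:ℝ)^s))) * (n:ℝ)^(-2:ℝ) := by
        rw [neg_mul]; ring
    _ ≤ 1 * (n:ℝ)^(-2:ℝ) := by gcongr
    _ = _ := one_mul _

lemma card_ball_upper (d : ℕ) (hd : 0 < d) : ∃ W : ℝ, 1 ≤ W ∧ ∀ r : ℝ, 1 ≤ r →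
    ((ball d r).card : ℝ) ≤ W * r^d := by
  obtain ⟨w, hw, h⟩ := card_ball d hd
  refine ⟨w * (1 + Real.sqrt d)^d + 1, by have : 0 < w * (1 + Real.sqrt d)^d := by positivity
                                          linarith, ?_⟩
  intro r hr
  refine (h r (by linarith)).1.trans ?_
  have h1 : r + Real.sqrt d ≤ (1 + Real.sqrt d) * r := by nlinarith [Real.sqrt_nonneg (d:ℝ)]
  calc w * (r + Real.sqrt d)^d ≤ w * ((1 + Real.sqrt d) * r)^d := by gcongr
    _ = w * (1 + Real.sqrt d)^d * r^d := by rw [mul_pow]; ring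
    _ ≤ _ := by gcongr; linarith

lemma ev_bn_large (d : ℕ) (hd : 0 < d) : ∀ᶠ n : ℕ in atTop, n^(d-1) + 1 ≤ bn d n := by
  obtain ⟨w, hw, h⟩ := card_ball d hd
  have h1 : ∀ᶠ n : ℕ in atTop, 2 * Real.sqrt d ≤ n := tendsto_natCast_atTop_atTop.eventually_ge_atTop _
  have h2 : ∀ᶠ n : ℕ in atTop, 2 * 2^d / w ≤ (n:ℝ) := tendsto_natCast_atTop_atTop.eventually_ge_atTop _
  filter_upwards [h1, h2, eventually_ge_atTop 1] with n h1 h2 h3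
  have hn : (1:ℝ) ≤ n := by exact_mod_cast h3
  have h4 := (h n (by positivity)).2 (by linarith [Real.sqrt_nonneg (d:ℝ)])
  have h5 : ((n:ℝ)/2)^d ≤ ((n:ℝ) - Real.sqrt d)^d := by
    apply pow_le_pow_left₀ (by positivity); linarith
  have h6 : ((n^(d-1) + 1 : ℕ):ℝ) ≤ bn d n := by
    push_cast
    have e : (n:ℝ)^d = (n:ℝ)^(d-1) * n := by rw [← pow_succ]; congr 1; omega
    have h7 : (1:ℝ) ≤ (n:ℝ)^(d-1) := one_le_pow₀ hn
    rw [div_le_iff₀ hw] at h2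
    calc (n:ℝ)^(d-1) + 1 ≤ (n:ℝ)^(d-1) * 2 := by linarith
      _ ≤ w * ((n:ℝ)/2)^d := by
          rw [div_pow, e, mul_div_assoc', le_div_iff₀ (by positivity)]
          calc (n:ℝ)^(d-1) * 2 * 2^d = (n:ℝ)^(d-1) * (2 * 2^d) := by ring
            _ ≤ (n:ℝ)^(d-1) * (n * w) := by gcongr
            _ = _ := by ring
      _ ≤ w * ((n:ℝ) - Real.sqrt d)^d := by gcongr
      _ ≤ _ := h4
  exact_mod_cast h6

variable {d : ℕ}

/-- quantitative inner bound for fixed parameters -/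
lemma inner_fixed (hd : 2 ≤ d) : ∃ C : ℝ, 1 ≤ C ∧ ∃ m0 : ℝ, 2 ≤ m0 ∧ ∀ (n k1 : ℕ) (m ε : ℝ), 2 ≤ n →
    m0 ≤ m → 64*m ≤ n → 0<ε → ε ≤ 1/10 → C*(1/m + m/n*Real.log n) ≤ ε^2/8 → k1 + 1 ≤ bn d n →
    μ0 {ω | uAggFrom {0} ω k1 ⊆ ball d m ∧
      ¬ ball d (n*(1-ε)) ⊆ uAggFrom ({0} : Finset (V d)) ω (bn d n - 1)} ≤
      ENNReal.ofReal ((bn d n : ℝ) *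
        Real.exp (-(ε^4 * n^2 * (k1 + 1) / (1280 * C * Real.log n * bn d n)))) := by
  have hd0 : 0 < d := by omega
  obtain ⟨C1, hC1, m0, hm0, hmain⟩ := green_main d hd
  obtain ⟨C2, hC2, hbound⟩ := green_bound d hd
  refine ⟨max C1 C2, le_max_of_le_left hC1, m0, hm0, ?_⟩
  intro n k1 m ε hn hm hmn hε hε1 hC hk
  have hn2 : (2:ℝ) ≤ n := by exact_mod_cast hn
  set b : ℝ := (bn d n : ℝ) with hb
  have hb1 : 1 ≤ b := by rw [hb]; exact_mod_cast (by omega : 1 ≤ bn d n)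
  have hlog : 0 < Real.log n := Real.log_pos (by linarith)
  set L : ℝ := max C1 C2 * Real.log n with hL
  have hCpos : 0 < max C1 C2 := lt_of_lt_of_le (by linarith) (le_max_left C1 C2)
  have hLpos : 0 < L := mul_pos hCpos hlog
  have hNb : ((bn d n - 1 : ℕ):ℝ) + 1 = b := by
    rw [Nat.cast_sub (by omega)]; push_cast; ring
  have single : ∀ z ∈ ball d (n*(1-ε)),
      μ0 {ω | uAggFrom {0} ω k1 ⊆ ball d m ∧ z ∉ uAggFrom ({0} : Finset (V d)) ω (bn d n - 1)} ≤
      ENNReal.ofReal (Real.exp (-(ε^4 * n^2 * (k1 + 1) / (1280 * max C1 C2 * Real.log n * b)))) := by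
    intro z hz
    have hzn : z ∈ ball d n := ball_mono (by nlinarith) hz
    set f := green (ball d n) z with hf
    set T := ∑ y ∈ ball d n, f y with hT
    have hT0 : 0 ≤ T := Finset.sum_nonneg fun y _ => green_nonneg hd0 _ _ _
    have hT1 : T ≤ ((n:ℝ)+1)^2 := by
      have := green_total_le hd0 n z hzn
      have := nsq_nonneg z
      simp only [hT, hf]; linarith
    set y1 := T / b with hy1
    set δ := ε^2*n^2/8 / b with hδ
    have hδ0 : 0 < δ := by positivity
    have hfL : ∀ y, f y ≤ L := by
      intro y
      refine (hbound n hn z hzn y).trans ?_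
      have h1 : (nsq (y - z) + 1)^(1 - (d/2:ℝ)) ≤ 1 := by
        apply Real.rpow_le_one_of_one_le_of_nonpos (by linarith [nsq_nonneg (y - z)])
        have : (2:ℝ) ≤ d := by exact_mod_cast hd
        linarith
      have h2 : C2 * Real.log n ≤ L := by
        rw [hL]; gcongr; exact le_max_right _ _
      have h3 : 0 ≤ C2 * Real.log n := by positivity
      calc _ ≤ C2 * Real.log n * 1 := by gcongr
        _ ≤ L := by linarith
    have key := late_bound hd0 f L hLpos (fun y => green_nonneg hd0 _ _ _) hfL z
      (fun y hy => green_sub hd0 _ _ hy) (ball d m) k1 (bn d n - 1) (by omega) (y1 + δ) y1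
      (by positivity) (by linarith) ?_ ?_
    · refine key.trans (ENNReal.ofReal_le_ofReal (Real.exp_le_exp.2 ?_))
      rw [neg_le_neg_iff, add_sub_cancel_left]
      have hy0 : y1 + δ ≤ 5 * n^2 / b := by
        rw [hy1, hδ, ← add_div]
        apply div_le_div_of_nonneg_right _ (by linarith)
        have : ε^2 ≤ 1 := by nlinarith
        have : ε^2 * n^2 ≤ 1 * (n:ℝ)^2 := by gcongr
        nlinarith
      have hy00 : 0 < y1 + δ := by positivity
      rw [div_le_div_iff₀ (by positivity) (by positivity)]
      calc ε^4 * n^2 * (k1+1) * (4 * L * (y1 + δ))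
          ≤ ε^4 * n^2 * (k1+1) * (4 * L * (5 * n^2 / b)) := by gcongr
        _ = δ^2 * (k1+1) * (1280 * max C1 C2 * Real.log n * b) := by
            rw [hδ, hL]; field_simp; ring
    · intro x hx
      have h1 := hmain n m ε hm hmn hε hε1 (le_trans (mul_le_mul_of_nonneg_right (le_max_left C1 C2) (by
        have : 0 < m := by linarith
        positivity)) hC) z hz x hx
      rw [hy1, hδ, ← add_div, div_le_iff₀ (by linarith)]
      exact h1
    · intro S hS
      rw [hNb, hy1, div_mul_cancel₀ _ (by linarith)]
      classical
      calc ∑ y ∈ S, f y = ∑ y ∈ S ∩ ball d n, f y := by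
            rw [← Finset.sum_inter_add_sum_sdiff S (ball d n) f]
            have : ∑ y ∈ S \ ball d n, f y = 0 :=
              Finset.sum_eq_zero fun y hy => green_off hd0 _ _ (Finset.mem_sdiff.1 hy).2
            rw [this, add_zero]
        _ ≤ T := Finset.sum_le_sum_of_subset_of_nonneg Finset.inter_subset_right
              fun y _ _ => green_nonneg hd0 _ _ _
  have hsub : {ω | uAggFrom {0} ω k1 ⊆ ball d m ∧
      ¬ ball d (n*(1-ε)) ⊆ uAggFrom ({0} : Finset (V d)) ω (bn d n - 1)} ⊆
      ⋃ z ∈ ball d (n*(1-ε)), {ω | uAggFrom {0} ω k1 ⊆ ball d m ∧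
        z ∉ uAggFrom ({0} : Finset (V d)) ω (bn d n - 1)} := by
    rintro ω ⟨q1, q2⟩
    obtain ⟨z, hz, hz1⟩ := Finset.not_subset.1 q2
    exact Set.mem_biUnion (Finset.mem_coe.2 hz) ⟨q1, hz1⟩
  refine (measure_mono hsub).trans ((measure_biUnion_finset_le _ _).trans ?_)
  refine (Finset.sum_le_sum single).trans ?_
  rw [Finset.sum_const, nsmul_eq_mul, ← ENNReal.ofReal_natCast, ← ENNReal.ofReal_mul (by positivity)]
  apply ENNReal.ofReal_le_ofReal
  gcongr
  rw [hb, bn]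
  exact_mod_cast Finset.card_le_card (ball_mono (by nlinarith))

end

section

lemma bc_lemma (s : ℕ → Set ℝ) (h : ∀ᶠ n : ℕ in atTop, μ0 (s n) ≤ ENNReal.ofReal ((n:ℝ)^(-2:ℝ))) :
    ∀ᵐ ω ∂μ0, ∀ᶠ n in atTop, ω ∉ s n := by
  classical
  set s' : ℕ → Set ℝ := fun n => if μ0 (s n) ≤ ENNReal.ofReal ((n:ℝ)^(-2:ℝ)) then s n else ∅ with hs'
  have h1 : ∑' n, μ0 (s' n) ≠ ⊤ := by
    have hsum : Summable (fun n : ℕ => (n:ℝ)^(-2:ℝ)) := Real.summable_nat_rpow.2 (by norm_num)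
    refine ne_top_of_le_ne_top hsum.tsum_ofReal_ne_top (ENNReal.tsum_le_tsum fun n => ?_)
    simp only [hs']
    split_ifs with hh
    · exact hh
    · simp
  filter_upwards [ae_eventually_notMem h1] with ω hω
  filter_upwards [hω, h] with n q1 q2
  simp only [hs'] at q1
  rwa [if_pos q2] at q1

variable {d : ℕ}

lemma inner_ev (hd : 2 ≤ d) : ∀ᶠ n : ℕ in atTop,
    μ0 {ω | uAggFrom {0} ω (n^(d-1)) ⊆ ball d ((n:ℝ)^(1 - 8 * (1/(16*(d:ℝ))))) ∧
      ¬ ball d (n*(1-(n:ℝ)^(-(1/(16*(d:ℝ)))))) ⊆ uAggFrom ({0} : Finset (V d)) ω (bn d n - 1)} ≤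
      ENNReal.ofReal ((n:ℝ)^(-2:ℝ)) := by
  have hd0 : 0 < d := by omega
  have hdR : (2:ℝ) ≤ d := by exact_mod_cast hd
  set c : ℝ := 1/(16*(d:ℝ)) with hc
  have hc0 : 0 < c := by positivity
  have hc1 : c ≤ 1/32 := by
    rw [hc]; apply div_le_div_of_nonneg_left <;> linarith
  obtain ⟨C, hC, m0, hm0, hfix⟩ := inner_fixed hd
  obtain ⟨W, hW, hcard⟩ := card_ball_upper d hd0
  filter_upwards [eventually_ge_atTop 2, ev_rpow_ge m0 (1-8*c) (by linarith),
    ev_rpow_small 64 (8*c) (by linarith), ev_rpow_small 10 c hc0,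
    ev_rpow_small (16*C) (1-10*c) (by linarith), ev_log_small (16*C) (6*c) (by linarith),
    ev_bn_large d hd0, ev_log_small (1280*C*W) (1/4) (by norm_num),
    ev_exp_small W d 1 (1/2) (by norm_num) (by norm_num)] with n hn2 h1 h2 h3 h4 h5 h6 h7 h8
  have hn : (0:ℝ) < n := by exact_mod_cast (by omega : 0 < n)
  have hn1 : (1:ℝ) ≤ n := by exact_mod_cast (by omega : 1 ≤ n)
  have hlog : 0 < Real.log n := Real.log_pos (by exact_mod_cast (by omega : 1 < n))
  have em : (n:ℝ)^(1-8*c) = n * (n:ℝ)^(-(8*c)) := by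
    rw [sub_eq_add_neg, Real.rpow_add hn, Real.rpow_one]
  have hb : (bn d n : ℝ) ≤ W * (n:ℝ)^d := hcard n hn1
  have hbpos : (0:ℝ) < bn d n := by exact_mod_cast (by omega : 0 < bn d n)
  refine (hfix n (n^(d-1)) _ ((n:ℝ)^(-c)) hn2 h1 ?_ (by positivity) (by linarith) ?_ h6).trans
    (ENNReal.ofReal_le_ofReal ?_)
  · rw [em]
    calc 64 * (n * (n:ℝ)^(-(8*c))) = n * (64 * (n:ℝ)^(-(8*c))) := by ring
      _ ≤ n * 1 := by gcongr
      _ = n := mul_one _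
  · have e2 : ((n:ℝ)^(-c))^2 = (n:ℝ)^(-(2*c)) := by
      rw [← Real.rpow_natCast, ← Real.rpow_mul hn.le]; congr 1; push_cast; ring
    have e3 : 1/(n:ℝ)^(1-8*c) = (n:ℝ)^(-(1-10*c)) * (n:ℝ)^(-(2*c)) := by
      rw [one_div, ← Real.rpow_neg hn.le, ← Real.rpow_add hn]; congr 1; ring
    have e4 : (n:ℝ)^(1-8*c)/n = (n:ℝ)^(-(6*c)) * (n:ℝ)^(-(2*c)) := by
      rw [em, mul_div_cancel_left₀ _ hn.ne', ← Real.rpow_add hn]; congr 1; ring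
    rw [e2, e3, e4]
    have hp : 0 < (n:ℝ)^(-(2*c)) := by positivity
    have q1 := mul_le_mul_of_nonneg_right h4 hp.le
    have q2 := mul_le_mul_of_nonneg_right h5 hp.le
    linarith
  · refine le_trans ?_ h8
    rw [one_mul, Real.rpow_natCast]
    have hmain : (n:ℝ)^(1/2:ℝ) ≤ ((n:ℝ)^(-c))^4 * n^2 * ((n^(d-1) : ℕ) + 1) / (1280 * C * Real.log n * bn d n) := by
      rw [le_div_iff₀ (by positivity)]
      have e4 : ((n:ℝ)^(-c))^4 = (n:ℝ)^(-(4*c)) := by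
        rw [← Real.rpow_natCast, ← Real.rpow_mul hn.le]; congr 1; push_cast; ring
      rw [Real.rpow_neg hn.le, ← div_eq_mul_inv, div_le_one (by positivity)] at h7
      have ed : (n:ℝ)^d * n = n^2 * (n:ℝ)^(d-1) := by
        rw [← pow_succ, ← pow_add]; congr 1; omega
      have ep : (n:ℝ)^(1/2:ℝ) * (n:ℝ)^(1/4:ℝ) ≤ (n:ℝ)^(-(4*c)) * n := by
        rw [← Real.rpow_add hn]
        nth_rw 3 [← Real.rpow_one (n:ℝ)]
        rw [← Real.rpow_add hn]
        apply Real.rpow_le_rpow_of_exponent_le hn1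
        linarith
      calc (n:ℝ)^(1/2:ℝ) * (1280 * C * Real.log n * bn d n)
          ≤ (n:ℝ)^(1/2:ℝ) * (1280 * C * Real.log n * (W * (n:ℝ)^d)) := by gcongr
        _ = (n:ℝ)^(1/2:ℝ) * (1280 * C * W * Real.log n) * (n:ℝ)^d := by ring
        _ ≤ (n:ℝ)^(1/2:ℝ) * (n:ℝ)^(1/4:ℝ) * (n:ℝ)^d := by gcongr
        _ ≤ (n:ℝ)^(-(4*c)) * n * (n:ℝ)^d := by gcongr
        _ = (n:ℝ)^(-(4*c)) * (n^2 * (n:ℝ)^(d-1)) := by rw [← ed]; ring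
        _ ≤ _ := by
            rw [e4, mul_assoc]
            gcongr
            push_cast; linarith
    exact mul_le_mul hb (Real.exp_le_exp.2 (neg_le_neg hmain)) (Real.exp_pos _).le (by positivity)

/-- convenient eventual form of the outer bound -/
lemma outer_ev (hd : 2 ≤ d) (N : ℕ → ℕ) (ρ m : ℕ → ℝ) (q : ℕ) (M α β s : ℝ) (hM : 0 < M)
    (hα : α ≤ 0) (hs : 0 < s) (t : ℝ) (ht : 0 < t)
    (hN : ∀ᶠ n in atTop, ((N n : ℕ) : ℝ) ≤ (n:ℝ)^q)
    (hρ : ∀ᶠ n in atTop, 0 ≤ ρ n) (hm : ∀ᶠ n in atTop, 1 ≤ m n)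
    (hm2 : ∀ᶠ n : ℕ in atTop, (m n)^(2/(d:ℝ)) ≤ M * (n:ℝ)^(-(2*α) - t))
    (hs2 : α + β = s) :
    ∀ᶠ n : ℕ in atTop, μ0 {ω | ((((uAggFrom ({0} : Finset (V d)) ω (N n)) \ ball d (ρ n - 1)).card : ℕ) : ℝ) ≤ m n ∧
      ¬ (uAggFrom ({0} : Finset (V d)) ω (N n) ⊆ ball d (ρ n + (n:ℝ)^β))} ≤
      ENNReal.ofReal ((n:ℝ)^(-2:ℝ)) := by
  classical
  have hd0 : 0 < d := by omega
  obtain ⟨C, hC, hout⟩ := outer_bound hd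
  obtain ⟨W, hW, hcard⟩ := card_ball_upper d hd0
  have hCn : ∀ᶠ n : ℕ in atTop, C + 4 ≤ (n:ℝ) := tendsto_natCast_atTop_atTop.eventually_ge_atTop _
  filter_upwards [hN, hρ, hm, hm2, hCn, ev_log_small (C*(q+1)*M) t ht,
    ev_exp_small W ((((q+1)*d + 2*(q+1) : ℕ)):ℝ) (1/2) s (by norm_num) hs, eventually_ge_atTop 2] with
    n hN hρ hm hm2 hCn h1 h2 hn2
  have hn : (0:ℝ) < n := by exact_mod_cast (by omega : 0 < n)
  have hn1 : (1:ℝ) ≤ n := by exact_mod_cast (by omega : 1 ≤ n)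
  have hlog : 0 < Real.log n := Real.log_pos (by exact_mod_cast (by omega : 1 < n))
  have hq1 : (1:ℝ) ≤ (n:ℝ)^q := one_le_pow₀ hn1
  have hNC : (N n : ℝ) + (C + 2) ≤ (n:ℝ)^(q+1) := by
    rw [pow_succ]
    have : (n:ℝ)^q * (C+4) ≤ (n:ℝ)^q * n := by gcongr
    have : 1 * (C+2) ≤ (n:ℝ)^q * (C+2) := by gcongr
    linarith
  have hlogN : Real.log (N n + C) ≤ (q+1) * Real.log n := by
    calc Real.log (N n + C) ≤ Real.log ((n:ℝ)^(q+1)) := by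
          apply Real.log_le_log
          · have := Nat.cast_nonneg (α := ℝ) (N n)
            linarith
          · linarith
      _ = _ := by rw [Real.log_pow]; push_cast; ring
  have hlogN0 : 0 ≤ Real.log (N n + C) :=
    Real.log_nonneg (by have := Nat.cast_nonneg (α := ℝ) (N n); linarith)
  have e2 : ((n:ℝ)^α)^2 = (n:ℝ)^(2*α) := by
    rw [← Real.rpow_natCast, ← Real.rpow_mul hn.le]; congr 1; push_cast; ring
  refine (hout (N n) (ρ n) (m n) ((n:ℝ)^α) ((n:ℝ)^β) hρ hm (by positivity)
    (Real.rpow_le_one_of_one_le_of_nonpos hn1 hα) (by positivity) ?_).trans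
    (ENNReal.ofReal_le_ofReal ?_)
  · have hmp : 0 ≤ (m n)^(2/(d:ℝ)) := Real.rpow_nonneg (by linarith) _
    calc ((n:ℝ)^α)^2 * (C * Real.log (N n + C) * (m n)^(2/(d:ℝ)))
        ≤ ((n:ℝ)^α)^2 * (C * ((q+1) * Real.log n) * (M * (n:ℝ)^(-(2*α) - t))) := by gcongr
      _ = C*(q+1)*M * Real.log n * ((n:ℝ)^(2*α) * (n:ℝ)^(-(2*α) - t)) := by rw [e2]; ring
      _ = C*(q+1)*M * Real.log n * (n:ℝ)^(-t) := by
          rw [← Real.rpow_add hn]; congr 2; ring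
      _ ≤ 1 := h1
  · refine le_trans ?_ h2
    have e3 : (n:ℝ)^α * (n:ℝ)^β / 2 = 1/2 * (n:ℝ)^s := by
      rw [← Real.rpow_add hn, hs2]; ring
    rw [e3, Real.rpow_natCast, ← mul_assoc]
    apply mul_le_mul_of_nonneg_right _ (Real.exp_pos _).le
    have hb : ((ball d (N n)).card : ℝ) ≤ W * ((n:ℝ)^(q+1))^d := by
      refine le_trans ?_ (hcard _ (one_le_pow₀ hn1))
      exact Nat.cast_le.2 (Finset.card_le_card (ball_mono (by linarith)))
    have hb2 : ((N n : ℝ)+2)^2 ≤ ((n:ℝ)^(q+1))^2 := by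
      have := Nat.cast_nonneg (α := ℝ) (N n)
      apply pow_le_pow_left₀ (by positivity)
      linarith
    calc ((ball d (N n)).card : ℝ) * ((N n : ℝ)+2)^2 ≤ (W * ((n:ℝ)^(q+1))^d) * ((n:ℝ)^(q+1))^2 := by
          gcongr
      _ = _ := by rw [← pow_mul, ← pow_mul, mul_assoc, ← pow_add]; congr 2; ring

lemma early_ev (hd : 2 ≤ d) : ∀ᶠ n : ℕ in atTop,
    μ0 {ω | ¬ uAggFrom ({0} : Finset (V d)) ω (n^(d-1)) ⊆ ball d ((n:ℝ)^(1 - 8 * (1/(16*(d:ℝ)))))} ≤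
      ENNReal.ofReal ((n:ℝ)^(-2:ℝ)) := by
  classical
  have hd0 : 0 < d := by omega
  have hdR : (2:ℝ) ≤ d := by exact_mod_cast hd
  have hdc : (1/(16*(d:ℝ))) * d = 1/16 := by field_simp
  set c : ℝ := 1/(16*(d:ℝ)) with hc
  have hc0 : 0 < c := by positivity
  have hc1 : c ≤ 1/32 := by
    rw [hc]; apply div_le_div_of_nonneg_left <;> linarith
  have key := outer_ev hd (fun n => n^(d-1)) (fun _ => 0) (fun n => ((n^(d-1) + 1 : ℕ):ℝ)) (d-1)
    (2^(2/(d:ℝ))) (-(1-14*c)) (1-8*c) (6*c) (by positivity) (by linarith) (by linarith) (4*c) (by linarith)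
    (Eventually.of_forall fun n => by push_cast; exact le_rfl)
    (Eventually.of_forall fun n => le_rfl)
    (Eventually.of_forall fun n => by push_cast; have : (0:ℝ) ≤ (n:ℝ)^(d-1) := by positivity
                                      linarith)
    (by
      filter_upwards [eventually_ge_atTop 1] with n hn
      have hnR : (1:ℝ) ≤ n := by exact_mod_cast hn
      have hn0 : (0:ℝ) < n := by linarith
      have h1 : (1:ℝ) ≤ (n:ℝ)^(d-1) := one_le_pow₀ hnR
      calc (((n^(d-1) + 1 : ℕ):ℝ))^(2/(d:ℝ)) ≤ (2 * (n:ℝ)^(d-1))^(2/(d:ℝ)) := by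
            apply Real.rpow_le_rpow (by positivity) _ (by positivity)
            push_cast; linarith
        _ = 2^(2/(d:ℝ)) * (n:ℝ)^(-(2 * -(1-14*c)) - 4*c) := by
            rw [Real.mul_rpow (by norm_num) (by positivity), ← Real.rpow_natCast, ← Real.rpow_mul hn0.le]
            congr 2
            rw [Nat.cast_sub (by omega)]
            push_cast
            have : (2:ℝ)/d = 32 * c := by rw [hc]; field_simp; norm_num
            rw [this]
            nlinarith [hdc])
    (by ring)
  filter_upwards [key] with n hn
  refine le_trans (measure_mono_ae ?_) hn
  filter_upwards [inv_ae hd0 (n^(d-1))] with ω hω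
  intro q
  refine ⟨?_, ?_⟩
  · rw [← hω.1]
    exact_mod_cast Finset.card_le_card Finset.sdiff_subset
  · rw [zero_add]; exact q

lemma late_outer_ev (hd : 2 ≤ d) : ∀ᶠ n : ℕ in atTop,
    μ0 {ω | ball d (n*(1-(n:ℝ)^(-(1/(16*(d:ℝ)))))) ⊆ uAggFrom ({0} : Finset (V d)) ω (bn d n - 1) ∧
      ¬ uAggFrom ({0} : Finset (V d)) ω (bn d n - 1) ⊆
        ball d (n*(1-(n:ℝ)^(-(1/(16*(d:ℝ))))) + 1 + (n:ℝ)^(1 - 2 * (1/(64*(d:ℝ)^2))))} ≤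
      ENNReal.ofReal ((n:ℝ)^(-2:ℝ)) := by
  classical
  have hd0 : 0 < d := by omega
  have hdR : (2:ℝ) ≤ d := by exact_mod_cast hd
  set c : ℝ := 1/(16*(d:ℝ)) with hc
  have hc0 : 0 < c := by positivity
  have hc1 : c ≤ 1/32 := by
    rw [hc]; apply div_le_div_of_nonneg_left <;> linarith
  set e : ℝ := 1/(64*(d:ℝ)^2) with he
  have he0 : 0 < e := by positivity
  have he1 : e ≤ 1/64 := by
    rw [he]; apply div_le_div_of_nonneg_left <;> nlinarith
  have hce : c * (2/(d:ℝ)) = 8 * e := by rw [hc, he]; field_simp; norm_num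
  obtain ⟨w, hw, hcb⟩ := card_ball d hd0
  obtain ⟨W, hW, hcard⟩ := card_ball_upper d hd0
  set M0 : ℝ := w * ((1 + Real.sqrt d)^d * (d * (1 + 2 * Real.sqrt d))) + 1 with hM0
  have hM0pos : 1 ≤ M0 := by
    have : 0 ≤ w * ((1 + Real.sqrt d)^d * (d * (1 + 2 * Real.sqrt d))) := by positivity
    linarith
  have hWn : ∀ᶠ n : ℕ in atTop, W ≤ (n:ℝ) := tendsto_natCast_atTop_atTop.eventually_ge_atTop _
  have key := outer_ev hd (fun n => bn d n - 1) (fun n => n*(1-(n:ℝ)^(-c)) + 1)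
    (fun n => M0 * ((n:ℝ)^(-c) * (n:ℝ)^d)) (d+1)
    (M0^(2/(d:ℝ))) (-(1-3*e)) (1-2*e) e (by positivity) (by linarith) he0 (2*e) (by linarith)
    (by
      filter_upwards [eventually_ge_atTop 1, hWn] with n hn hWn
      have hnR : (1:ℝ) ≤ n := by exact_mod_cast hn
      have h1 : (bn d n : ℝ) ≤ W * (n:ℝ)^d := hcard n hnR
      have h2 : ((bn d n - 1 : ℕ):ℝ) ≤ bn d n := by exact_mod_cast Nat.sub_le _ _
      calc _ ≤ W * (n:ℝ)^d := h2.trans h1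
        _ ≤ n * (n:ℝ)^d := by gcongr
        _ = _ := by ring)
    (by
      filter_upwards [eventually_ge_atTop 1, ev_rpow_small 1 c hc0] with n hn h1
      have : (0:ℝ) ≤ n * (1 - (n:ℝ)^(-c)) := mul_nonneg (by positivity) (by linarith)
      linarith)
    (by
      filter_upwards [eventually_ge_atTop 1] with n hn
      have hnR : (1:ℝ) ≤ n := by exact_mod_cast hn
      have hn0 : (0:ℝ) < n := by linarith
      have : 1 ≤ (n:ℝ)^(-c) * (n:ℝ)^d := by
        rw [← Real.rpow_natCast, ← Real.rpow_add hn0]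
        apply Real.one_le_rpow hnR; linarith
      nlinarith)
    (by
      filter_upwards [eventually_ge_atTop 1] with n hn
      have hnR : (1:ℝ) ≤ n := by exact_mod_cast hn
      have hn0 : (0:ℝ) < n := by linarith
      apply le_of_eq
      rw [Real.mul_rpow (by linarith) (by positivity), ← Real.rpow_natCast, ← Real.rpow_add hn0,
        ← Real.rpow_mul hn0.le]
      congr 2
      have : (d:ℝ) * (2/(d:ℝ)) = 2 := by field_simp
      linarith)
    (by ring)
  filter_upwards [key, eventually_ge_atTop 1, ev_rpow_small 2 c hc0,
    ev_rpow_ge (2*Real.sqrt d) 1 (by norm_num), ev_rpow_ge 1 (1-c) (by linarith)] with n hn hn1 h1 h2 h3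
  refine le_trans (measure_mono_ae ?_) hn
  filter_upwards [inv_ae hd0 (bn d n - 1)] with ω hω
  rintro ⟨q1, q2⟩
  refine ⟨?_, q2⟩
  have hnR : (1:ℝ) ≤ n := by exact_mod_cast hn1
  have hn0 : (0:ℝ) < n := by linarith
  rw [Real.rpow_one] at h2
  set A := uAggFrom ({0} : Finset (V d)) ω (bn d n - 1) with hA
  rw [add_sub_cancel_right]
  have hbpos : 1 ≤ bn d n := Finset.card_pos.2 ⟨0, by rw [mem_ball, nm_zero_le]; positivity⟩
  have hAc : A.card = bn d n := by rw [hω.1]; omega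
  have hcd := Finset.cast_card_sdiff (R := ℝ) q1
  rw [hcd, hAc]
  set ε := (n:ℝ)^(-c) with hε
  have hε0 : 0 < ε := by positivity
  have hs0 := Real.sqrt_nonneg (d:ℝ)
  have hr0 : Real.sqrt d ≤ n*(1-ε) := by
    have : (n:ℝ) * (1/2) ≤ n * (1-ε) := by gcongr; linarith
    linarith
  have hup := (hcb n hn0.le).1
  have hlo := (hcb (n*(1-ε)) (by linarith)).2 hr0
  have hbn : (bn d n : ℝ) = ((ball d n).card : ℝ) := rfl
  rw [hbn]
  set a := (n:ℝ) + Real.sqrt d with ha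
  set b := (n:ℝ)*(1-ε) - Real.sqrt d with hb
  have hb0 : 0 ≤ b := by linarith
  have hab : a - b = n * ε + 2 * Real.sqrt d := by rw [ha, hb]; ring
  have hba : b ≤ a := by have : 0 ≤ n * ε := by positivity
                         linarith
  have hnε : 1 ≤ n * ε := by
    have : (n:ℝ)^(1-c) = n * ε := by rw [sub_eq_add_neg, Real.rpow_add hn0, Real.rpow_one]
    linarith
  have hpow : a^d - b^d ≤ d * a^(d-1) * (a - b) := by
    have ha0 : 0 < a := by linarith
    have hber := one_add_mul_le_pow (a := -((a-b)/a)) (by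
      have : (a-b)/a ≤ 1 := by rw [div_le_one ha0]; linarith
      linarith) d
    have e1 : 1 + -((a-b)/a) = b/a := by field_simp; ring
    rw [e1, div_pow, le_div_iff₀ (by positivity)] at hber
    have e2 : a^d = a^(d-1) * a := by rw [← pow_succ]; congr 1; omega
    have e3 : (1 + (d:ℝ) * -((a-b)/a)) * a^d = a^d - d * a^(d-1) * (a-b) := by
      rw [e2]; field_simp; ring
    linarith
  have han : a ≤ (1 + Real.sqrt d) * n := by rw [ha]; nlinarith
  have h4 : a - b ≤ (1 + 2 * Real.sqrt d) * (n * ε) := by rw [hab]; nlinarith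
  have h5 : a^(d-1) ≤ (1 + Real.sqrt d)^d * (n:ℝ)^(d-1) := by
    calc a^(d-1) ≤ ((1 + Real.sqrt d) * n)^(d-1) := by
          apply pow_le_pow_left₀ (by linarith) han
      _ = (1 + Real.sqrt d)^(d-1) * (n:ℝ)^(d-1) := mul_pow _ _ _
      _ ≤ _ := by
          gcongr
          · linarith
          · omega
  have hnd : (n:ℝ)^d = (n:ℝ)^(d-1) * n := by rw [← pow_succ]; congr 1; omega
  have h6 : d * a^(d-1) * (a - b) ≤ d * ((1 + Real.sqrt d)^d * (n:ℝ)^(d-1)) * ((1 + 2 * Real.sqrt d) * (n * ε)) := by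
    apply mul_le_mul _ h4 (by linarith) (by positivity)
    gcongr
  calc ((ball d n).card : ℝ) - ((ball d (n*(1-ε))).card : ℝ) ≤ w * a^d - w * b^d := by linarith
    _ = w * (a^d - b^d) := by ring
    _ ≤ w * (d * ((1 + Real.sqrt d)^d * (n:ℝ)^(d-1)) * ((1 + 2 * Real.sqrt d) * (n * ε))) := by
        apply mul_le_mul_of_nonneg_left (hpow.trans h6) hw.le
    _ = (w * ((1 + Real.sqrt d)^d * (d * (1 + 2 * Real.sqrt d)))) * (ε * (n:ℝ)^d) := by rw [hnd]; ring
    _ ≤ M0 * (ε * (n:ℝ)^d) := by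
        apply mul_le_mul_of_nonneg_right _ (by positivity)
        rw [hM0]; linarith

end

theorem statement0 (d : ℕ) (hd : 2 ≤ d) :
    ∃ c₁ c₂ C₁ C₂ : ℝ, 0 < c₁ ∧ 0 < c₂ ∧ 0 < C₁ ∧ 0 < C₂ ∧
      ∀ᵐ ω ∂μ0, ∀ᶠ n : ℕ in atTop,
        ball d ((n : ℝ) * (1 - C₁ * (n : ℝ) ^ (-c₁))) ⊆
            uAggFrom ({0} : Finset (V d)) ω (bn d n - 1) ∧
          uAggFrom ({0} : Finset (V d)) ω (bn d n - 1) ⊆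
            ball d ((n : ℝ) * (1 + C₂ * (n : ℝ) ^ (-c₂))) := by
  have hdR : (2:ℝ) ≤ d := by exact_mod_cast hd
  have hc1 : 1/(16*(d:ℝ)) ≤ 1/32 := by
    apply div_le_div_of_nonneg_left <;> linarith
  refine ⟨1/(16*(d:ℝ)), 2 * (1/(64*(d:ℝ)^2)), 1, 1, by positivity, by positivity, one_pos, one_pos, ?_⟩
  filter_upwards [bc_lemma _ (early_ev hd), bc_lemma _ (inner_ev hd), bc_lemma _ (late_outer_ev hd)]
    with ω w1 w2 w3
  filter_upwards [w1, w2, w3, eventually_ge_atTop 1, ev_rpow_ge 1 (1-1/(16*(d:ℝ))) (by linarith)]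
    with n q1 q2 q3 hn h3
  have hn0 : (0:ℝ) < n := by exact_mod_cast hn
  simp only [Set.mem_ofPred_eq, not_and, not_not] at q1 q2 q3
  have i1 := q2 q1
  refine ⟨by rw [one_mul]; exact i1, (q3 i1).trans (ball_mono ?_)⟩
  rw [sub_eq_add_neg, Real.rpow_add hn0, Real.rpow_one] at h3
  rw [sub_eq_add_neg 1 (2 * (1/(64*(d:ℝ)^2))), Real.rpow_add hn0, Real.rpow_one]
  linarith
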